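/- Let q ∈ ℂ* and let ξ be a ℂ-point of M_q. Then the kernel of the co-orbit map β^ξ contains the right ideal Σ_{f∈O(M_q)^{β-GL_q}} (f − f(ξ))·O(M_q), which in turn contains the right ideal Σ_{i=1}^N (τ_i − τ_i(ξ))·O(M_q). Moreover, if q is not a root of unity (or q = 1), then these two right ideals are equal. -/

import Mathlib

open TensorProduct

noncomputable section

/-- Number of inversions (the length) of a permutation of `Fin t`. -/
def invCount {t : ℕ} (σ : Equiv.Perm (Fin t)) : ℕ :=
  (Finset.univ.filter fun p : Fin t × Fin t => p.1 < p.2 ∧ σ p.2 < σ p.1).card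

/-- The principal quantum minor `[I|I]` of the matrix of generators `x`. -/
def qMinor {A : Type} [CommRing A] {M : Type} [Ring M] [Algebra A M] {N : ℕ}
    (q : A) (x : Fin N → Fin N → M) (I : Finset (Fin N)) : M :=
  ∑ σ : Equiv.Perm (Fin I.card),
    ((-q) ^ invCount σ) •
      ((List.finRange I.card).map fun k =>
        x ((I.orderIsoOfFin rfl) k).1 ((I.orderIsoOfFin rfl) (σ k)).1).prod

/-- The quantum determinant. -/
def qdet {A : Type} [CommRing A] {M : Type} [Ring M] [Algebra A M] {N : ℕ}
    (q : A) (x : Fin N → Fin N → M) : M :=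
  qMinor q x Finset.univ

/-- `w(I)`: the sum of the elements of `I` (with `{1, …, N}` indexing). -/
def wtSet {N : ℕ} (I : Finset (Fin N)) : ℕ := ∑ j ∈ I, (j.1 + 1)

/-- The weighted sum `τ_i` of principal quantum minors of size `i`. -/
def tauCoinv {A : Type} [CommRing A] {M : Type} [Ring M] [Algebra A M] {N : ℕ}
    (q qinv : A) (x : Fin N → Fin N → M) (i : ℕ) : M :=
  ∑ I ∈ Finset.univ.filter (fun I : Finset (Fin N) => I.card = i),
    qinv ^ (2 * wtSet I) • qMinor q x I

/-- The sum `σ_i` of all principal quantum minors of size `i`. -/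
def sigmaCoinv {A : Type} [CommRing A] {M : Type} [Ring M] [Algebra A M] {N : ℕ}
    (q : A) (x : Fin N → Fin N → M) (i : ℕ) : M :=
  ∑ I ∈ Finset.univ.filter (fun I : Finset (Fin N) => I.card = i), qMinor q x I

/-- The right adjoint coaction `β(h) = Σ h₂ ⊗ S(h₁)h₃`. -/
def adjBeta {A : Type} [CommRing A] {M G : Type} [Ring M] [Algebra A M] [Ring G] [Algebra A G]
    (ΔM : M →ₐ[A] M ⊗[A] M) (ι : M →ₐ[A] G) (St : G →ₗ[A] G) : M →ₗ[A] M ⊗[A] G :=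
  TensorProduct.map LinearMap.id (LinearMap.mul' A G) ∘ₗ
  (TensorProduct.assoc A M G G).toLinearMap ∘ₗ
  TensorProduct.map
    ((TensorProduct.comm A G M).toLinearMap ∘ₗ
      TensorProduct.map (St ∘ₗ ι.toLinearMap) LinearMap.id)
    ι.toLinearMap ∘ₗ
  TensorProduct.map ΔM.toLinearMap LinearMap.id ∘ₗ ΔM.toLinearMap

/-- The right coaction `α(h) = Σ h₂ ⊗ h₃S(h₁)`. -/
def adjAlpha {A : Type} [CommRing A] {M G : Type} [Ring M] [Algebra A M] [Ring G] [Algebra A G]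
    (ΔM : M →ₐ[A] M ⊗[A] M) (ι : M →ₐ[A] G) (St : G →ₗ[A] G) : M →ₗ[A] M ⊗[A] G :=
  TensorProduct.map LinearMap.id (LinearMap.mul' A G) ∘ₗ
  TensorProduct.map LinearMap.id (TensorProduct.comm A G G).toLinearMap ∘ₗ
  (TensorProduct.assoc A M G G).toLinearMap ∘ₗ
  TensorProduct.map
    ((TensorProduct.comm A G M).toLinearMap ∘ₗ
      TensorProduct.map (St ∘ₗ ι.toLinearMap) LinearMap.id)
    ι.toLinearMap ∘ₗ
  TensorProduct.map ΔM.toLinearMap LinearMap.id ∘ₗ ΔM.toLinearMap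

/-- The co-orbit map associated to a point `e = ev_ξ` and a coaction `b`. -/
def coorbit {A : Type} [CommRing A] {M G : Type} [Ring M] [Algebra A M] [Ring G] [Algebra A G]
    (e : M →ₐ[A] A) (b : M →ₗ[A] M ⊗[A] G) : M →ₗ[A] G :=
  (TensorProduct.lid A G).toLinearMap ∘ₗ TensorProduct.map e.toLinearMap LinearMap.id ∘ₗ b

/-- The left coaction `λ_D = (π_D ⊗ id) ∘ Δ` of a quotient Hopf algebra. -/
def leftCoact {A : Type} [CommRing A] {G D : Type} [Ring G] [Algebra A G]
    [CommRing D] [Algebra A D]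
    (πD : G →ₐ[A] D) (ΔG : G →ₐ[A] G ⊗[A] G) : G →ₗ[A] D ⊗[A] G :=
  TensorProduct.map πD.toLinearMap LinearMap.id ∘ₗ ΔG.toLinearMap

/-- Coinvariants of the left coaction `λ_D`. -/
def dCoinv {A : Type} [CommRing A] {G D : Type} [Ring G] [Algebra A G]
    [CommRing D] [Algebra A D]
    (πD : G →ₐ[A] D) (ΔG : G →ₐ[A] G ⊗[A] G) : Set G :=
  {f : G | leftCoact πD ΔG f = (1 : D) ⊗ₜ[A] f}

/-- The right coaction `ρ_D = (id ⊗ π_D) ∘ Δ`. -/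
def rightCoact {A : Type} [CommRing A] {G D : Type} [Ring G] [Algebra A G]
    [CommRing D] [Algebra A D]
    (πD : G →ₐ[A] D) (ΔG : G →ₐ[A] G ⊗[A] G) : G →ₗ[A] G ⊗[A] D :=
  TensorProduct.map LinearMap.id πD.toLinearMap ∘ₗ ΔG.toLinearMap

/-- The weight space of weight `ta : D` for the grading induced by `ρ_D`. -/
def weightSpace' {A : Type} [CommRing A] {G D : Type} [Ring G] [Algebra A G]
    [CommRing D] [Algebra A D]
    (πD : G →ₐ[A] D) (ΔG : G →ₐ[A] G ⊗[A] G) (ta : D) : Submodule A G :=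
  LinearMap.ker (rightCoact πD ΔG - (TensorProduct.mk A G D).flip ta)

/-- The subcomodule generated by a subset `s` of the comodule `(M, b)`. -/
def comodGen {A : Type} [CommRing A] {M G : Type} [Ring M] [Algebra A M] [Ring G] [Algebra A G]
    (b : M →ₗ[A] M ⊗[A] G) (s : Set M) : Submodule A M :=
  sInf {W : Submodule A M | s ⊆ W ∧
    ∀ w ∈ W, b w ∈ LinearMap.range (TensorProduct.map W.subtype (LinearMap.id : G →ₗ[A] G))}

/-- The coefficient `q ^ δ_{ab}` of the FRT relations. -/
def diagCoeff {N : ℕ} (q : ℂ) (a b : Fin N) : ℂ := if a = b then q else 1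

/-- The coefficient `(q - q⁻¹) [a < b]` of the FRT relations. -/
def ltCoeff {N : ℕ} (q : ℂ) (a b : Fin N) : ℂ := if a < b then q - q⁻¹ else 0

/-- The FRT form `R Y₁ Y₂ = Y₂ Y₁ R` of the relations between quantum matrix entries. -/
def IsQuantumMatrix {N : ℕ} {B : Type} [Ring B] [Algebra ℂ B] (q : ℂ) (y : Fin N → Fin N → B) :
    Prop :=
  ∀ a b c d, diagCoeff q a b • (y a c * y b d) + ltCoeff q b a • (y b c * y a d)
    = diagCoeff q c d • (y b d * y a c) + ltCoeff q c d • (y b c * y a d)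

namespace IsQuantumMatrix

variable {N : ℕ} {q : ℂ} {B C : Type} [Ring B] [Algebra ℂ B] [Ring C] [Algebra ℂ C]
  {y z : Fin N → Fin N → B}

lemma of_rels (hq : q ≠ 0)
    (hrow : ∀ i j l : Fin N, j < l → y i j * y i l = q • (y i l * y i j))
    (hcol : ∀ i k j : Fin N, i < k → y i j * y k j = q • (y k j * y i j))
    (hanti : ∀ i k j l : Fin N, i < k → j < l → y i l * y k j = y k j * y i l)
    (hdiag : ∀ i k j l : Fin N, i < k → j < l →
      y i j * y k l - y k l * y i j = (q - q⁻¹) • (y i l * y k j)) :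
    IsQuantumMatrix q y := by
  intro a b c d
  rcases lt_trichotomy a b with h | rfl | h <;> rcases lt_trichotomy c d with h' | rfl | h'
  · simp only [diagCoeff, ltCoeff, h', h.not_gt, h.ne, h'.ne, if_true, if_false]
    rw [← hanti a b c d h h', ← hdiag a b c d h h']; simp
  · simp only [diagCoeff, ltCoeff, h.not_gt, h.ne, lt_irrefl, if_true, if_false]
    rw [hcol a b c h]; simp
  · simp only [diagCoeff, ltCoeff, h.not_gt, h.ne, h'.not_gt, h'.ne', if_false]
    rw [hanti a b d c h h']
  · simp only [diagCoeff, ltCoeff, h', h'.ne, lt_irrefl, if_true, if_false]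
    rw [hrow a c d h']
    simp only [smul_smul, ← add_smul]
    congr 1
    field_simp
    ring
  · simp [diagCoeff, ltCoeff]
  · simp only [diagCoeff, ltCoeff, h'.not_gt, h'.ne', lt_irrefl, if_true, if_false]
    rw [hrow a d c h']; simp
  · simp only [diagCoeff, ltCoeff, h, h', h.ne', h'.ne, if_true, if_false]
    rw [hanti b a c d h h']
  · simp only [diagCoeff, ltCoeff, h, h.ne', lt_irrefl, if_true, if_false]
    rw [hcol b a c h]
    simp only [smul_smul, ← add_smul]
    congr 1
    field_simp
    ring
  · simp only [diagCoeff, ltCoeff, h, h.ne', h'.not_gt, h'.ne', if_true, if_false]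
    rw [← hdiag b a d c h h']; simp

lemma row (hy : IsQuantumMatrix q y) (i j l : Fin N) (h : j < l) :
    y i j * y i l = q • (y i l * y i j) := by
  have := hy i i l j
  simpa [diagCoeff, ltCoeff, h.ne', h.not_gt] using this.symm

lemma col (hy : IsQuantumMatrix q y) (i k j : Fin N) (h : i < k) :
    y i j * y k j = q • (y k j * y i j) := by
  have := hy i k j j
  simpa [diagCoeff, ltCoeff, h.ne, h.not_gt] using this

lemma anti (hy : IsQuantumMatrix q y) (i k j l : Fin N) (h : i < k) (h' : j < l) :
    y i l * y k j = y k j * y i l := by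
  have := hy i k l j
  simpa [diagCoeff, ltCoeff, h.ne, h.not_gt, h'.ne', h'.not_gt] using this

lemma diag (hy : IsQuantumMatrix q y) (i k j l : Fin N) (h : i < k) (h' : j < l) :
    y i j * y k l - y k l * y i j = (q - q⁻¹) • (y i l * y k j) := by
  have := hy i k j l
  rw [hy.anti i k j l h h', sub_eq_iff_eq_add']
  simpa [diagCoeff, ltCoeff, h.ne, h.not_gt, h', h'.ne] using this

lemma map (hy : IsQuantumMatrix q y) (f : B →ₐ[ℂ] C) : IsQuantumMatrix q fun i j => f (y i j) := by
  intro a b c d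
  simpa using congrArg f (hy a b c d)

lemma mul (hy : IsQuantumMatrix q y) (hz : IsQuantumMatrix q z)
    (h : ∀ i j k l, Commute (y i j) (z k l)) :
    IsQuantumMatrix q fun i j => ∑ k, y i k * z k j := by
  have key (a b c d) : (∑ k, y a k * z k c) * (∑ l, y b l * z l d)
      = ∑ k, ∑ l, (y a k * y b l) * (z k c * z l d) := by
    simp only [Finset.sum_mul_sum]
    refine Finset.sum_congr rfl fun k _ => Finset.sum_congr rfl fun l _ => ?_
    rw [mul_assoc, ← mul_assoc (z k c), ← (h b l k c).eq]
    simp only [mul_assoc]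
  have key' (a b c d) : (∑ k, y a k * z k c) * (∑ l, y b l * z l d)
      = ∑ k, ∑ l, (y a l * y b k) * (z l c * z k d) := by
    rw [key, Finset.sum_comm]
  intro a b c d
  simp only []
  calc
    _ = ∑ k, ∑ l, (diagCoeff q a b • (y a k * y b l) + ltCoeff q b a • (y b k * y a l))
          * (z k c * z l d) := by
      simp only [key, Finset.smul_sum, ← Finset.sum_add_distrib, add_mul, smul_mul_assoc]
    _ = ∑ k, ∑ l, (diagCoeff q k l • (y b l * y a k) + ltCoeff q k l • (y b k * y a l))
          * (z k c * z l d) := by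
      simp only [hy a b]
    _ = (∑ k, ∑ l, diagCoeff q k l • (y b l * y a k) * (z k c * z l d)) +
          ∑ k, ∑ l, ltCoeff q l k • (y b l * y a k) * (z l c * z k d) := by
      simp only [add_mul, Finset.sum_add_distrib]
      congr 1
      exact Finset.sum_comm
    _ = ∑ k, ∑ l, (y b l * y a k) *
          (diagCoeff q k l • (z k c * z l d) + ltCoeff q l k • (z l c * z k d)) := by
      simp only [← Finset.sum_add_distrib, mul_add, smul_mul_assoc, mul_smul_comm]
    _ = ∑ k, ∑ l, (y b l * y a k) *
          (diagCoeff q c d • (z l d * z k c) + ltCoeff q c d • (z l c * z k d)) := by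
      simp only [hz _ _ c d]
    _ = _ := by
      simp only [key', Finset.smul_sum, ← Finset.sum_add_distrib, mul_add, mul_smul_comm]

lemma transpose (hq : q ≠ 0) (hy : IsQuantumMatrix q y) : IsQuantumMatrix q fun i j => y j i := by
  refine of_rels hq (fun i j l h => hy.col _ _ _ h) (fun i k j h => hy.row _ _ _ h)
    (fun i k j l h h' => (hy.anti _ _ _ _ h' h).symm) fun i k j l h h' => ?_
  rw [hy.diag _ _ _ _ h' h, hy.anti _ _ _ _ h' h]

lemma scale (hy : IsQuantumMatrix q y) (r s : Fin N → ℂ) :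
    IsQuantumMatrix q fun i j => (r i * s j) • y i j := by
  intro a b c d
  have := congrArg (fun t => (r a * s c * (r b * s d)) • t) (hy a b c d)
  simp only [smul_add, smul_smul, smul_mul_smul_comm] at this ⊢
  convert this using 3 <;> ring

lemma one (hq : q ≠ 0) : IsQuantumMatrix q fun i j : Fin N => if i = j then (1 : B) else 0 := by
  refine of_rels hq ?_ ?_ ?_ ?_
  · intro i j l h
    by_cases h1 : i = j <;> by_cases h2 : i = l <;> simp_all
  · intro i j l h
    by_cases h1 : i = l <;> by_cases h2 : j = l <;> simp_all
  · intro i k j l h h'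
    simp only [mul_ite, mul_one, mul_zero]; split_ifs <;> simp_all
  · intro i k j l h h'
    have : ¬ (i = l ∧ k = j) := by rintro ⟨rfl, rfl⟩; exact lt_asymm h h'
    simp only [mul_ite, mul_one, mul_zero]; split_ifs <;> simp_all

end IsQuantumMatrix

/-- The quantum minor with ordered list of rows `a` and set of columns `J`, by Laplace expansion
along the first row. -/
def qDet {N : ℕ} {B : Type} [Ring B] [Algebra ℂ B] (q : ℂ) (x : Fin N → Fin N → B) :
    List (Fin N) → Finset (Fin N) → B
  | [], J => if J = ∅ then 1 else 0
  | i :: a, J => ∑ j ∈ J, (-q) ^ (J.filter (· < j)).card • (x i j * qDet q x a (J.erase j))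

section

variable {N : ℕ} {q : ℂ} {B C : Type} [Ring B] [Algebra ℂ B] [Ring C] [Algebra ℂ C]
  {x y z : Fin N → Fin N → B}

lemma qDet_nil (J : Finset (Fin N)) : qDet q x [] J = if J = ∅ then 1 else 0 := rfl

lemma qDet_cons (i : Fin N) (a : List (Fin N)) (J : Finset (Fin N)) :
    qDet q x (i :: a) J
      = ∑ j ∈ J, (-q) ^ (J.filter (· < j)).card • (x i j * qDet q x a (J.erase j)) := rfl

lemma map_qDet (f : B →ₐ[ℂ] C) (a : List (Fin N)) (J : Finset (Fin N)) :
    f (qDet q x a J) = qDet q (fun i j => f (x i j)) a J := by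
  induction a generalizing J with
  | nil => simp only [qDet_nil]; split_ifs <;> simp
  | cons i a ih => simp [qDet_cons, ih]

lemma qDet_commute {b : B} (h : ∀ i j, Commute b (x i j)) (a : List (Fin N))
    (J : Finset (Fin N)) : Commute b (qDet q x a J) := by
  induction a generalizing J with
  | nil => simp only [qDet_nil]; split_ifs <;> simp
  | cons i a ih =>
    exact Commute.sum_right _ _ _ fun j _ => ((h i j).mul_right (ih _)).smul_right _

lemma sum_erase_eq_sum_lt {A : Type} [AddCommMonoid A] (J : Finset (Fin N))
    (F : Fin N → Fin N → A) :
    ∑ c ∈ J, ∑ d ∈ J.erase c, F c d = ∑ c ∈ J, ∑ d ∈ J with c < d, (F c d + F d c) := by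
  have h1 : ∀ c ∈ J, ∑ d ∈ J.erase c, F c d
      = ∑ d ∈ J, (if c < d then F c d else 0) + ∑ d ∈ J, (if d < c then F c d else 0) := by
    intro c _
    rw [← Finset.sum_add_distrib, ← Finset.filter_ne', Finset.sum_filter]
    refine Finset.sum_congr rfl fun d _ => ?_
    rcases lt_trichotomy c d with h | rfl | h
    · simp [h, h.ne', h.not_gt]
    · simp
    · simp [h, h.ne, h.not_gt]
  rw [Finset.sum_congr rfl h1, Finset.sum_add_distrib, Finset.sum_comm (s := J) (t := J)
    (f := fun c d => if d < c then F c d else 0), ← Finset.sum_add_distrib]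
  refine Finset.sum_congr rfl fun c _ => ?_
  rw [Finset.sum_filter, ← Finset.sum_add_distrib]
  refine Finset.sum_congr rfl fun d _ => ?_
  split_ifs <;> simp

lemma qDet_cons_cons (i j : Fin N) (a : List (Fin N)) (J : Finset (Fin N)) :
    qDet q x (i :: j :: a) J = ∑ c ∈ J, ∑ d ∈ J with c < d,
      (-q) ^ ((J.filter (· < c)).card + ((J.erase c).filter (· < d)).card) •
        ((x i c * x j d - q • (x i d * x j c)) * qDet q x a ((J.erase c).erase d)) := by
  simp only [qDet_cons, Finset.mul_sum, Finset.smul_sum]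
  rw [sum_erase_eq_sum_lt]
  refine Finset.sum_congr rfl fun c hc => Finset.sum_congr rfl fun d hd => ?_
  obtain ⟨hd, hcd⟩ := Finset.mem_filter.1 hd
  have e1 : ((J.erase d).filter (· < c)) = J.filter (· < c) := by
    ext k; simp only [Finset.mem_filter, Finset.mem_erase]
    constructor
    · tauto
    · rintro ⟨h1, h2⟩; exact ⟨⟨(h2.trans hcd).ne, h1⟩, h2⟩
  have e2 : (J.filter (· < d)).card = ((J.erase c).filter (· < d)).card + 1 := by
    rw [← Finset.card_erase_add_one (s := J.filter (· < d)) (a := c) (by simp [hc, hcd]),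
      Finset.filter_erase]
  rw [e1, e2, Finset.erase_right_comm (a := d)]
  simp only [mul_smul_comm, smul_smul, sub_mul, smul_sub, smul_mul_assoc, mul_assoc]
  rw [sub_eq_add_neg, ← neg_smul]
  congr 2 <;> ring

lemma qDet_cons_self (hx : IsQuantumMatrix q x) (i : Fin N) (a : List (Fin N))
    (J : Finset (Fin N)) : qDet q x (i :: i :: a) J = 0 := by
  rw [qDet_cons_cons]
  refine Finset.sum_eq_zero fun c _ => Finset.sum_eq_zero fun d hd => ?_
  rw [hx.row i c d (Finset.mem_filter.1 hd).2]
  simp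

lemma qDet_swap (hq : q ≠ 0) (hx : IsQuantumMatrix q x) {i j : Fin N} (hij : j < i)
    (a : List (Fin N)) (J : Finset (Fin N)) :
    qDet q x (i :: j :: a) J = (-q) • qDet q x (j :: i :: a) J := by
  rw [qDet_cons_cons, qDet_cons_cons, Finset.smul_sum]
  refine Finset.sum_congr rfl fun c _ => ?_
  rw [Finset.smul_sum]
  refine Finset.sum_congr rfl fun d hd => ?_
  have hcd := (Finset.mem_filter.1 hd).2
  have h1 := hx.anti j i c d hij hcd
  have h2 := hx.diag j i c d hij hcd
  rw [sub_eq_iff_eq_add'] at h2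
  have key : x i c * x j d - q • (x i d * x j c)
      = (-q) • (x j c * x i d - q • (x j d * x i c)) := by
    rw [h2, h1]
    match_scalars
    · field_simp
      ring
    · ring
  rw [key, smul_mul_assoc, smul_comm]

lemma qDet_cons_sort (hq : q ≠ 0) (hx : IsQuantumMatrix q x) (k : Fin N) (K : Finset (Fin N))
    (J : Finset (Fin N)) :
    qDet q x (k :: K.sort) J
      = if k ∈ K then 0 else (-q) ^ (K.filter (· < k)).card • qDet q x (insert k K).sort J := by
  induction K using Finset.induction_on_min generalizing J with
  | empty => simp
  | insert m K hm ih =>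
    have hmK : m ∉ K := fun h => lt_irrefl _ (hm m h)
    rw [Finset.sort_insert _ (fun b hb => (hm b hb).le) hmK]
    rcases lt_trichotomy k m with h | rfl | h
    · have hk : ∀ b ∈ insert m K, k < b := by
        intro b hb
        rcases Finset.mem_insert.1 hb with rfl | hb
        · exact h
        · exact h.trans (hm b hb)
      have hk' : k ∉ insert m K := fun h => lt_irrefl _ (hk k h)
      rw [if_neg hk', Finset.sort_insert _ (fun b hb => (hk b hb).le) hk',
        Finset.sort_insert _ (fun b hb => (hm b hb).le) hmK]
      rw [Finset.filter_false_of_mem (fun b hb => (hk b hb).not_gt)]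
      simp
    · simp [qDet_cons_self hx]
    · rw [qDet_swap hq hx h, qDet_cons]
      simp only [ih]
      by_cases hk : k ∈ K
      · simp [hk]
      · have hk' : k ∉ insert m K := by simp [hk, h.ne']
        rw [if_neg hk', Finset.insert_comm, Finset.sort_insert _ (a := m)]
        · rw [qDet_cons, Finset.filter_insert, if_pos h, Finset.card_insert_of_notMem (by simp [hmK]),
            Finset.smul_sum, Finset.smul_sum]
          refine Finset.sum_congr rfl fun j _ => ?_
          simp only [hk, if_false, mul_smul_comm, smul_smul]
          congr 1
          ring
        · intro b hb
          rcases Finset.mem_insert.1 hb with rfl | hb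
          · exact h.le
          · exact (hm b hb).le
        · simp [h.ne, hmK]

lemma qDet_mul (hq : q ≠ 0) (hz : IsQuantumMatrix q z)
    (h : ∀ i j k l, Commute (y i j) (z k l)) (a : List (Fin N)) (J : Finset (Fin N)) :
    qDet q (fun i j => ∑ k, y i k * z k j) a J = ∑ K, qDet q y a K * qDet q z K.sort J := by
  induction a generalizing J with
  | nil =>
    rw [Fintype.sum_eq_single (∅ : Finset (Fin N))]
    · simp [qDet_nil]
    · intro K hK; simp [qDet_nil, hK]
  | cons i a ih =>
    have hc (k j K) : z k j * qDet q y a K = qDet q y a K * z k j :=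
      (qDet_commute (fun i l => (h i l k j).symm) a K).eq
    calc
      _ = ∑ k, ∑ K, (y i k * qDet q y a K) * qDet q z (k :: K.sort) J := by
        simp only [qDet_cons, ih, Finset.sum_mul, Finset.mul_sum, Finset.smul_sum]
        rw [Finset.sum_comm]
        conv_rhs => rw [Finset.sum_comm]
        refine Finset.sum_congr rfl fun K _ => ?_
        rw [Finset.sum_comm]
        refine Finset.sum_congr rfl fun k _ => Finset.sum_congr rfl fun j _ => ?_
        rw [mul_smul_comm]
        simp only [mul_assoc]
        rw [← mul_assoc (z k j), hc]
        simp only [mul_assoc]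
      _ = ∑ p ∈ (Finset.univ : Finset (Fin N × Finset (Fin N))) with p.1 ∉ p.2,
            ((-q) ^ (p.2.filter (· < p.1)).card • (y i p.1 * qDet q y a p.2))
              * qDet q z (insert p.1 p.2).sort J := by
        rw [Finset.sum_filter, Fintype.sum_prod_type]
        refine Finset.sum_congr rfl fun k _ => Finset.sum_congr rfl fun K _ => ?_
        rw [qDet_cons_sort hq hz]
        split_ifs <;> simp_all
      _ = ∑ p ∈ (Finset.univ : Finset (Finset (Fin N) × Fin N)) with p.2 ∈ p.1,
            ((-q) ^ (p.1.filter (· < p.2)).card • (y i p.2 * qDet q y a (p.1.erase p.2)))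
              * qDet q z p.1.sort J := by
        refine Finset.sum_bij' (fun p _ => (insert p.1 p.2, p.1))
          (fun p _ => (p.2, p.1.erase p.2)) ?_ ?_ ?_ ?_ ?_
        · simp
        · simp
        · rintro ⟨k, K⟩ h; simpa using h
        · rintro ⟨K, k⟩ h
          have h : k ∈ K := by simpa using h
          simp [Finset.insert_erase h]
        · rintro ⟨k, K⟩ h
          have h : k ∉ K := by simpa using h
          simp [Finset.filter_insert, h]
      _ = _ := by
        rw [Finset.sum_filter, Fintype.sum_prod_type]
        refine Finset.sum_congr rfl fun K _ => ?_
        rw [← Finset.sum_filter, qDet_cons, Finset.sum_mul]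
        simp

/-- If the rows in `a` all vanish in some column of `J`, the minor vanishes. -/
lemma qDet_eq_zero_of_column {a : List (Fin N)} {J : Finset (Fin N)} {c : Fin N} (hc : c ∈ J)
    (h : ∀ i ∈ a, x i c = 0) : qDet q x a J = 0 := by
  induction a generalizing J with
  | nil => rw [qDet_nil, if_neg (Finset.ne_empty_of_mem hc)]
  | cons i a ih =>
    rw [qDet_cons]
    refine Finset.sum_eq_zero fun j _ => ?_
    by_cases hj : j = c
    · simp [hj, h i]
    · rw [ih (Finset.mem_erase.2 ⟨Ne.symm hj, hc⟩) fun i hi => h i (List.mem_cons_of_mem _ hi)]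
      simp

lemma qDet_sort_of_lower (h : ∀ i j, i < j → x i j = 0) (K : Finset (Fin N)) :
    qDet q x K.sort K = (K.sort.map fun i => x i i).prod := by
  induction K using Finset.induction_on_min with
  | empty => simp [qDet_nil]
  | insert m K hm ih =>
    have hmK : m ∉ K := fun h => lt_irrefl _ (hm m h)
    rw [Finset.sort_insert _ (fun b hb => (hm b hb).le) hmK, qDet_cons, Finset.sum_eq_single m]
    · rw [Finset.erase_insert hmK, ih, Finset.filter_false_of_mem]
      · simp
      · intro b hb
        rcases Finset.mem_insert.1 hb with rfl | hb
        · simp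
        · exact (hm b hb).not_gt
    · intro b hb hbm
      rw [h m b (hm b (by simpa [hbm] using hb))]
      simp
    · simp

lemma qDet_sort_of_upper (h : ∀ i j, j < i → x i j = 0) (K : Finset (Fin N)) :
    qDet q x K.sort K = (K.sort.map fun i => x i i).prod := by
  induction K using Finset.induction_on_min with
  | empty => simp [qDet_nil]
  | insert m K hm ih =>
    have hmK : m ∉ K := fun h => lt_irrefl _ (hm m h)
    rw [Finset.sort_insert _ (fun b hb => (hm b hb).le) hmK, qDet_cons, Finset.sum_eq_single m]
    · rw [Finset.erase_insert hmK, ih, Finset.filter_false_of_mem]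
      · simp
      · intro b hb
        rcases Finset.mem_insert.1 hb with rfl | hb
        · simp
        · exact (hm b hb).not_gt
    · intro b hb hbm
      rw [qDet_eq_zero_of_column (c := m)]
      · simp
      · simp [Ne.symm hbm]
      · intro i hi
        exact h i m (hm i (by simpa using hi))
    · simp

end

section

variable {N : ℕ} {q : ℂ} {B : Type} [Ring B] [Algebra ℂ B] {x : Fin N → Fin N → B}

/-- Number of inversions of a sequence. -/
def seqInv {n : ℕ} (b : Fin n → Fin N) : ℕ :=
  (Finset.univ.filter fun p : Fin n × Fin n => p.1 < p.2 ∧ b p.2 < b p.1).card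

/-- The coefficient with which the sequence of columns `b` occurs in a quantum minor with set of
columns `J`. -/
def seqCoeff {n : ℕ} (q : ℂ) (b : Fin n → Fin N) (J : Finset (Fin N)) : ℂ :=
  open Classical in if Function.Injective b ∧ Finset.univ.image b = J then (-q) ^ seqInv b else 0

lemma seqInv_cons {n : ℕ} (j : Fin N) (b : Fin n → Fin N) :
    seqInv (Fin.cons j b : Fin (n + 1) → Fin N)
      = (Finset.univ.filter fun k => b k < j).card + seqInv b := by
  simp only [seqInv, Finset.card_filter, Fintype.sum_prod_type, Fin.sum_univ_succ]
  simp

lemma seqCoeff_cons {n : ℕ} (j : Fin N) (b : Fin n → Fin N) (J : Finset (Fin N)) :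
    seqCoeff q (Fin.cons j b : Fin (n + 1) → Fin N) J
      = if j ∈ J then (-q) ^ (J.filter (· < j)).card * seqCoeff q b (J.erase j) else 0 := by
  classical
  have him : Finset.univ.image (Fin.cons j b : Fin (n + 1) → Fin N)
      = insert j (Finset.univ.image b) := by
    ext k; simp [Fin.exists_fin_succ, eq_comm]
  have hiff : (Function.Injective (Fin.cons j b : Fin (n + 1) → Fin N) ∧
      Finset.univ.image (Fin.cons j b : Fin (n + 1) → Fin N) = J) ↔
      j ∈ J ∧ Function.Injective b ∧ Finset.univ.image b = J.erase j := by
    rw [him, Fin.cons_injective_iff]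
    constructor
    · rintro ⟨⟨h1, h2⟩, rfl⟩
      have h1 : j ∉ Finset.univ.image b := by simpa using h1
      exact ⟨by simp, h2, (Finset.erase_insert h1).symm⟩
    · rintro ⟨h1, h2, h3⟩
      refine ⟨⟨?_, h2⟩, by rw [h3, Finset.insert_erase h1]⟩
      have : j ∉ Finset.univ.image b := by rw [h3]; simp
      simpa using this
  simp only [seqCoeff, hiff]
  by_cases hj : j ∈ J
  · by_cases hb : Function.Injective b ∧ Finset.univ.image b = J.erase j
    · simp only [hj, hb, if_true, and_self]
      rw [seqInv_cons, pow_add]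
      congr 2
      have : J.filter (· < j) = (J.erase j).filter (· < j) := by
        rw [Finset.filter_erase, Finset.erase_eq_of_notMem]; simp
      rw [this, ← hb.2, Finset.filter_image, Finset.card_image_of_injective _ hb.1]
    · simp [hb]
  · simp [hj]

lemma qDet_ofFn {n : ℕ} (α : Fin n → Fin N) (J : Finset (Fin N)) :
    qDet q x (List.ofFn α) J
      = ∑ b : Fin n → Fin N, seqCoeff q b J • (List.ofFn fun k => x (α k) (b k)).prod := by
  induction n generalizing J with
  | zero =>
    rw [Fintype.sum_unique]
    simp [qDet_nil, seqCoeff, seqInv, Function.injective_of_subsingleton, eq_comm]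
  | succ n ih =>
    have hcons (j : Fin N) (b : Fin n → Fin N) :
        seqCoeff q ((Fin.consEquiv fun _ => Fin N) (j, b)) J
          = if j ∈ J then (-q) ^ (J.filter (· < j)).card * seqCoeff q b (J.erase j) else 0 :=
      seqCoeff_cons j b J
    rw [List.ofFn_succ, qDet_cons, ← (Fin.consEquiv fun _ => Fin N).sum_comp,
      Fintype.sum_prod_type]
    simp only [ih, hcons]
    rw [← Finset.sum_filter_add_sum_filter_not Finset.univ (· ∈ J)]
    rw [Finset.sum_eq_zero (s := Finset.univ.filter (· ∉ J)), add_zero]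
    · rw [Finset.filter_univ_mem]
      refine Finset.sum_congr rfl fun j hj => ?_
      rw [Finset.mul_sum, Finset.smul_sum]
      refine Finset.sum_congr rfl fun b _ => ?_
      simp [hj, List.ofFn_succ, smul_smul]
    · intro j hj
      have hj : j ∉ J := by simpa using hj
      simp [hj]

lemma qMinor_eq_qDet (I : Finset (Fin N)) : qMinor q x I = qDet q x I.sort I := by
  classical
  have hs : I.sort = List.ofFn (I.orderEmbOfFin rfl) := by
    rw [List.ofFn_eq_map, Finset.listMap_orderEmbOfFin_finRange]
  rw [hs, qDet_ofFn, qMinor]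
  have hinj : Function.Injective fun (σ : Equiv.Perm (Fin I.card)) (k : Fin I.card) =>
      I.orderEmbOfFin rfl (σ k) := fun σ τ h =>
    Equiv.ext fun k => (I.orderEmbOfFin rfl).injective (congrFun h k)
  refine Finset.sum_of_injOn _ hinj.injOn (by simp) ?_ ?_
  · intro b _ hb
    rw [seqCoeff, if_neg, zero_smul]
    rintro ⟨h1, h2⟩
    apply hb
    have hm (k) : b k ∈ I := h2 ▸ Finset.mem_image_of_mem b (Finset.mem_univ k)
    let f : Fin I.card → Fin I.card := fun k => (I.orderIsoOfFin rfl).symm ⟨b k, hm k⟩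
    have hf : Function.Injective f := by
      intro k l h
      have := (I.orderIsoOfFin rfl).symm.injective h
      exact h1 (by simpa using this)
    refine ⟨Equiv.ofBijective f (Finite.injective_iff_bijective.1 hf), by simp, ?_⟩
    funext k
    simp [f, ← Finset.coe_orderIsoOfFin_apply]
  · intro σ _
    rw [seqCoeff, if_pos]
    · congr 1
      · simp [seqInv, invCount]
      · rw [List.ofFn_eq_map]; rfl
    · refine ⟨(I.orderEmbOfFin rfl).injective.comp σ.injective, ?_⟩
      change Finset.univ.image (I.orderEmbOfFin rfl ∘ σ) = I
      rw [← Finset.image_image, Finset.image_univ_equiv]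
      exact Finset.image_orderEmbOfFin_univ I rfl

end

section

variable {N : ℕ} {q : ℂ} {B : Type} [Ring B] [Algebra ℂ B] {x s : Fin N → Fin N → B}

/-- The weight `q ^ (-2 k)`, for indices starting from `1`. -/
def qWeight {N : ℕ} (q : ℂ) (k : Fin N) : ℂ := q⁻¹ ^ (2 * (k.1 + 1))

lemma qWeight_ne_zero (hq : q ≠ 0) (k : Fin N) : qWeight q k ≠ 0 :=
  pow_ne_zero _ (inv_ne_zero hq)

lemma sum_ltCoeff_mul_qWeight (hq : q ≠ 0) (d : Fin N) :
    q * qWeight q d + ∑ k, ltCoeff q k d * qWeight q k = q⁻¹ := by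
  have key (n : ℕ) :
      q * q⁻¹ ^ (2 * (n + 1)) + ∑ k ∈ Finset.range n, (q - q⁻¹) * q⁻¹ ^ (2 * (k + 1)) = q⁻¹ := by
    have hqu : q * q⁻¹ = 1 := mul_inv_cancel₀ hq
    generalize q⁻¹ = u at hqu ⊢
    induction n with
    | zero =>
      simp only [Finset.range_zero, Finset.sum_empty]
      linear_combination u * hqu
    | succ n ih =>
      rw [Finset.sum_range_succ]
      refine Eq.trans ?_ ih
      rw [add_comm (Finset.sum _ _), ← add_assoc]
      congr 1
      linear_combination u ^ (2 * n + 3) * hqu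
  rw [← key d.1]
  congr 1
  simp only [ltCoeff, ite_mul, zero_mul, qWeight, Fin.lt_def]
  rw [Fin.sum_univ_eq_sum_range
    (fun k => if k < d.1 then (q - q⁻¹) * q⁻¹ ^ (2 * (k + 1)) else 0) N, ← Finset.sum_filter]
  congr 1
  ext k
  simp only [Finset.mem_filter, Finset.mem_range]
  have := d.2
  omega

lemma sum_qWeight_mul_inverse (hq : q ≠ 0) (hx : IsQuantumMatrix q x)
    (hl : ∀ i j, ∑ k, s i k * x k j = if i = j then 1 else 0)
    (hr : ∀ i j, ∑ k, x i k * s k j = if i = j then 1 else 0) (n a : Fin N) :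
    ∑ k, qWeight q k • (s k n * x a k) = if n = a then algebraMap ℂ B (qWeight q a) else 0 := by
  have h1 (k : Fin N) (a n : Fin N) : diagCoeff q a n • (s k n * x a k)
      + (if a = n then ∑ b, ltCoeff q b a • (s k b * x b k) else 0)
      = q • (x a k * s k n) + ∑ d, ltCoeff q k d • (x a d * s d n) := by
    have h0 : ∑ b, ∑ d, s k b * (diagCoeff q a b • (x a k * x b d)
          + ltCoeff q b a • (x b k * x a d)) * s d n
        = ∑ b, ∑ d, s k b * (diagCoeff q k d • (x b d * x a k)
          + ltCoeff q k d • (x b k * x a d)) * s d n := by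
      simp only [hx a _ k]
    have t1 : ∑ b, ∑ d, s k b * (diagCoeff q a b • (x a k * x b d)) * s d n
        = diagCoeff q a n • (s k n * x a k) := by
      have : ∀ b, ∑ d, s k b * (diagCoeff q a b • (x a k * x b d)) * s d n
          = diagCoeff q a b • (s k b * x a k * ∑ d, x b d * s d n) := by
        intro b
        simp only [Finset.mul_sum, Finset.smul_sum, mul_smul_comm, smul_mul_assoc, mul_assoc]
      simp only [this, hr]
      simp
    have t2 : ∑ b, ∑ d, s k b * (ltCoeff q b a • (x b k * x a d)) * s d n
        = if a = n then ∑ b, ltCoeff q b a • (s k b * x b k) else 0 := by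
      have : ∀ b, ∑ d, s k b * (ltCoeff q b a • (x b k * x a d)) * s d n
          = ltCoeff q b a • (s k b * x b k * ∑ d, x a d * s d n) := by
        intro b
        simp only [Finset.mul_sum, Finset.smul_sum, mul_smul_comm, smul_mul_assoc, mul_assoc]
      simp only [this, hr]
      split_ifs <;> simp
    have t3 : ∑ b, ∑ d, s k b * (diagCoeff q k d • (x b d * x a k)) * s d n
        = q • (x a k * s k n) := by
      rw [Finset.sum_comm]
      have : ∀ d, ∑ b, s k b * (diagCoeff q k d • (x b d * x a k)) * s d n
          = diagCoeff q k d • ((∑ b, s k b * x b d) * (x a k * s d n)) := by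
        intro b
        simp only [Finset.sum_mul, Finset.smul_sum, mul_smul_comm, smul_mul_assoc, mul_assoc]
      simp only [this, hl]
      simp [diagCoeff]
    have t4 : ∑ b, ∑ d, s k b * (ltCoeff q k d • (x b k * x a d)) * s d n
        = ∑ d, ltCoeff q k d • (x a d * s d n) := by
      rw [Finset.sum_comm]
      have : ∀ d, ∑ b, s k b * (ltCoeff q k d • (x b k * x a d)) * s d n
          = ltCoeff q k d • ((∑ b, s k b * x b k) * (x a d * s d n)) := by
        intro b
        simp only [Finset.sum_mul, Finset.smul_sum, mul_smul_comm, smul_mul_assoc, mul_assoc]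
      simp only [this, hl]
      simp
    simpa only [mul_add, add_mul, Finset.sum_add_distrib, t1, t2, t3, t4] using h0
  set Q : Fin N → Fin N → B := fun n a => ∑ k, qWeight q k • (s k n * x a k) with hQ
  have h2 (a n : Fin N) : diagCoeff q a n • Q n a
      + (if a = n then ∑ b, ltCoeff q b a • Q b b else 0)
      = if a = n then algebraMap ℂ B q⁻¹ else 0 := by
    have := congrArg (fun f => ∑ k, qWeight q k • f k) (funext fun k => h1 k a n)
    simp only [smul_add, Finset.sum_add_distrib] at this
    have e1 : ∑ k, qWeight q k • diagCoeff q a n • (s k n * x a k) = diagCoeff q a n • Q n a := by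
      simp only [hQ, Finset.smul_sum]
      exact Finset.sum_congr rfl fun k _ => smul_comm _ _ _
    have e2 : (∑ k, qWeight q k • if a = n then ∑ b, ltCoeff q b a • (s k b * x b k) else 0)
        = if a = n then ∑ b, ltCoeff q b a • Q b b else 0 := by
      split_ifs
      · simp only [hQ, Finset.smul_sum]
        rw [Finset.sum_comm]
        exact Finset.sum_congr rfl fun k _ => Finset.sum_congr rfl fun k _ => smul_comm _ _ _
      · simp
    have e3 : ∑ k, qWeight q k • q • (x a k * s k n)
        + ∑ k, qWeight q k • ∑ d, ltCoeff q k d • (x a d * s d n)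
        = if a = n then algebraMap ℂ B q⁻¹ else 0 := by
      simp only [Finset.smul_sum]
      rw [Finset.sum_comm (f := fun k d => qWeight q k • ltCoeff q k d • (x a d * s d n)),
        ← Finset.sum_add_distrib]
      simp only [smul_smul, ← Finset.sum_smul, ← add_smul]
      have : ∀ d : Fin N, qWeight q d * q + ∑ k, qWeight q k * ltCoeff q k d = q⁻¹ := fun d => by
        rw [← sum_ltCoeff_mul_qWeight hq d]
        simp only [mul_comm]
      simp only [this, ← Finset.smul_sum, hr]
      split_ifs <;> simp [Algebra.algebraMap_eq_smul_one]
    rw [e1, e2, e3] at this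
    exact this
  have hdiagQ (a : Fin N) : Q a a = algebraMap ℂ B (qWeight q a) := by
    induction a using WellFoundedLT.induction with
    | ind a ih =>
      have h := h2 a a
      rw [if_pos rfl, if_pos rfl] at h
      have : ∑ b, ltCoeff q b a • Q b b
          = algebraMap ℂ B (∑ b, ltCoeff q b a * qWeight q b) := by
        rw [map_sum]
        refine Finset.sum_congr rfl fun b _ => ?_
        by_cases hb : b < a
        · rw [ih b hb, Algebra.smul_def, map_mul]
        · simp [ltCoeff, hb]
      rw [this, ← sum_ltCoeff_mul_qWeight hq a, map_add, add_left_inj, diagCoeff, if_pos rfl,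
        map_mul, ← Algebra.smul_def] at h
      exact smul_right_injective B hq h
  split_ifs with h
  · subst h; exact hdiagQ n
  · have := h2 a n
    simpa [diagCoeff, Ne.symm h] using this

lemma qDet_eq_zero_of_card_ne {a : List (Fin N)} {J : Finset (Fin N)} (h : J.card ≠ a.length) :
    qDet q x a J = 0 := by
  induction a generalizing J with
  | nil => rw [qDet_nil, if_neg]; rintro rfl; simp at h
  | cons i a ih =>
    rw [qDet_cons]
    refine Finset.sum_eq_zero fun j hj => ?_
    rw [ih]
    · simp
    · have := Finset.card_erase_add_one hj
      simp only [List.length_cons] at h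
      omega

lemma qDet_one (K L : Finset (Fin N)) :
    qDet q (fun i j => if i = j then (1 : B) else 0) L.sort K = if K = L then 1 else 0 := by
  split_ifs with h
  · subst h
    rw [qDet_sort_of_lower]
    · simp
    · intro i j h; simp [h.ne]
  · by_cases hc : K.card = L.card
    · have : ¬ K ⊆ L := fun hKL => h (Finset.eq_of_subset_of_card_le hKL hc.ge)
      obtain ⟨c, hc, hcL⟩ := Finset.not_subset.1 this
      refine qDet_eq_zero_of_column hc fun i hi => if_neg ?_
      rintro rfl
      exact hcL (by simpa using hi)
    · exact qDet_eq_zero_of_card_ne (by simpa using hc)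

/-- Twisted orthogonality between quantum minors and their antipodes. -/
lemma sum_antipode_qDet_mul_qDet (hq : q ≠ 0) (hx : IsQuantumMatrix q x) (S : B →ₗ[ℂ] B)
    (hS1 : S 1 = 1) (hSm : ∀ a b, S (a * b) = S b * S a)
    (hl : ∀ i j, ∑ k, S (x i k) * x k j = if i = j then 1 else 0)
    (hr : ∀ i j, ∑ k, x i k * S (x k j) = if i = j then 1 else 0)
    (a : List (Fin N)) (K : Finset (Fin N)) :
    ∑ I : Finset (Fin N), (∏ i ∈ I, qWeight q i) • (S (qDet q x I.sort K) * qDet q x a I)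
      = (a.map (qWeight q)).prod • qDet q (fun i j => if i = j then (1 : B) else 0) a K := by
  induction a generalizing K with
  | nil =>
    rw [Fintype.sum_eq_single (∅ : Finset (Fin N))]
    · simp only [Finset.sort_empty, qDet_nil]
      split_ifs <;> simp [hS1]
    · intro I hI; simp [qDet_nil, hI]
  | cons i a ih =>
    calc
      _ = ∑ p ∈ (Finset.univ : Finset (Finset (Fin N) × Fin N)) with p.2 ∈ p.1,
            (∏ i ∈ p.1, qWeight q i) • (S (qDet q x p.1.sort K) *
              ((-q) ^ (p.1.filter (· < p.2)).card • (x i p.2 * qDet q x a (p.1.erase p.2)))) := by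
        rw [Finset.sum_filter, Fintype.sum_prod_type]
        refine Finset.sum_congr rfl fun I _ => ?_
        rw [← Finset.sum_filter, qDet_cons, Finset.mul_sum, Finset.smul_sum]
        simp
      _ = ∑ p ∈ (Finset.univ : Finset (Fin N × Finset (Fin N))) with p.1 ∉ p.2,
            (qWeight q p.1 * ∏ i ∈ p.2, qWeight q i) •
              (S ((-q) ^ (p.2.filter (· < p.1)).card • qDet q x (insert p.1 p.2).sort K) *
              (x i p.1 * qDet q x a p.2)) := by
        refine Finset.sum_bij' (fun p _ => (p.2, p.1.erase p.2))
          (fun p _ => (insert p.1 p.2, p.1)) ?_ ?_ ?_ ?_ ?_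
        · simp
        · simp
        · rintro ⟨K, k⟩ h
          have h : k ∈ K := by simpa using h
          simp [Finset.insert_erase h]
        · rintro ⟨k, K⟩ h
          have h : k ∉ K := by simpa using h
          simp [h]
        · rintro ⟨I, k⟩ h
          have h : k ∈ I := by simpa using h
          have : (I.erase k).filter (· < k) = I.filter (· < k) := by
            rw [Finset.filter_erase, Finset.erase_eq_of_notMem]; simp
          simp [Finset.insert_erase h, Finset.mul_prod_erase _ _ h, this]
      _ = ∑ I : Finset (Fin N), ∑ j, (qWeight q j * ∏ i ∈ I, qWeight q i) •
            (S (qDet q x (j :: I.sort) K) * (x i j * qDet q x a I)) := by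
        rw [Finset.sum_filter, Fintype.sum_prod_type, Finset.sum_comm]
        refine Finset.sum_congr rfl fun I _ => Finset.sum_congr rfl fun j _ => ?_
        rw [qDet_cons_sort hq hx]
        split_ifs <;> simp_all
      _ = ∑ k ∈ K, (-q) ^ (K.filter (· < k)).card • ∑ I : Finset (Fin N),
            (∏ i ∈ I, qWeight q i) • (S (qDet q x I.sort (K.erase k)) *
              (∑ j, qWeight q j • (S (x j k) * x i j)) * qDet q x a I) := by
        simp only [qDet_cons, map_sum, map_smul, hSm, Finset.sum_mul, Finset.mul_sum,
          Finset.smul_sum]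
        conv_rhs => rw [Finset.sum_comm]
        refine Finset.sum_congr rfl fun I _ => ?_
        rw [Finset.sum_comm]
        refine Finset.sum_congr rfl fun k _ => Finset.sum_congr rfl fun j _ => ?_
        simp only [mul_smul_comm, smul_mul_assoc, smul_smul, mul_assoc]
        congr 1
        ring
      _ = _ := by
        simp only [sum_qWeight_mul_inverse hq hx (s := fun i j => S (x i j)) hl hr]
        rw [qDet_cons, Finset.smul_sum]
        refine Finset.sum_congr rfl fun k _ => ?_
        rw [List.map_cons, List.prod_cons]
        by_cases h : i = k
        · subst h
          have := ih (K.erase i)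
          simp only [if_true, one_mul, ← Algebra.commutes, ← Algebra.smul_def, smul_mul_assoc]
          rw [smul_comm, mul_smul, ← this]
          congr 1
          rw [Finset.smul_sum]
          exact (Finset.sum_congr rfl fun I _ => smul_comm _ _ _)
        · simp [h, Ne.symm h]

end

/-- `x` is the universal quantum matrix. -/
structure IsUniversalQuantumMatrix {N : ℕ} (q : ℂ) {M : Type} [Ring M] [Algebra ℂ M]
    (x : Fin N → Fin N → M) : Prop where
  rtt : IsQuantumMatrix q x
  gen : Algebra.adjoin ℂ (Set.range fun p : Fin N × Fin N => x p.1 p.2) = ⊤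
  lift : ∀ (B : Type) [Ring B] [Algebra ℂ B] (y : Fin N → Fin N → B), IsQuantumMatrix q y →
    ∃ φ : M →ₐ[ℂ] B, ∀ i j, φ (x i j) = y i j

lemma IsUniversalQuantumMatrix.ext {N : ℕ} {q : ℂ} {M B : Type} [Ring M] [Algebra ℂ M] [Ring B]
    [Algebra ℂ B] {x : Fin N → Fin N → M} (hx : IsUniversalQuantumMatrix q x) {f g : M →ₐ[ℂ] B}
    (h : ∀ i j, f (x i j) = g (x i j)) : f = g :=
  AlgHom.ext_of_adjoin_eq_top hx.gen (by rintro _ ⟨p, rfl⟩; exact h p.1 p.2)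

/-- The quantum general linear group, as the localization of the bialgebra of quantum matrices
at the quantum determinant. -/
structure IsQuantumGL {N : ℕ} (q : ℂ) {M G : Type} [Ring M] [Algebra ℂ M] [Ring G] [Algebra ℂ G]
    (x : Fin N → Fin N → M) (ι : M →ₐ[ℂ] G) (ΔM : M →ₐ[ℂ] M ⊗[ℂ] M)
    (ΔG : G →ₐ[ℂ] G ⊗[ℂ] G) (εG : G →ₐ[ℂ] ℂ) (St : G →ₗ[ℂ] G) : Prop where
  ne_zero : q ≠ 0
  univ : IsUniversalQuantumMatrix q x
  ext : ∀ {B : Type} [Ring B] [Algebra ℂ B] {f g : G →ₐ[ℂ] B},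
    (∀ i j, f (ι (x i j)) = g (ι (x i j))) → f = g
  lift : ∀ (B : Type) [Ring B] [Algebra ℂ B] (φ : M →ₐ[ℂ] B), IsUnit (φ (qdet q x)) →
    ∃ ψ : G →ₐ[ℂ] B, ψ.comp ι = φ
  isUnit : IsUnit (ι (qdet q x))
  comul : ∀ i j, ΔM (x i j) = ∑ k, x i k ⊗ₜ[ℂ] x k j
  comulG : ∀ m, ΔG (ι m) = Algebra.TensorProduct.map ι ι (ΔM m)
  counit : ∀ i j, εG (ι (x i j)) = if i = j then 1 else 0
  antipode_left : LinearMap.mul' ℂ G ∘ₗ TensorProduct.map St LinearMap.id ∘ₗ ΔG.toLinearMap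
      = Algebra.linearMap ℂ G ∘ₗ εG.toLinearMap
  antipode_right : LinearMap.mul' ℂ G ∘ₗ TensorProduct.map LinearMap.id St ∘ₗ ΔG.toLinearMap
      = Algebra.linearMap ℂ G ∘ₗ εG.toLinearMap

lemma antipode_anti {A : Type} [Ring A] [Algebra ℂ A] (Δ : A →ₐ[ℂ] A ⊗[ℂ] A) (ε : A →ₐ[ℂ] ℂ)
    (S : A →ₗ[ℂ] A)
    (h1 : (Algebra.TensorProduct.assoc ℂ ℂ ℂ A A A).toAlgHom.comp
      ((Algebra.TensorProduct.map Δ (.id ℂ A)).comp Δ)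
      = (Algebra.TensorProduct.map (.id ℂ A) Δ).comp Δ)
    (h2 : (Algebra.TensorProduct.map ε (.id ℂ A)).comp Δ = (Algebra.TensorProduct.lid ℂ A).symm)
    (h3 : (Algebra.TensorProduct.map (.id ℂ A) ε).comp Δ = (Algebra.TensorProduct.rid ℂ ℂ A).symm)
    (hS1 : LinearMap.mul' ℂ A ∘ₗ TensorProduct.map S LinearMap.id ∘ₗ Δ.toLinearMap
      = Algebra.linearMap ℂ A ∘ₗ ε.toLinearMap)
    (hS2 : LinearMap.mul' ℂ A ∘ₗ TensorProduct.map LinearMap.id S ∘ₗ Δ.toLinearMap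
      = Algebra.linearMap ℂ A ∘ₗ ε.toLinearMap) (a b : A) : S (a * b) = S b * S a := by
  let _ : Bialgebra ℂ A := Bialgebra.ofAlgHom Δ ε h1 h2 h3
  let _ : HopfAlgebra ℂ A :=
    { antipode := S
      mul_antipode_rTensor_comul := hS1
      mul_antipode_lTensor_comul := hS2 }
  exact HopfAlgebra.antipode_mul_antidistrib (R := ℂ) a b

namespace IsQuantumGL

variable {N : ℕ} {q : ℂ} {M G : Type} [Ring M] [Algebra ℂ M] [Ring G] [Algebra ℂ G]
    {x : Fin N → Fin N → M} {ι : M →ₐ[ℂ] G} {ΔM : M →ₐ[ℂ] M ⊗[ℂ] M}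
    {ΔG : G →ₐ[ℂ] G ⊗[ℂ] G} {εG : G →ₐ[ℂ] ℂ} {St : G →ₗ[ℂ] G}

lemma comulG_gen (h : IsQuantumGL q x ι ΔM ΔG εG St) (i j : Fin N) :
    ΔG (ι (x i j)) = ∑ k, ι (x i k) ⊗ₜ ι (x k j) := by
  simp [h.comulG, h.comul]

lemma antipode_mul (h : IsQuantumGL q x ι ΔM ΔG εG St) (a b : G) :
    St (a * b) = St b * St a := by
  refine antipode_anti ΔG εG St (h.ext fun i j => ?_) (h.ext fun i j => ?_) (h.ext fun i j => ?_)
    h.antipode_left h.antipode_right a b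
  · simp only [AlgHom.comp_apply, h.comulG_gen, map_sum, Algebra.TensorProduct.map_tmul,
      AlgHom.id_apply, sum_tmul, tmul_sum]
    rw [Finset.sum_comm]
    simp
  · simp [h.comulG_gen, h.counit, TensorProduct.ite_tmul]
  · simp [h.comulG_gen, h.counit, TensorProduct.tmul_ite]

lemma antipode_one (h : IsQuantumGL q x ι ΔM ΔG εG St) : St 1 = 1 := by
  simpa [Algebra.TensorProduct.one_def] using LinearMap.congr_fun h.antipode_left 1

lemma antipode_left_gen (h : IsQuantumGL q x ι ΔM ΔG εG St) (i j : Fin N) :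
    ∑ k, St (ι (x i k)) * ι (x k j) = if i = j then 1 else 0 := by
  have := LinearMap.congr_fun h.antipode_left (ι (x i j))
  simp only [LinearMap.comp_apply, AlgHom.toLinearMap_apply, h.comulG_gen, h.counit] at this
  simpa [apply_ite] using this

lemma antipode_right_gen (h : IsQuantumGL q x ι ΔM ΔG εG St) (i j : Fin N) :
    ∑ k, ι (x i k) * St (ι (x k j)) = if i = j then 1 else 0 := by
  have := LinearMap.congr_fun h.antipode_right (ι (x i j))
  simp only [LinearMap.comp_apply, AlgHom.toLinearMap_apply, h.comulG_gen, h.counit] at this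
  simpa [apply_ite] using this

end IsQuantumGL

lemma comul_qDet {N : ℕ} {q : ℂ} {M : Type} [Ring M] [Algebra ℂ M] {x : Fin N → Fin N → M}
    (hq : q ≠ 0) (hx : IsQuantumMatrix q x) {ΔM : M →ₐ[ℂ] M ⊗[ℂ] M}
    (hΔ : ∀ i j, ΔM (x i j) = ∑ k, x i k ⊗ₜ[ℂ] x k j) (a : List (Fin N)) (J : Finset (Fin N)) :
    ΔM (qDet q x a J) = ∑ K, qDet q x a K ⊗ₜ qDet q x K.sort J := by
  let l : M →ₐ[ℂ] M ⊗[ℂ] M := Algebra.TensorProduct.includeLeft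
  let r : M →ₐ[ℂ] M ⊗[ℂ] M := Algebra.TensorProduct.includeRight
  have := qDet_mul (y := fun i j => l (x i j)) (z := fun i j => r (x i j)) hq (hx.map r)
    (fun i j k m => by simp [l, r, Commute, SemiconjBy]) a J
  rw [map_qDet]
  simp only [← map_qDet, hΔ] at this ⊢
  simpa [l, r] using this

section Coaction

variable {M G : Type} [Ring M] [Algebra ℂ M] [Ring G] [Algebra ℂ G]
    (ι : M →ₐ[ℂ] G) (ΔM : M →ₐ[ℂ] M ⊗[ℂ] M) (St : G →ₗ[ℂ] G)

/-- The map `(a ⊗ b) ⊗ c ↦ b ⊗ S(a)c`. -/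
def adjMap : (M ⊗[ℂ] M) ⊗[ℂ] M →ₗ[ℂ] M ⊗[ℂ] G :=
  TensorProduct.map LinearMap.id (LinearMap.mul' ℂ G) ∘ₗ
  (TensorProduct.assoc ℂ M G G).toLinearMap ∘ₗ
  TensorProduct.map
    ((TensorProduct.comm ℂ G M).toLinearMap ∘ₗ
      TensorProduct.map (St ∘ₗ ι.toLinearMap) LinearMap.id)
    ι.toLinearMap

lemma adjMap_tmul (a b c : M) : adjMap ι St ((a ⊗ₜ b) ⊗ₜ c) = b ⊗ₜ (St (ι a) * ι c) := by
  simp [adjMap]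

lemma adjBeta_apply (f : M) : adjBeta ΔM ι St f
    = adjMap ι St (Algebra.TensorProduct.map ΔM (.id ℂ M) (ΔM f)) := rfl

variable {ι ΔM St}

lemma adjMap_mul_tmul (hS : ∀ a b, St (a * b) = St b * St a) (t : (M ⊗[ℂ] M) ⊗[ℂ] M)
    (a b c : M) : adjMap ι St (t * ((a ⊗ₜ b) ⊗ₜ c))
      = (1 ⊗ₜ St (ι a)) * adjMap ι St t * (b ⊗ₜ ι c) := by
  induction t using TensorProduct.induction_on with
  | zero => simp
  | add s t hs ht => simp only [add_mul, mul_add, map_add, hs, ht]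
  | tmul s c' =>
    induction s using TensorProduct.induction_on with
    | zero => simp
    | add s t hs ht => simp only [add_tmul, add_mul, mul_add, map_add, hs, ht]
    | tmul a' b' => simp [adjMap_tmul, hS, mul_assoc]

lemma adjBeta_mul (hS : ∀ a b, St (a * b) = St b * St a) {f : M}
    (hf : adjBeta ΔM ι St f = f ⊗ₜ 1) (g : M) :
    adjBeta ΔM ι St (f * g) = (f ⊗ₜ 1) * adjBeta ΔM ι St g := by
  rw [adjBeta_apply] at hf
  rw [adjBeta_apply, adjBeta_apply, map_mul, map_mul]
  generalize Algebra.TensorProduct.map ΔM (.id ℂ M) (ΔM g) = t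
  induction t using TensorProduct.induction_on with
  | zero => simp
  | add s t hs ht => simp only [mul_add, map_add, hs, ht]
  | tmul s c' =>
    induction s using TensorProduct.induction_on with
    | zero => simp
    | add s t hs ht => simp only [add_tmul, mul_add, map_add, hs, ht]
    | tmul a' b' => simp [adjMap_tmul, adjMap_mul_tmul hS, hf]

lemma coorbit_eq_zero (hS : ∀ a b, St (a * b) = St b * St a) {f : M}
    (hf : adjBeta ΔM ι St f = f ⊗ₜ 1) (e : M →ₐ[ℂ] ℂ) (g : M) :
    coorbit e (adjBeta ΔM ι St) ((f - algebraMap ℂ M (e f)) * g) = 0 := by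
  have key (t : M ⊗[ℂ] G) : (TensorProduct.lid ℂ G).toLinearMap
      (TensorProduct.map e.toLinearMap LinearMap.id ((f ⊗ₜ 1) * t))
      = e f • (TensorProduct.lid ℂ G).toLinearMap
        (TensorProduct.map e.toLinearMap LinearMap.id t) := by
    induction t using TensorProduct.induction_on with
    | zero => simp
    | add s t hs ht => simp only [mul_add, map_add, hs, ht, smul_add]
    | tmul a b => simp [mul_smul]
  rw [sub_mul, ← Algebra.smul_def, map_sub, map_smul]
  simp only [coorbit, LinearMap.comp_apply]
  rw [adjBeta_mul hS hf, key, sub_self]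

end Coaction

namespace IsQuantumGL

variable {N : ℕ} {q : ℂ} {M G : Type} [Ring M] [Algebra ℂ M] [Ring G] [Algebra ℂ G]
    {x : Fin N → Fin N → M} {ι : M →ₐ[ℂ] G} {ΔM : M →ₐ[ℂ] M ⊗[ℂ] M}
    {ΔG : G →ₐ[ℂ] G ⊗[ℂ] G} {εG : G →ₐ[ℂ] ℂ} {St : G →ₗ[ℂ] G}

lemma tauCoinv_eq (q : ℂ) (x : Fin N → Fin N → M) (m : ℕ) : tauCoinv q q⁻¹ x m
    = ∑ I : Finset (Fin N) with I.card = m, (∏ i ∈ I, qWeight q i) • qDet q x I.sort I := by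
  refine Finset.sum_congr rfl fun I _ => ?_
  rw [qMinor_eq_qDet]
  congr 1
  simp only [qWeight, wtSet, Finset.prod_pow_eq_pow_sum, Finset.mul_sum]

lemma prod_sort_map_qWeight (K : Finset (Fin N)) :
    (K.sort.map (qWeight q)).prod = ∏ i ∈ K, qWeight q i := by
  rw [← Finset.prod_map_toList]
  exact ((Finset.sort_perm_toList _ _).map _).prod_eq

lemma adjBeta_tauCoinv (h : IsQuantumGL q x ι ΔM ΔG εG St) (m : ℕ) :
    adjBeta ΔM ι St (tauCoinv q q⁻¹ x m) = tauCoinv q q⁻¹ x m ⊗ₜ 1 := by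
  have hsum (K L : Finset (Fin N)) : ∑ I : Finset (Fin N) with I.card = m,
      (∏ i ∈ I, qWeight q i) • (St (ι (qDet q x I.sort K)) * ι (qDet q x L.sort I))
      = if K.card = m ∧ K = L then (∏ i ∈ K, qWeight q i) • 1 else 0 := by
    by_cases hK : K.card = m
    · have := sum_antipode_qDet_mul_qDet h.ne_zero (h.univ.rtt.map ι) St h.antipode_one
        h.antipode_mul h.antipode_left_gen h.antipode_right_gen L.sort K
      rw [qDet_one, prod_sort_map_qWeight] at this
      simp only [← map_qDet] at this
      rw [Finset.sum_filter_of_ne, this]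
      · by_cases hKL : K = L
        · subst hKL; simp [hK]
        · simp [hKL]
      · intro I _ hI
        by_contra hI'
        rw [qDet_eq_zero_of_card_ne (by rw [Finset.length_sort]; omega)] at hI
        simp at hI
    · rw [if_neg fun h => hK h.1]
      refine Finset.sum_eq_zero fun I hI => ?_
      have hI : I.card = m := by simpa using hI
      rw [qDet_eq_zero_of_card_ne (by rw [Finset.length_sort]; omega)]
      simp
  rw [adjBeta_apply, tauCoinv_eq]
  calc
    _ = ∑ I : Finset (Fin N) with I.card = m, (∏ i ∈ I, qWeight q i) • ∑ L, ∑ K,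
          qDet q x K.sort L ⊗ₜ[ℂ] (St (ι (qDet q x I.sort K)) * ι (qDet q x L.sort I)) := by
      simp only [map_sum, map_smul, comul_qDet h.ne_zero h.univ.rtt h.comul,
        Algebra.TensorProduct.map_tmul, sum_tmul, adjMap_tmul, AlgHom.id_apply]
    _ = ∑ L, ∑ K, qDet q x K.sort L ⊗ₜ[ℂ] ∑ I : Finset (Fin N) with I.card = m,
          (∏ i ∈ I, qWeight q i) • (St (ι (qDet q x I.sort K)) * ι (qDet q x L.sort I)) := by
      simp only [Finset.smul_sum, tmul_sum, tmul_smul]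
      rw [Finset.sum_comm]
      refine Finset.sum_congr rfl fun L _ => ?_
      rw [Finset.sum_comm]
    _ = _ := by
      simp only [hsum]
      rw [sum_tmul, Finset.sum_filter, Finset.sum_comm]
      refine Finset.sum_congr rfl fun K _ => ?_
      rw [Finset.sum_eq_single K]
      · split_ifs <;> simp_all [smul_tmul']
      · intro L _ hL; simp [Ne.symm hL]
      · simp

end IsQuantumGL

/-- The squared distance of an entry from the diagonal. -/
def offDiag {N : ℕ} (p : Fin N × Fin N) : ℤ := ((p.1 : ℤ) - p.2) ^ 2

lemma offDiag_nonneg {N : ℕ} (p : Fin N × Fin N) : 0 ≤ offDiag p := sq_nonneg _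

/-- The monomial in the entries of `x` indexed by a word. -/
def wordProd {N : ℕ} {M : Type} [Ring M] (x : Fin N → Fin N → M) (l : List (Fin N × Fin N)) : M :=
  (l.map fun p => x p.1 p.2).prod

section PBW

variable {N : ℕ} {q : ℂ} {M : Type} [Ring M] [Algebra ℂ M] {x : Fin N → Fin N → M}

/-- The span of the monomials of length `n` and off-diagonal weight more than `w`. -/
def wordSpan (x : Fin N → Fin N → M) (n : ℕ) (w : ℤ) : Submodule ℂ M :=
  Submodule.span ℂ {m | ∃ l : List (Fin N × Fin N),
    l.length = n ∧ w < (l.map offDiag).sum ∧ m = wordProd x l}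

lemma IsQuantumMatrix.exists_swap (hq : q ≠ 0) (hx : IsQuantumMatrix q x) (p p' : Fin N × Fin N) :
    ∃ (u c : ℂ) (r r' : Fin N × Fin N),
      x p.1 p.2 * x p'.1 p'.2 - u • (x p'.1 p'.2 * x p.1 p.2) = c • (x r.1 r.2 * x r'.1 r'.2) ∧
      (c = 0 ∨ offDiag p + offDiag p' < offDiag r + offDiag r') := by
  obtain ⟨i, j⟩ := p
  obtain ⟨k, l⟩ := p'
  have triv (u : ℂ) (h : x i j * x k l = u • (x k l * x i j)) : ∃ (u c : ℂ) (r r' : Fin N × Fin N),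
      x i j * x k l - u • (x k l * x i j) = c • (x r.1 r.2 * x r'.1 r'.2) ∧
      (c = 0 ∨ offDiag (i, j) + offDiag (k, l) < offDiag r + offDiag r') :=
    ⟨u, 0, (i, j), (k, l), by simp [h], .inl rfl⟩
  have wt {i k j l : Fin N} (h : i < k) (h' : j < l) :
      offDiag (i, j) + offDiag (k, l) < offDiag (i, l) + offDiag (k, j) := by
    simp only [offDiag]
    have h1 : (0 : ℤ) < (k : ℤ) - i := by have := Fin.lt_def.1 h; omega
    have h2 : (0 : ℤ) < (l : ℤ) - j := by have := Fin.lt_def.1 h'; omega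
    nlinarith [mul_pos h1 h2]
  have inv {a b : M} (h : a = q • b) : b = q⁻¹ • a := by rw [h, inv_smul_smul₀ hq]
  rcases lt_trichotomy i k with h | rfl | h <;> rcases lt_trichotomy j l with h' | rfl | h'
  · exact ⟨1, q - q⁻¹, (i, l), (k, j), by simp [← hx.diag i k j l h h'], .inr (wt h h')⟩
  · exact triv q (hx.col i k j h)
  · exact triv 1 (by simp [hx.anti i k l j h h'])
  · exact triv q (hx.row i j l h')
  · exact triv 1 (by simp)
  · exact triv q⁻¹ (inv (hx.row i l j h'))
  · exact triv 1 (by simp [hx.anti k i j l h h'])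
  · exact triv q⁻¹ (inv (hx.col k i j h))
  · refine ⟨1, -(q - q⁻¹), (k, j), (i, l), ?_, .inr ?_⟩
    · rw [neg_smul, ← hx.diag k i l j h h']; simp
    · linarith [wt h h']

lemma IsQuantumMatrix.exists_perm (hq : q ≠ 0) (hx : IsQuantumMatrix q x)
    {l l' : List (Fin N × Fin N)} (h : l.Perm l') :
    ∃ u : ℂ, wordProd x l - u • wordProd x l' ∈ wordSpan x l.length (l.map offDiag).sum := by
  induction h with
  | nil => exact ⟨1, by simp⟩
  | @cons p l l' h ih =>
    obtain ⟨u, hu⟩ := ih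
    refine ⟨u, ?_⟩
    have := Submodule.mem_map_of_mem (f := LinearMap.mulLeft ℂ (x p.1 p.2)) hu
    rw [wordSpan, Submodule.map_span] at this
    simp only [wordProd, LinearMap.mulLeft_apply, mul_sub, mul_smul_comm] at this
    simp only [wordProd, List.map_cons, List.prod_cons, List.length_cons, List.sum_cons]
    refine Submodule.span_mono ?_ this
    rintro _ ⟨_, ⟨m, h1, h2, rfl⟩, rfl⟩
    exact ⟨p :: m, by simpa using h1, by simpa using h2, by simp [wordProd]⟩
  | swap p p' l =>
    obtain ⟨u, c, r, r', h1, h2⟩ := hx.exists_swap hq p' p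
    refine ⟨u, ?_⟩
    have : wordProd x (p' :: p :: l) - u • wordProd x (p :: p' :: l)
        = c • wordProd x (r :: r' :: l) := by
      simp only [wordProd, List.map_cons, List.prod_cons, ← mul_assoc]
      rw [← smul_mul_assoc, ← sub_mul, h1, smul_mul_assoc]
    rw [this]
    rcases h2 with rfl | h2
    · simp
    · refine Submodule.smul_mem _ _ (Submodule.subset_span ⟨_, by simp, ?_, rfl⟩)
      simp only [List.map_cons, List.sum_cons]
      linarith
  | @trans l₁ l₂ l₃ h h' ih ih' =>
    obtain ⟨u, hu⟩ := ih
    obtain ⟨v, hv⟩ := ih'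
    rw [← h.length_eq, ← (h.map offDiag).sum_eq] at hv
    refine ⟨u * v, ?_⟩
    have := add_mem hu (Submodule.smul_mem _ u hv)
    rwa [smul_sub, sub_add_sub_cancel, smul_smul] at this

lemma IsQuantumMatrix.wordProd_mem_span (hq : q ≠ 0) (hx : IsQuantumMatrix q x)
    (l : List (Fin N × Fin N)) :
    wordProd x l ∈ Submodule.span ℂ
      (Set.range fun A : Multiset (Fin N × Fin N) => wordProd x A.toList) := by
  have hbound (l : List (Fin N × Fin N)) : (l.map offDiag).sum ≤ l.length * (N : ℤ) ^ 2 := by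
    refine (List.sum_le_card_nsmul _ ((N : ℤ) ^ 2) ?_).trans (by simp)
    simp only [List.mem_map]
    rintro _ ⟨p, -, rfl⟩
    refine sq_le_sq' ?_ ?_ <;> have := p.1.2 <;> have := p.2.2 <;> omega
  obtain ⟨n, hn⟩ : ∃ n : ℕ, (l.length * (N : ℤ) ^ 2 - (l.map offDiag).sum).toNat = n := ⟨_, rfl⟩
  induction n using Nat.strong_induction_on generalizing l with
  | _ n ih =>
    obtain ⟨u, hu⟩ := hx.exists_perm hq
      (Multiset.coe_eq_coe.1 (Multiset.coe_toList (l : Multiset (Fin N × Fin N)))).symm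
    rw [← sub_add_cancel (wordProd x l) (u • wordProd x (Multiset.toList l))]
    refine add_mem (Submodule.span_le.2 ?_ hu)
      (Submodule.smul_mem _ _ (Submodule.subset_span ⟨_, rfl⟩))
    rintro _ ⟨m, h1, h2, rfl⟩
    have := hbound m
    exact ih _ (by rw [← hn, h1] at *; omega) m rfl

lemma IsUniversalQuantumMatrix.exists_finsupp (hq : q ≠ 0) (hx : IsUniversalQuantumMatrix q x)
    (f : M) : ∃ c : Multiset (Fin N × Fin N) →₀ ℂ,
      f = c.sum fun A a => a • wordProd x A.toList := by
  have hf : f ∈ Submodule.span ℂ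
      (Submonoid.closure (Set.range fun p : Fin N × Fin N => x p.1 p.2) : Set M) := by
    rw [← Algebra.adjoin_eq_span, hx.gen]; trivial
  have : f ∈ Submodule.span ℂ
      (Set.range fun A : Multiset (Fin N × Fin N) => wordProd x A.toList) := by
    refine Submodule.span_le.2 (fun m hm => ?_) hf
    obtain ⟨l, hl, rfl⟩ := Submonoid.exists_list_of_mem_closure hm
    obtain ⟨w, rfl⟩ : l ∈ Set.range (List.map fun p : Fin N × Fin N => x p.1 p.2) := by
      rwa [Set.range_list_map]
    exact hx.rtt.wordProd_mem_span hq w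
  obtain ⟨c, hc⟩ := Finsupp.mem_span_range_iff_exists_finsupp.1 this
  exact ⟨c, hc.symm⟩

end PBW

/-- The lattice of shift vectors. -/
abbrev ShiftLattice := Bool × ℕ × ℕ →₀ ℤ

/-- The algebra of operators on functions on the shift lattice. -/
abbrev ShiftEnd := Module.End ℂ (ShiftLattice → ℂ)

namespace ShiftLattice

/-- A standard basis vector of the shift lattice. -/
def basisVec (b : Bool) (k i : ℕ) : ShiftLattice := Finsupp.single (b, k, i) 1

/-- A coordinate function of the shift lattice. -/
def coord (b : Bool) (k i : ℕ) : ShiftLattice →+ ℤ := Finsupp.applyAddHom (b, k, i)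

lemma coord_basisVec (b b' : Bool) (k k' i i' : ℕ) :
    coord b k i (basisVec b' k' i') = if b = b' ∧ k = k' ∧ i = i' then 1 else 0 := by
  simp only [coord, basisVec, Finsupp.applyAddHom_apply, Finsupp.single_apply, Prod.mk.injEq]
  congr 1
  simp only [eq_comm]

/-- The weight of a shift vector. -/
def wt : ShiftLattice →+ ℤ :=
  Finsupp.liftAddHom fun p => ((2 * p.2.1 - 1 : ℕ) : ℤ) • AddMonoidHom.id ℤ

lemma wt_basisVec (b : Bool) (k i : ℕ) : wt (basisVec b k i) = ((2 * k - 1 : ℕ) : ℤ) := by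
  simp [wt, basisVec]

/-- The shift vector of the path descending `d` steps from `i`. -/
def path (b : Bool) (i d : ℕ) : ShiftLattice := ∑ t ∈ Finset.range d, basisVec b (t + 1) (i - t)

lemma path_succ (b : Bool) (i d : ℕ) :
    path b i (d + 1) = path b i d + basisVec b (d + 1) (i - d) := Finset.sum_range_succ _ _

@[simp] lemma path_zero (b : Bool) (i : ℕ) : path b i 0 = 0 := rfl

lemma wt_path (b : Bool) (i d : ℕ) : wt (path b i d) = (d : ℤ) ^ 2 := by
  induction d with
  | zero => simp
  | succ d ih =>
    rw [path_succ, map_add, ih, wt_basisVec, show 2 * (d + 1) - 1 = 2 * d + 1 by omega]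
    push_cast; ring

lemma coord_path (b b' : Bool) (k r i d : ℕ) (h : d ≤ i) :
    coord b k r (path b' i d) = if b = b' ∧ 1 ≤ k ∧ k ≤ d ∧ i + 1 = r + k then 1 else 0 := by
  induction d with
  | zero =>
    rw [if_neg (by omega)]; simp
  | succ d ih =>
    rw [path_succ, map_add, ih (by omega), coord_basisVec]
    by_cases hb : b = b'
    · simp only [hb, true_and]
      split_ifs <;> first | rfl | omega
    · simp [hb]

end ShiftLattice

open ShiftLattice

/-- The `q`-difference operator `g ↦ (v ↦ q ^ m v * g (v + e))`. -/
def qShift (q : ℂ) (m : ShiftLattice →+ ℤ) (e : ShiftLattice) : ShiftEnd where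
  toFun g v := q ^ m v * g (v + e)
  map_add' f g := by ext v; simp [mul_add]
  map_smul' c g := by ext v; simp [mul_left_comm]

section qShift

variable {q : ℂ}

lemma qShift_apply (m : ShiftLattice →+ ℤ) (e : ShiftLattice) (g : ShiftLattice → ℂ)
    (v : ShiftLattice) : qShift q m e g v = q ^ m v * g (v + e) := rfl

lemma qShift_mul (hq : q ≠ 0) (m m' : ShiftLattice →+ ℤ) (e e' : ShiftLattice) :
    qShift q m e * qShift q m' e' = q ^ m' e • qShift q (m + m') (e + e') := by
  ext g v
  simp only [Module.End.mul_apply, LinearMap.smul_apply, Pi.smul_apply, qShift_apply, map_add,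
    zpow_add₀ hq, AddMonoidHom.add_apply, smul_eq_mul, add_assoc]
  ring

lemma qShift_mul_comm (hq : q ≠ 0) (m m' : ShiftLattice →+ ℤ) (e e' : ShiftLattice) :
    qShift q m e * qShift q m' e' = q ^ (m' e - m e') • (qShift q m' e' * qShift q m e) := by
  rw [qShift_mul hq, qShift_mul hq, smul_smul, ← zpow_add₀ hq, add_comm m, add_comm e]
  congr 2
  omega

lemma qShift_commute (hq : q ≠ 0) {m m' : ShiftLattice →+ ℤ} {e e' : ShiftLattice}
    (h : m' e = m e') : Commute (qShift q m e) (qShift q m' e') := by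
  rw [Commute, SemiconjBy, qShift_mul_comm hq, h, sub_self, zpow_zero, one_smul]

lemma qShift_zero : qShift q 0 0 = 1 := by
  ext g v
  simp [qShift_apply]

lemma isUnit_qShift (hq : q ≠ 0) (m : ShiftLattice →+ ℤ) (e : ShiftLattice) :
    IsUnit (qShift q m e) := by
  have h (m : ShiftLattice →+ ℤ) (e : ShiftLattice) :
      qShift q m e * (q ^ m e • qShift q (-m) (-e)) = 1 := by
    rw [mul_smul_comm, qShift_mul hq, smul_smul, ← zpow_add₀ hq]
    simp [qShift_zero]
  have h1 := h m e
  have h2 := h (-m) (-e)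
  rw [isUnit_iff_exists]
  refine ⟨_, h1, ?_⟩
  simpa using h2

end qShift

/-- The operator `T` shifts by `e` up to shifts of larger weight. -/
def HasLead (T : ShiftEnd) (e : ShiftLattice) : Prop :=
  ∀ v, ∃ u : ℂ, u ≠ 0 ∧ ∀ g : ShiftLattice → ℂ,
    (∀ v', wt v + wt e < wt v' → g v' = 0) → T g v = u * g (v + e)

namespace HasLead

variable {q : ℂ} {S T : ShiftEnd} {d e : ShiftLattice}

lemma qShift (hq : q ≠ 0) (m : ShiftLattice →+ ℤ) (e : ShiftLattice) :
    HasLead (qShift q m e) e :=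
  fun v => ⟨q ^ m v, zpow_ne_zero _ hq, fun _ _ => rfl⟩

lemma one : HasLead 1 0 := fun v => ⟨1, one_ne_zero, fun g _ => by simp⟩

lemma smul {c : ℂ} (hc : c ≠ 0) (h : HasLead T e) : HasLead (c • T) e := by
  intro v
  obtain ⟨u, hu, H⟩ := h v
  exact ⟨c * u, mul_ne_zero hc hu, fun g hg => by simp [H g hg, mul_assoc]⟩

lemma eq_zero (h : HasLead T e) {v : ShiftLattice} {g : ShiftLattice → ℂ} {w : ℤ}
    (hw : w < wt v + wt e) (hg : ∀ v', w < wt v' → g v' = 0) : T g v = 0 := by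
  obtain ⟨u, hu, H⟩ := h v
  rw [H g fun v' hv' => hg v' (hw.trans hv'), hg _ (by rw [map_add]; exact hw), mul_zero]

lemma mul (h : HasLead S d) (h' : HasLead T e) : HasLead (S * T) (d + e) := by
  intro v
  obtain ⟨u, hu, H⟩ := h v
  obtain ⟨u', hu', H'⟩ := h' (v + d)
  refine ⟨u * u', mul_ne_zero hu hu', fun g hg => ?_⟩
  rw [Module.End.mul_apply, H, H', mul_assoc, add_assoc]
  · intro v' hv'
    refine hg v' ?_
    simp only [map_add] at hv' ⊢
    linarith
  · intro v' hv'
    refine h'.eq_zero (w := wt v + wt (d + e)) ?_ hg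
    simp only [map_add]
    linarith

lemma sum {α : Type} [Fintype α] {F : α → ShiftEnd} (a : α) (h : HasLead (F a) e)
    (hF : ∀ b, b ≠ a → F b = 0 ∨ ∃ e', wt e < wt e' ∧ HasLead (F b) e') :
    HasLead (∑ b, F b) e := by
  intro v
  obtain ⟨u, hu, H⟩ := h v
  refine ⟨u, hu, fun g hg => ?_⟩
  rw [LinearMap.sum_apply, Finset.sum_apply, Finset.sum_eq_single a, H g hg]
  · intro b _ hb
    rcases hF b hb with h0 | ⟨e', he', h'⟩
    · simp [h0]
    · exact h'.eq_zero (by linarith) hg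
  · simp

end HasLead

/-- An elementary bidiagonal quantum matrix. -/
def bidiag (N : ℕ) (q : ℂ) (b : Bool) (k : ℕ) (i j : Fin N) : ShiftEnd :=
  if i = j then qShift q (coord b k i - coord b k (i + 1)) 0
  else if i.1 = j + 1 then qShift q 0 (basisVec b k i) else 0

/-- A diagonal quantum matrix with independent commuting entries. -/
def torus (N : ℕ) (q : ℂ) (b : Bool) (i j : Fin N) : ShiftEnd :=
  if i = j then qShift q 0 (basisVec b 0 i) else 0

section Factors

variable {N : ℕ} {q : ℂ} {b : Bool}

lemma bidiag_cases (q : ℂ) (b : Bool) (k : ℕ) (i j : Fin N) :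
    (i = j ∧ bidiag N q b k i j = qShift q (coord b k i - coord b k (i + 1)) 0) ∨
    (i.1 = j + 1 ∧ bidiag N q b k i j = qShift q 0 (basisVec b k i)) ∨
    ((i.1 < j.1 ∨ j.1 + 1 < i.1) ∧ bidiag N q b k i j = 0) := by
  unfold bidiag
  rcases eq_or_ne i j with rfl | h
  · simp
  · by_cases h' : i.1 = j + 1
    · simp [h, h']
    · have := Fin.val_ne_of_ne h
      simp only [h, h', if_false, false_and, and_true, false_or]
      omega

lemma isQuantumMatrix_bidiag (hq : q ≠ 0) (b : Bool) (k : ℕ) :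
    IsQuantumMatrix q (bidiag N q b k) := by
  have hz {i k' j l : Fin N} (h : i < k') (h' : j < l) :
      bidiag N q b k i l * bidiag N q b k k' j = 0 ∧
      bidiag N q b k k' j * bidiag N q b k i l = 0 := by
    rw [Fin.lt_def] at h h'
    rcases bidiag_cases q b k i l with ⟨rfl, -⟩ | ⟨h1, -⟩ | ⟨-, h1⟩
    · rcases bidiag_cases q b k k' j with ⟨rfl, -⟩ | ⟨h2, -⟩ | ⟨-, h2⟩
      · omega
      · omega
      · simp [h2]
    · rcases bidiag_cases q b k k' j with ⟨rfl, -⟩ | ⟨h2, -⟩ | ⟨-, h2⟩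
      · omega
      · omega
      · simp [h2]
    · simp [h1]
  refine IsQuantumMatrix.of_rels hq ?_ ?_ ?_ ?_
  · intro i j l h
    rw [Fin.lt_def] at h
    rcases bidiag_cases q b k i j with ⟨rfl, h1⟩ | ⟨h0, h1⟩ | ⟨-, h1⟩
    · rcases bidiag_cases q b k i l with ⟨rfl, h2⟩ | ⟨h3, h2⟩ | ⟨-, h2⟩
      · omega
      · omega
      · simp [h2]
    · rcases bidiag_cases q b k i l with ⟨rfl, h2⟩ | ⟨h3, h2⟩ | ⟨-, h2⟩
      · rw [h1, h2, qShift_mul_comm hq]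
        simp [coord_basisVec]
      · omega
      · simp [h2]
    · simp [h1]
  · intro i k' j h
    rw [Fin.lt_def] at h
    rcases bidiag_cases q b k i j with ⟨rfl, h1⟩ | ⟨h0, h1⟩ | ⟨-, h1⟩
    · rcases bidiag_cases q b k k' i with ⟨rfl, h2⟩ | ⟨h3, h2⟩ | ⟨-, h2⟩
      · omega
      · rw [h1, h2, qShift_mul_comm hq]
        simp [coord_basisVec, h3]
      · simp [h2]
    · rcases bidiag_cases q b k k' j with ⟨rfl, h2⟩ | ⟨h3, h2⟩ | ⟨-, h2⟩
      · omega
      · omega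
      · simp [h2]
    · simp [h1]
  · intro i k' j l h h'
    rw [(hz h h').1, (hz h h').2]
  · intro i k' j l h h'
    rw [(hz h h').1, smul_zero, sub_eq_zero]
    rw [Fin.lt_def] at h h'
    change Commute _ _
    rcases bidiag_cases q b k i j with ⟨rfl, h1⟩ | ⟨h0, h1⟩ | ⟨-, h1⟩
    · rcases bidiag_cases q b k k' l with ⟨rfl, h2⟩ | ⟨h3, h2⟩ | ⟨-, h2⟩
      · rw [h1, h2]; exact qShift_commute hq (by simp)
      · rw [h1, h2]
        refine qShift_commute hq ?_
        simp only [AddMonoidHom.zero_apply, AddMonoidHom.sub_apply, coord_basisVec]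
        rw [if_neg (by omega), if_neg (by omega)]; simp
      · simp [h2]
    · rcases bidiag_cases q b k k' l with ⟨rfl, h2⟩ | ⟨h3, h2⟩ | ⟨-, h2⟩
      · rw [h1, h2]
        refine qShift_commute hq ?_
        simp only [AddMonoidHom.zero_apply, AddMonoidHom.sub_apply, coord_basisVec]
        rw [if_neg (by omega), if_neg (by omega)]; simp
      · rw [h1, h2]; exact qShift_commute hq (by simp)
      · simp [h2]
    · simp [h1]

lemma bidiag_commute (hq : q ≠ 0) {b b' : Bool} {k k' : ℕ} (h : b ≠ b' ∨ k ≠ k')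
    (i j i' j' : Fin N) : Commute (bidiag N q b k i j) (bidiag N q b' k' i' j') := by
  have h1 : ¬ (b = b' ∧ k = k') := by tauto
  have h2 : ¬ (b' = b ∧ k' = k) := by tauto
  unfold bidiag
  split_ifs <;> first
    | exact Commute.zero_left _
    | exact Commute.zero_right _
    | (refine qShift_commute hq ?_
       simp only [AddMonoidHom.zero_apply, AddMonoidHom.sub_apply, coord_basisVec, map_zero,
         ← and_assoc, h1, h2, false_and, if_false, sub_self])

lemma bidiag_commute_torus (hq : q ≠ 0) {b b' : Bool} {k : ℕ} (h : k ≠ 0)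
    (i j i' j' : Fin N) : Commute (bidiag N q b k i j) (torus N q b' i' j') := by
  unfold bidiag torus
  split_ifs <;> first
    | exact Commute.zero_left _
    | exact Commute.zero_right _
    | (refine qShift_commute hq ?_
       simp [coord_basisVec, h])

lemma torus_commute (hq : q ≠ 0) (b b' : Bool) (i j i' j' : Fin N) :
    Commute (torus N q b i j) (torus N q b' i' j') := by
  unfold torus
  split_ifs <;> first
    | exact Commute.zero_left _
    | exact Commute.zero_right _
    | exact qShift_commute hq (by simp)

lemma isQuantumMatrix_torus (hq : q ≠ 0) (b : Bool) : IsQuantumMatrix q (torus N q b) := by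
  refine IsQuantumMatrix.of_rels hq ?_ ?_ (fun _ _ _ _ _ _ => torus_commute hq _ _ _ _ _ _) ?_
  · intro i j l h
    unfold torus
    rcases eq_or_ne i j with rfl | h'
    · simp [h.ne]
    · simp [h']
  · intro i k j h
    unfold torus
    rcases eq_or_ne i j with rfl | h'
    · simp [h.ne']
    · simp [h']
  · intro i k j l h h'
    rw [(torus_commute hq b b i j k l).eq, sub_self]
    unfold torus
    rcases eq_or_ne i l with rfl | h1
    · rw [if_neg (h'.trans h).ne']; simp
    · simp [h1]

/-- The product of the first `n` elementary bidiagonal quantum matrices. -/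
def bidiagProd (N : ℕ) (q : ℂ) (b : Bool) : ℕ → Fin N → Fin N → ShiftEnd
  | 0 => fun i j => if i = j then 1 else 0
  | n + 1 => fun i j => ∑ k, bidiagProd N q b n i k * bidiag N q b (n + 1) k j

lemma bidiagProd_commute {T : ShiftEnd} (n : ℕ)
    (h : ∀ k, 0 < k → k ≤ n → ∀ i j, Commute (bidiag N q b k i j) T) (i j : Fin N) :
    Commute (bidiagProd N q b n i j) T := by
  induction n generalizing i j with
  | zero =>
    simp only [bidiagProd]
    split_ifs
    · exact Commute.one_left _
    · exact Commute.zero_left _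
  | succ n ih =>
    exact Commute.sum_left _ _ _ fun k _ => Commute.mul_left
      (ih (fun k h1 h2 => h k h1 (by omega)) _ _) (h _ (by omega) le_rfl _ _)

lemma isQuantumMatrix_bidiagProd (hq : q ≠ 0) (b : Bool) (n : ℕ) :
    IsQuantumMatrix q (bidiagProd N q b n) := by
  induction n with
  | zero => exact IsQuantumMatrix.one hq
  | succ n ih =>
    exact ih.mul (isQuantumMatrix_bidiag hq b (n + 1)) fun i j k l =>
      bidiagProd_commute n (fun m _ hm _ _ => bidiag_commute hq (.inr (by omega)) _ _ _ _) i j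

lemma bidiagProd_commute_bidiagProd (hq : q ≠ 0) {b b' : Bool} (h : b ≠ b') (n n' : ℕ)
    (i j i' j' : Fin N) : Commute (bidiagProd N q b n i j) (bidiagProd N q b' n' i' j') :=
  bidiagProd_commute n (fun _ _ _ _ _ => (bidiagProd_commute n' (fun _ _ _ _ _ =>
    bidiag_commute hq (.inl h.symm) _ _ _ _) _ _).symm) _ _

lemma bidiagProd_commute_torus (hq : q ≠ 0) (b b' : Bool) (n : ℕ)
    (i j i' j' : Fin N) : Commute (bidiagProd N q b n i j) (torus N q b' i' j') :=
  bidiagProd_commute n (fun _ _ _ _ _ => bidiag_commute_torus hq (by omega) _ _ _ _) _ _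

lemma bidiagProd_eq_zero (n : ℕ) (i j : Fin N) (h : i < j ∨ j.1 + n < i.1) :
    bidiagProd N q b n i j = 0 := by
  induction n generalizing i j with
  | zero =>
    have : i ≠ j := by rintro rfl; simp at h
    simp [bidiagProd, this]
  | succ n ih =>
    refine Finset.sum_eq_zero fun k _ => ?_
    rw [Fin.lt_def] at h
    rcases bidiag_cases q b (n + 1) k j with ⟨rfl, -⟩ | ⟨h0, -⟩ | ⟨-, h1⟩
    · rw [ih _ _ (by rw [Fin.lt_def]; omega), zero_mul]
    · rw [ih _ _ (by rw [Fin.lt_def]; omega), zero_mul]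
    · rw [h1, mul_zero]

lemma hasLead_bidiagProd (hq : q ≠ 0) (n : ℕ) (i j : Fin N) (h : j ≤ i) (h' : i.1 ≤ j + n) :
    HasLead (bidiagProd N q b n i j) (path b i (i - j)) := by
  rw [Fin.le_def] at h
  induction n generalizing i j with
  | zero =>
    have : i = j := by ext; omega
    subst this
    simpa [bidiagProd] using HasLead.one
  | succ n ih =>
    have hup (k : Fin N) (hk : k.1 = j + 1) (hik : k ≤ i) (hik' : i.1 ≤ k + n) :
        HasLead (bidiagProd N q b n i k * bidiag N q b (n + 1) k j)
          (path b i (i - k) + basisVec b (n + 1) k) := by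
      refine (ih i k hik hik').mul ?_
      have : k ≠ j := by rintro rfl; omega
      simp only [bidiag, this, hk, if_true, if_false]
      exact .qShift hq _ _
    by_cases hn : i.1 ≤ j + n
    · refine HasLead.sum j ?_ fun k hk => ?_
      · rw [← add_zero (path b _ _)]
        refine (ih i j h hn).mul ?_
        simp only [bidiag, if_true]
        exact .qShift hq _ _
      · rcases bidiag_cases q b (n + 1) k j with ⟨h0, -⟩ | ⟨h0, -⟩ | ⟨-, h1⟩
        · exact absurd h0 hk
        · by_cases hik : k ≤ i
          · refine .inr ⟨_, ?_, hup k h0 hik (by omega)⟩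
            rw [map_add, wt_path, wt_path, wt_basisVec]
            obtain ⟨d, hd⟩ := Nat.exists_eq_add_of_le hik
            rw [show i.1 - k = d by omega, show i.1 - j = d + 1 by omega,
              show 2 * (n + 1) - 1 = 2 * n + 1 by omega]
            have : d < n := by omega
            push_cast
            nlinarith
          · exact .inl (by rw [bidiagProd_eq_zero n i k (.inl (not_le.1 hik)), zero_mul])
        · exact .inl (by rw [h1, mul_zero])
    · have hlt : j.1 + 1 < N := by omega
      refine HasLead.sum ⟨j + 1, hlt⟩ ?_ fun k hk => .inl ?_
      · have := hup ⟨j + 1, hlt⟩ rfl (by rw [Fin.le_def]; simp; omega) (by simp; omega)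
        rw [show i.1 - j = n + 1 by omega, path_succ, show i.1 - n = j + 1 by omega]
        rwa [show i.1 - (j.1 + 1) = n by omega] at this
      · rcases bidiag_cases q b (n + 1) k j with ⟨rfl, -⟩ | ⟨h0, -⟩ | ⟨-, h1⟩
        · rw [bidiagProd_eq_zero n i k (.inr (by omega)), zero_mul]
        · exact absurd (Fin.ext h0) hk
        · rw [h1, mul_zero]

lemma isUnit_bidiagProd (hq : q ≠ 0) (n : ℕ) (i : Fin N) : IsUnit (bidiagProd N q b n i i) := by
  induction n with
  | zero => simp [bidiagProd]
  | succ n ih =>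
    simp only [bidiagProd]
    rw [Finset.sum_eq_single i]
    · refine ih.mul ?_
      simp only [bidiag, if_true]
      exact isUnit_qShift hq _ _
    · intro k _ hk
      rcases lt_or_gt_of_ne hk with h | h
      · rcases bidiag_cases q b (n + 1) k i with ⟨rfl, -⟩ | ⟨h0, -⟩ | ⟨-, h1⟩
        · exact absurd rfl hk
        · rw [Fin.lt_def] at h; omega
        · rw [h1, mul_zero]
      · rw [bidiagProd_eq_zero n i k (.inl h), zero_mul]
    · simp

end Factors

/-- The lower triangular factor of the universal quantum matrix. -/
def lowerFactor (N : ℕ) (q : ℂ) (i j : Fin N) : ShiftEnd :=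
  ∑ k, bidiagProd N q false N i k * torus N q false k j

/-- The upper triangular factor of the universal quantum matrix. -/
def upperFactor (N : ℕ) (q : ℂ) (i j : Fin N) : ShiftEnd :=
  ∑ k, bidiagProd N q true N k i * torus N q true k j

section Triangular

variable {N : ℕ} {q : ℂ}

lemma lowerFactor_eq (i j : Fin N) : lowerFactor N q i j
    = bidiagProd N q false N i j * qShift q 0 (basisVec false 0 j) := by
  simp [lowerFactor, torus]

lemma upperFactor_eq (i j : Fin N) : upperFactor N q i j
    = bidiagProd N q true N j i * qShift q 0 (basisVec true 0 j) := by
  simp [upperFactor, torus]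

lemma isQuantumMatrix_lowerFactor (hq : q ≠ 0) : IsQuantumMatrix q (lowerFactor N q) :=
  (isQuantumMatrix_bidiagProd hq _ _).mul (isQuantumMatrix_torus hq _)
    (bidiagProd_commute_torus hq _ _ _)

lemma isQuantumMatrix_upperFactor (hq : q ≠ 0) : IsQuantumMatrix q (upperFactor N q) :=
  ((isQuantumMatrix_bidiagProd hq _ _).transpose hq).mul (isQuantumMatrix_torus hq _)
    fun _ _ => bidiagProd_commute_torus hq _ _ _ _ _

lemma lowerFactor_commute_upperFactor (hq : q ≠ 0) (i j k l : Fin N) :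
    Commute (lowerFactor N q i j) (upperFactor N q k l) := by
  refine Commute.sum_left _ _ _ fun s _ => Commute.sum_right _ _ _ fun t _ => ?_
  refine Commute.mul_left (Commute.mul_right ?_ ?_) (Commute.mul_right ?_ ?_)
  · exact bidiagProd_commute_bidiagProd hq (by simp) _ _ _ _ _ _
  · exact bidiagProd_commute_torus hq _ _ _ _ _ _ _
  · exact (bidiagProd_commute_torus hq _ _ _ _ _ _ _).symm
  · exact torus_commute hq _ _ _ _ _ _

lemma lowerFactor_eq_zero {i j : Fin N} (h : i < j) : lowerFactor N q i j = 0 := by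
  rw [lowerFactor_eq, bidiagProd_eq_zero N i j (.inl h), zero_mul]

lemma upperFactor_eq_zero {i j : Fin N} (h : j < i) : upperFactor N q i j = 0 := by
  rw [upperFactor_eq, bidiagProd_eq_zero N j i (.inl h), zero_mul]

lemma hasLead_lowerFactor (hq : q ≠ 0) {i j : Fin N} (h : j ≤ i) :
    HasLead (lowerFactor N q i j) (path false i (i - j) + basisVec false 0 j) := by
  rw [lowerFactor_eq]
  exact (hasLead_bidiagProd hq N i j h (by omega)).mul (.qShift hq _ _)

lemma hasLead_upperFactor (hq : q ≠ 0) {i j : Fin N} (h : i ≤ j) :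
    HasLead (upperFactor N q i j) (path true j (j - i) + basisVec true 0 j) := by
  rw [upperFactor_eq]
  exact (hasLead_bidiagProd hq N j i h (by omega)).mul (.qShift hq _ _)

lemma isUnit_lowerFactor (hq : q ≠ 0) (i : Fin N) : IsUnit (lowerFactor N q i i) := by
  rw [lowerFactor_eq]
  exact (isUnit_bidiagProd hq N i).mul (isUnit_qShift hq _ _)

lemma isUnit_upperFactor (hq : q ≠ 0) (i : Fin N) : IsUnit (upperFactor N q i i) := by
  rw [upperFactor_eq]
  exact (isUnit_bidiagProd hq N i).mul (isUnit_qShift hq _ _)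

/-- The leading shift of an entry of the product of the lower and upper factors. -/
def luLead (p : Fin N × Fin N) : ShiftLattice :=
  let m := min p.1.1 p.2.1
  (path false p.1 (p.1 - m) + basisVec false 0 m) + (path true p.2 (p.2 - m) + basisVec true 0 p.2)

/-- The leading shift of an entry of the product of the upper and lower factors. -/
def ulLead (p : Fin N × Fin N) : ShiftLattice :=
  let m := max p.1.1 p.2.1
  (path false m (m - p.2) + basisVec false 0 p.2) + (path true m (m - p.1) + basisVec true 0 m)

lemma hasLead_lu (hq : q ≠ 0) (p : Fin N × Fin N) :
    HasLead (∑ k, lowerFactor N q p.1 k * upperFactor N q k p.2) (luLead p) := by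
  obtain ⟨i, j⟩ := p
  refine HasLead.sum (min i j) ?_ fun k hk => ?_
  · convert (hasLead_lowerFactor hq (min_le_left i j)).mul
      (hasLead_upperFactor hq (min_le_right i j)) using 1
    simp [luLead]
  · rcases lt_or_ge i k with h | h
    · exact .inl (by rw [lowerFactor_eq_zero h, zero_mul])
    rcases lt_or_ge j k with h' | h'
    · exact .inl (by rw [upperFactor_eq_zero h', mul_zero])
    refine .inr ⟨_, ?_, (hasLead_lowerFactor hq h).mul (hasLead_upperFactor hq h')⟩
    have hk' : k.1 < min i.1 j.1 := by
      refine lt_of_le_of_ne (le_min h h') fun h0 => hk (Fin.ext ?_)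
      simpa using h0
    simp only [luLead, map_add, wt_path, wt_basisVec]
    rcases le_total i.1 j.1 with h0 | h0
    · simp only [min_eq_left h0] at hk' ⊢
      rw [Nat.sub_self, Nat.cast_sub h0, Nat.cast_sub h, Nat.cast_sub h']
      push_cast
      zify at *
      nlinarith
    · simp only [min_eq_right h0] at hk' ⊢
      rw [Nat.sub_self, Nat.cast_sub h0, Nat.cast_sub h, Nat.cast_sub h']
      push_cast
      zify at *
      nlinarith

/-- The eigenvalues of the square of the antipode on generators. -/
def twistCoeff (q : ℂ) (i j : Fin N) : ℂ := q ^ (2 * i.1) * (q ^ (2 * j.1))⁻¹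

lemma twistCoeff_ne_zero (hq : q ≠ 0) (i j : Fin N) : twistCoeff q i j ≠ 0 :=
  mul_ne_zero (pow_ne_zero _ hq) (inv_ne_zero (pow_ne_zero _ hq))

lemma hasLead_ul (hq : q ≠ 0) (p : Fin N × Fin N) :
    HasLead (∑ k, twistCoeff q p.1 k • (lowerFactor N q k p.2 * upperFactor N q p.1 k))
      (ulLead p) := by
  obtain ⟨i, j⟩ := p
  refine HasLead.sum (max i j) (.smul (twistCoeff_ne_zero hq _ _) ?_) fun k hk => ?_
  · convert (hasLead_lowerFactor hq (le_max_right i j)).mul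
      (hasLead_upperFactor hq (le_max_left i j)) using 1
    simp [ulLead]
  · rcases lt_or_ge k j with h | h
    · exact .inl (by rw [lowerFactor_eq_zero h, zero_mul, smul_zero])
    rcases lt_or_ge k i with h' | h'
    · exact .inl (by rw [upperFactor_eq_zero h', mul_zero, smul_zero])
    refine .inr ⟨_, ?_, .smul (twistCoeff_ne_zero hq _ _)
      ((hasLead_lowerFactor hq h).mul (hasLead_upperFactor hq h'))⟩
    have hk' : max i.1 j.1 < k.1 := by
      refine lt_of_le_of_ne (max_le h' h) fun h0 => hk (Fin.ext ?_)
      simpa using h0.symm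
    simp only [ulLead, map_add, wt_path, wt_basisVec]
    rcases le_total i.1 j.1 with h0 | h0
    · simp only [max_eq_right h0] at hk' ⊢
      rw [Nat.sub_self, Nat.cast_sub h0, Nat.cast_sub h, Nat.cast_sub h']
      push_cast
      zify at *
      nlinarith
    · simp only [max_eq_left h0] at hk' ⊢
      rw [Nat.sub_self, Nat.cast_sub h0, Nat.cast_sub h, Nat.cast_sub h']
      push_cast
      zify at *
      nlinarith

lemma wt_luLead (p : Fin N × Fin N) : wt (luLead p) = offDiag p := by
  simp only [luLead, offDiag, map_add, wt_path, wt_basisVec]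
  rcases le_total p.1.1 p.2.1 with h0 | h0
  · simp only [min_eq_left h0, Nat.cast_sub h0]
    push_cast
    simp only [Nat.sub_self]
    push_cast
    ring
  · simp only [min_eq_right h0, Nat.cast_sub h0]
    push_cast
    simp only [Nat.sub_self]
    push_cast
    ring

lemma wt_ulLead (p : Fin N × Fin N) : wt (ulLead p) = offDiag p := by
  simp only [ulLead, offDiag, map_add, wt_path, wt_basisVec]
  rcases le_total p.1.1 p.2.1 with h0 | h0
  · simp only [max_eq_right h0, Nat.cast_sub h0]
    push_cast
    simp only [Nat.sub_self]
    push_cast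
    ring
  · simp only [max_eq_left h0, Nat.cast_sub h0]
    push_cast
    simp only [Nat.sub_self]
    push_cast
    ring

/-- The total height of the torus coordinates. -/
def height (N : ℕ) : ShiftLattice →+ ℤ :=
  ∑ i ∈ Finset.range N, (i : ℤ) • (coord false 0 i + coord true 0 i)

lemma height_basisVec (b : Bool) {i : ℕ} (hi : i < N) : height N (basisVec b 0 i) = i := by
  simp only [height, AddMonoidHom.finsetSum_apply, AddMonoidHom.smul_apply, AddMonoidHom.add_apply,
    coord_basisVec]
  rw [Finset.sum_eq_single i]
  · cases b <;> simp
  · intro j _ hj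
    simp [hj]
  · simp [hi]

lemma height_path (b : Bool) {i d : ℕ} (hd : d ≤ i) : height N (path b i d) = 0 := by
  simp only [height, AddMonoidHom.finsetSum_apply, AddMonoidHom.smul_apply, AddMonoidHom.add_apply]
  refine Finset.sum_eq_zero fun j _ => ?_
  rw [coord_path _ _ _ _ _ _ hd, coord_path _ _ _ _ _ _ hd]
  simp

lemma height_ulLead (p : Fin N × Fin N) :
    height N (ulLead p) = height N (luLead p) + |(p.1 : ℤ) - p.2| := by
  simp only [ulLead, luLead, map_add]
  rw [height_path _ (by omega), height_path _ (by omega), height_path _ (by omega),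
    height_path _ (by omega), height_basisVec _ (by omega), height_basisVec _ (by omega),
    height_basisVec _ (by omega), height_basisVec _ (by omega)]
  rcases le_total p.1.1 p.2.1 with h0 | h0
  · rw [abs_of_nonpos (by omega)]
    simp only [max_eq_right h0, min_eq_left h0]; ring
  · rw [abs_of_nonneg (by omega)]
    simp only [max_eq_left h0, min_eq_right h0]; ring

lemma exists_dual_ulLead (p : Fin N × Fin N) :
    ∃ l : ShiftLattice →+ ℤ, ∀ p', l (ulLead p') = if p' = p then 1 else 0 := by
  have lower (i j : Fin N) (h : j < i) :
      ∃ l : ShiftLattice →+ ℤ, ∀ p', l (ulLead p') = if p' = (i, j) then 1 else 0 := by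
    refine ⟨coord false (i - j) (j + 1) - coord false (i - j + 1) j, fun ⟨i', j'⟩ => ?_⟩
    rw [Fin.lt_def] at h
    simp only [ulLead, AddMonoidHom.sub_apply, map_add, coord_basisVec, Prod.mk.injEq,
      Fin.ext_iff]
    rw [coord_path _ _ _ _ _ _ (by omega), coord_path _ _ _ _ _ _ (by omega),
      coord_path _ _ _ _ _ _ (by omega), coord_path _ _ _ _ _ _ (by omega)]
    simp only [true_and, reduceCtorEq, false_and, if_false]
    split_ifs <;> omega
  have upper (i j : Fin N) (h : i < j) :
      ∃ l : ShiftLattice →+ ℤ, ∀ p', l (ulLead p') = if p' = (i, j) then 1 else 0 := by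
    refine ⟨coord true (j - i) (i + 1) - coord true (j - i + 1) i, fun ⟨i', j'⟩ => ?_⟩
    rw [Fin.lt_def] at h
    simp only [ulLead, AddMonoidHom.sub_apply, map_add, coord_basisVec, Prod.mk.injEq,
      Fin.ext_iff]
    rw [coord_path _ _ _ _ _ _ (by omega), coord_path _ _ _ _ _ _ (by omega),
      coord_path _ _ _ _ _ _ (by omega), coord_path _ _ _ _ _ _ (by omega)]
    simp only [true_and, reduceCtorEq, false_and, if_false]
    split_ifs <;> omega
  have off (i j : Fin N) (h : i ≠ j) :
      ∃ l : ShiftLattice →+ ℤ, ∀ p', l (ulLead p') = if p' = (i, j) then 1 else 0 :=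
    (lt_or_gt_of_ne h).elim (upper i j) (lower i j)
  obtain ⟨i, j⟩ := p
  rcases eq_or_ne i j with rfl | h
  · choose! l hl using fun k => off k i
    refine ⟨coord false 0 i - ∑ k ∈ Finset.univ.erase i, l k, fun p' => ?_⟩
    rw [AddMonoidHom.sub_apply, AddMonoidHom.finsetSum_apply,
      Finset.sum_congr rfl fun k hk => hl k (Finset.ne_of_mem_erase hk) p']
    obtain ⟨i', j'⟩ := p'
    have h1 : coord false 0 i (ulLead (i', j')) = if i = j' then 1 else 0 := by
      simp only [ulLead, map_add, coord_basisVec]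
      rw [coord_path _ _ _ _ _ _ (by omega), coord_path _ _ _ _ _ _ (by omega)]
      simp [Fin.ext_iff]
    rw [h1]
    simp only [Prod.mk.injEq]
    by_cases h2 : i = j'
    · subst h2
      simp only [and_true, if_true, Finset.sum_ite_eq, Finset.mem_erase, Finset.mem_univ]
      split_ifs <;> simp_all
    · simp [h2, Ne.symm h2]
  · exact off i j h

lemma sum_ulLead_injective :
    Function.Injective fun A : Multiset (Fin N × Fin N) => (A.map ulLead).sum := by
  intro A B h
  ext p
  obtain ⟨l, hl⟩ := exists_dual_ulLead p
  have key (A : Multiset (Fin N × Fin N)) : l (A.map ulLead).sum = A.count p := by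
    induction A using Multiset.induction_on with
    | empty => simp
    | cons a A ih =>
      rw [Multiset.map_cons, Multiset.sum_cons, map_add, ih, hl, Multiset.count_cons]
      simp only [eq_comm]
      push_cast
      rw [add_comm]
  have := congrArg l h
  simp only [key] at this
  exact_mod_cast this

end Triangular

section Commuting

variable {N : ℕ} {q : ℂ} {M B : Type} [Ring M] [Algebra ℂ M] [Ring B] [Algebra ℂ B]
  {x : Fin N → Fin N → M}

lemma IsUniversalQuantumMatrix.commute_of_gen (hx : IsUniversalQuantumMatrix q x) {φ ψ : M →ₐ[ℂ] B}
    (h : ∀ i j k l, Commute (φ (x i j)) (ψ (x k l))) (a b : M) : Commute (φ a) (ψ b) := by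
  have ha : a ∈ Algebra.adjoin ℂ (Set.range fun p : Fin N × Fin N => x p.1 p.2) := by
    rw [hx.gen]; trivial
  have hb : b ∈ Algebra.adjoin ℂ (Set.range fun p : Fin N × Fin N => x p.1 p.2) := by
    rw [hx.gen]; trivial
  have h1 (i j : Fin N) : Commute (φ (x i j)) (ψ b) := by
    induction hb using Algebra.adjoin_induction with
    | mem _ h0 => obtain ⟨p, rfl⟩ := h0; exact h i j p.1 p.2
    | algebraMap r => rw [AlgHom.commutes]; exact Algebra.commute_algebraMap_right _ _
    | add _ _ _ _ h1 h2 => rw [map_add]; exact h1.add_right h2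
    | mul _ _ _ _ h1 h2 => rw [map_mul]; exact h1.mul_right h2
  induction ha using Algebra.adjoin_induction with
  | mem _ h0 => obtain ⟨p, rfl⟩ := h0; exact h1 p.1 p.2
  | algebraMap r => rw [AlgHom.commutes]; exact Algebra.commute_algebraMap_left _ _
  | add _ _ _ _ h1 h2 => rw [map_add]; exact h1.add_left h2
  | mul _ _ _ _ h1 h2 => rw [map_mul]; exact h1.mul_left h2

/-- The elements with `Δ f = Σ f₂ ⊗ D f₁`. -/
def twistCocomm (ΔM : M →ₐ[ℂ] M ⊗[ℂ] M) (D : M →ₐ[ℂ] M) : Subalgebra ℂ M :=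
  AlgHom.equalizer ΔM (((Algebra.TensorProduct.map (.id ℂ M) D).comp
    (Algebra.TensorProduct.comm ℂ M M).toAlgHom).comp ΔM)

lemma mem_twistCocomm {ΔM : M →ₐ[ℂ] M ⊗[ℂ] M} {D : M →ₐ[ℂ] M} {f : M} :
    f ∈ twistCocomm ΔM D ↔ ΔM f = Algebra.TensorProduct.map (.id ℂ M) D
      (Algebra.TensorProduct.comm ℂ M M (ΔM f)) := Iff.rfl

lemma IsUniversalQuantumMatrix.exists_convolution (hx : IsUniversalQuantumMatrix q x)
    {ΔM : M →ₐ[ℂ] M ⊗[ℂ] M} (hΔ : ∀ i j, ΔM (x i j) = ∑ k, x i k ⊗ₜ[ℂ] x k j)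
    {D : M →ₐ[ℂ] M} (hD : ∀ i j, D (x i j) = twistCoeff q i j • x i j) {φ ψ : M →ₐ[ℂ] B}
    (h : ∀ i j k l, Commute (φ (x i j)) (ψ (x k l))) :
    ∃ g₁ g₂ : M →ₐ[ℂ] B, (∀ i j, g₁ (x i j) = ∑ k, φ (x i k) * ψ (x k j)) ∧
      (∀ i j, g₂ (x i j) = ∑ k, twistCoeff q i k • (φ (x k j) * ψ (x i k))) ∧
      ∀ f ∈ twistCocomm ΔM D, g₁ f = g₂ f := by
  let L := Algebra.TensorProduct.lift φ ψ (hx.commute_of_gen h)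
  refine ⟨L.comp ΔM, L.comp (((Algebra.TensorProduct.map (.id ℂ M) D).comp
    (Algebra.TensorProduct.comm ℂ M M).toAlgHom).comp ΔM), fun i j => ?_, fun i j => ?_,
    fun f hf => congrArg L (mem_twistCocomm.1 hf)⟩
  · simp [L, hΔ]
  · simp [L, hΔ, hD]

end Commuting

section Leading

variable {N : ℕ} {q : ℂ} {M : Type} [Ring M] [Algebra ℂ M] {x : Fin N → Fin N → M}

lemma hasLead_wordProd {g : M →ₐ[ℂ] ShiftEnd} {φ : Fin N × Fin N → ShiftLattice}
    (h : ∀ p, HasLead (g (x p.1 p.2)) (φ p)) (A : Multiset (Fin N × Fin N)) :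
    HasLead (g (wordProd x A.toList)) (A.map φ).sum := by
  have key (l : List (Fin N × Fin N)) : HasLead (g (wordProd x l)) (l.map φ).sum := by
    induction l with
    | nil => simpa [wordProd] using HasLead.one
    | cons p l ih =>
      rw [wordProd, List.map_cons, List.prod_cons, map_mul]
      exact (h p).mul ih
  convert key A.toList using 1
  conv_lhs => rw [← Multiset.coe_toList A]
  rw [Multiset.map_coe, Multiset.sum_coe]

lemma wt_sum_map {φ : Fin N × Fin N → ShiftLattice} (h : ∀ p, wt (φ p) = offDiag p)
    (A : Multiset (Fin N × Fin N)) : wt (A.map φ).sum = (A.map offDiag).sum := by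
  rw [map_multiset_sum, Multiset.map_map]
  simp only [Function.comp_def, h]

/-- The shift vector of a monomial of minimal weight gives a coefficient of the operator. -/
lemma eval_single {g : M →ₐ[ℂ] ShiftEnd} {φ : Fin N × Fin N → ShiftLattice}
    (h : ∀ p, HasLead (g (x p.1 p.2)) (φ p)) (hφ : ∀ p, wt (φ p) = offDiag p)
    (A : Multiset (Fin N × Fin N)) :
    ∃ u : ℂ, u ≠ 0 ∧ ∀ d : ShiftLattice, wt d ≤ (A.map offDiag).sum →
      g (wordProd x A.toList) (Pi.single d 1) 0 = if (A.map φ).sum = d then u else 0 := by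
  obtain ⟨u, hu, H⟩ := hasLead_wordProd h A 0
  refine ⟨u, hu, fun d hd => ?_⟩
  rw [H, zero_add, Pi.single_apply]
  · simp
  · intro v hv
    rw [map_zero, zero_add, wt_sum_map hφ] at hv
    rw [Pi.single_apply, if_neg]
    rintro rfl
    omega

lemma exists_extremal (c : Multiset (Fin N × Fin N) →₀ ℂ) (hc : c ≠ 0) :
    ∃ A ∈ c.support, (∀ B ∈ c.support, (A.map offDiag).sum ≤ (B.map offDiag).sum) ∧
      ∀ B ∈ c.support, (B.map offDiag).sum = (A.map offDiag).sum →
        height N (B.map ulLead).sum ≤ height N (A.map ulLead).sum := by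
  obtain ⟨A₀, h₀, hmin⟩ := c.support.exists_min_image (fun A => (A.map offDiag).sum)
    (Finsupp.support_nonempty_iff.2 hc)
  obtain ⟨A, hA, hmax⟩ := (c.support.filter fun B =>
      (B.map offDiag).sum = (A₀.map offDiag).sum).exists_max_image
    (fun A => height N (A.map ulLead).sum) ⟨A₀, by simp [Finsupp.mem_support_iff.1 h₀]⟩
  rw [Finset.mem_filter] at hA
  refine ⟨A, hA.1, fun B hB => by rw [hA.2]; exact hmin B hB, fun B hB hBA => hmax B ?_⟩
  rw [Finset.mem_filter]
  exact ⟨hB, hBA.trans hA.2⟩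

lemma eval_ul_ne_zero {g : M →ₐ[ℂ] ShiftEnd} (h : ∀ p, HasLead (g (x p.1 p.2)) (ulLead p))
    (c : Multiset (Fin N × Fin N) →₀ ℂ) {A : Multiset (Fin N × Fin N)} (hA : A ∈ c.support)
    (hmin : ∀ B ∈ c.support, (A.map offDiag).sum ≤ (B.map offDiag).sum) :
    g (c.sum fun A a => a • wordProd x A.toList) (Pi.single (A.map ulLead).sum 1) 0 ≠ 0 := by
  rw [Finsupp.sum, map_sum, LinearMap.sum_apply, Finset.sum_apply, Finset.sum_eq_single A]
  · obtain ⟨u, hu, H⟩ := eval_single h wt_ulLead A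
    rw [map_smul, LinearMap.smul_apply, Pi.smul_apply, H _ (wt_sum_map wt_ulLead A).le, if_pos rfl]
    exact mul_ne_zero (Finsupp.mem_support_iff.1 hA) hu
  · intro B hB hBA
    obtain ⟨u, hu, H⟩ := eval_single h wt_ulLead B
    rw [map_smul, LinearMap.smul_apply, Pi.smul_apply,
      H _ ((wt_sum_map wt_ulLead A).le.trans (hmin B hB)),
      if_neg fun h => hBA (sum_ulLead_injective h), smul_zero]
  · exact fun h => absurd hA h

lemma injective_of_ulLead (hq : q ≠ 0) (hx : IsUniversalQuantumMatrix q x) {g : M →ₐ[ℂ] ShiftEnd}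
    (h : ∀ p, HasLead (g (x p.1 p.2)) (ulLead p)) : Function.Injective g := by
  rw [injective_iff_map_eq_zero]
  intro f hf
  obtain ⟨c, rfl⟩ := hx.exists_finsupp hq f
  by_contra hne
  have hc : c ≠ 0 := by rintro rfl; simp at hne
  obtain ⟨A, hA, hmin, -⟩ := exists_extremal c hc
  exact eval_ul_ne_zero h c hA hmin (by rw [hf]; rfl)

lemma exists_ul_hom (hq : q ≠ 0) (hx : IsUniversalQuantumMatrix q x) :
    ∃ g : M →ₐ[ℂ] ShiftEnd, ∀ i j, g (x i j)
      = ∑ k, (twistCoeff q i k • upperFactor N q i k) * lowerFactor N q k j := by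
  refine hx.lift _ _ (IsQuantumMatrix.mul ?_ (isQuantumMatrix_lowerFactor hq)
    fun i j k l => ((lowerFactor_commute_upperFactor hq k l i j).smul_right _).symm)
  exact (isQuantumMatrix_upperFactor hq).scale (fun i => q ^ (2 * i.1)) fun j => (q ^ (2 * j.1))⁻¹

lemma exists_injective_isUnit (hq : q ≠ 0) (hx : IsUniversalQuantumMatrix q x) :
    ∃ g : M →ₐ[ℂ] ShiftEnd, Function.Injective g ∧ IsUnit (g (qdet q x)) := by
  obtain ⟨g, hg⟩ := exists_ul_hom hq hx
  refine ⟨g, injective_of_ulLead hq hx fun p => ?_, ?_⟩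
  · rw [hg]
    convert hasLead_ul hq p using 3 with k
    rw [smul_mul_assoc, (lowerFactor_commute_upperFactor hq _ _ _ _).eq]
  · have hlist {l : List ShiftEnd} (h : ∀ a ∈ l, IsUnit a) : IsUnit l.prod := by
      induction l with
      | nil => simp
      | cons a l ih =>
        rw [List.prod_cons]
        exact (h a (by simp)).mul (ih fun b hb => h b (by simp [hb]))
    rw [qdet, qMinor_eq_qDet, map_qDet]
    simp only [hg]
    rw [qDet_mul hq (isQuantumMatrix_lowerFactor hq)
      fun i j k l => ((lowerFactor_commute_upperFactor hq k l i j).smul_right _).symm,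
      Finset.sum_eq_single Finset.univ,
      qDet_sort_of_upper fun i j h => by rw [upperFactor_eq_zero h, smul_zero],
      qDet_sort_of_lower fun i j h => lowerFactor_eq_zero h]
    · refine (hlist ?_).mul (hlist ?_)
      · simp only [List.mem_map]
        rintro _ ⟨i, -, rfl⟩
        rw [twistCoeff, mul_inv_cancel₀ (pow_ne_zero _ hq), one_smul]
        exact isUnit_upperFactor hq i
      · simp only [List.mem_map]
        rintro _ ⟨i, -, rfl⟩
        exact isUnit_lowerFactor hq i
    · intro K _ hK
      rw [qDet_eq_zero_of_card_ne, zero_mul]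
      rw [Finset.length_sort]
      exact fun h => hK (Finset.card_eq_iff_eq_univ _ |>.1 (by simpa using h))
    · simp

lemma IsUniversalQuantumMatrix.eq_zero_of_restrict (hq : q ≠ 0) (hx : IsUniversalQuantumMatrix q x)
    {ΔM : M →ₐ[ℂ] M ⊗[ℂ] M} (hΔ : ∀ i j, ΔM (x i j) = ∑ k, x i k ⊗ₜ[ℂ] x k j)
    {D : M →ₐ[ℂ] M} (hD : ∀ i j, D (x i j) = twistCoeff q i j • x i j)
    {r : M →ₐ[ℂ] MvPolynomial (Fin N) ℂ}
    (hr : ∀ i j, r (x i j) = if i = j then MvPolynomial.X i else 0)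
    {f : M} (hf : f ∈ twistCocomm ΔM D) (hrf : r f = 0) : f = 0 := by
  obtain ⟨φ, hφ⟩ := hx.lift _ _ (isQuantumMatrix_lowerFactor hq)
  obtain ⟨ψ, hψ⟩ := hx.lift _ _ (isQuantumMatrix_upperFactor hq)
  obtain ⟨g₁, g₂, h₁, h₂, H⟩ := hx.exists_convolution hΔ hD (φ := φ) (ψ := ψ) fun i j k l => by
    rw [hφ, hψ]; exact lowerFactor_commute_upperFactor hq _ _ _ _
  simp only [hφ, hψ] at h₁ h₂
  have L₁ (p : Fin N × Fin N) : HasLead (g₁ (x p.1 p.2)) (luLead p) := by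
    rw [h₁]; exact hasLead_lu hq p
  have L₂ (p : Fin N × Fin N) : HasLead (g₂ (x p.1 p.2)) (ulLead p) := by
    rw [h₂]; exact hasLead_ul hq p
  obtain ⟨c, rfl⟩ := hx.exists_finsupp hq f
  by_contra hne
  have hc : c ≠ 0 := by rintro rfl; simp at hne
  obtain ⟨A, hA, hmin, hmax⟩ := exists_extremal c hc
  have hdiag : ∀ p ∈ A, p.1 = p.2 := by
    have hev := eval_ul_ne_zero L₂ c hA hmin
    rw [← H _ hf, Finsupp.sum, map_sum, LinearMap.sum_apply, Finset.sum_apply] at hev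
    obtain ⟨B, hB, hBA⟩ := Finset.exists_ne_zero_of_sum_ne_zero hev
    obtain ⟨u, hu, hu'⟩ := eval_single L₁ wt_luLead B
    rw [map_smul, LinearMap.smul_apply, Pi.smul_apply,
      hu' _ ((wt_sum_map wt_ulLead A).le.trans (hmin B hB))] at hBA
    have hBA' : (B.map luLead).sum = (A.map ulLead).sum := by
      by_contra h
      simp [h] at hBA
    have hw : (B.map offDiag).sum = (A.map offDiag).sum := by
      rw [← wt_sum_map wt_luLead, ← wt_sum_map wt_ulLead, hBA']
    have hle := hmax B hB hw
    rw [← hBA', map_multiset_sum, map_multiset_sum, Multiset.map_map, Multiset.map_map,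
      show (height N ∘ ulLead) = fun p => (height N ∘ luLead) p + |(p.1 : ℤ) - p.2| from
        funext fun p => height_ulLead p, Multiset.sum_map_add] at hle
    have hB0 : (B.map fun p : Fin N × Fin N => |(p.1 : ℤ) - p.2|).sum = 0 := by
      refine le_antisymm (by linarith) (Multiset.sum_nonneg ?_)
      simp only [Multiset.mem_map]
      rintro _ ⟨p, -, rfl⟩
      exact abs_nonneg _
    have hBd (p) (hp : p ∈ B) : (p.1 : ℤ) - p.2 = 0 := by
      have hp' := Multiset.single_le_sum (s := B.map fun p : Fin N × Fin N => |(p.1 : ℤ) - p.2|)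
        (by
          simp only [Multiset.mem_map]
          rintro _ ⟨p, -, rfl⟩
          exact abs_nonneg _) _ (Multiset.mem_map_of_mem _ hp)
      rw [hB0] at hp'
      exact abs_eq_zero.1 (le_antisymm hp' (abs_nonneg _))
    have hA0 : (A.map offDiag).sum = 0 := by
      rw [← hw]
      refine Multiset.sum_eq_zero ?_
      simp only [Multiset.mem_map]
      rintro _ ⟨p, hp, rfl⟩
      rw [offDiag, hBd p hp]; rfl
    intro p hp
    have hp' := Multiset.single_le_sum (s := A.map offDiag)
      (by
        simp only [Multiset.mem_map]
        rintro _ ⟨p, -, rfl⟩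
        exact offDiag_nonneg p) _ (Multiset.mem_map_of_mem _ hp)
    rw [hA0] at hp'
    have := pow_eq_zero_iff (two_ne_zero) |>.1 (le_antisymm hp' (offDiag_nonneg p))
    exact Fin.ext (by omega)
  have hword (B : Multiset (Fin N × Fin N)) : r (wordProd x B.toList)
      = if ∀ p ∈ B, p.1 = p.2 then
        MvPolynomial.monomial (Multiset.toFinsupp (B.map Prod.fst)) 1 else 0 := by
    have h1 : r (wordProd x B.toList)
        = (B.map fun p => if p.1 = p.2 then (MvPolynomial.X p.1 : MvPolynomial (Fin N) ℂ) else 0).prod := by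
      rw [wordProd, map_list_prod, List.map_map]
      conv_rhs => rw [← Multiset.coe_toList B]
      rw [Multiset.map_coe, Multiset.prod_coe]
      simp only [Function.comp_def, hr]
    rw [h1]
    clear h1
    induction B using Multiset.induction_on with
    | empty => simp
    | cons p B ih =>
      rw [Multiset.map_cons, Multiset.prod_cons, ih]
      simp only [Multiset.forall_mem_cons, Multiset.map_cons]
      by_cases hp : p.1 = p.2 <;> by_cases hB : ∀ p ∈ B, p.1 = p.2
      · rw [if_pos hp, if_pos hB, if_pos ⟨hp, hB⟩, MvPolynomial.X, MvPolynomial.monomial_mul,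
          ← Multiset.singleton_add, map_add, Multiset.toFinsupp_singleton, one_mul]
      · rw [if_neg hB, if_neg (mt And.right hB), mul_zero]
      · rw [if_neg hp, if_neg (mt And.left hp), zero_mul]
      · rw [if_neg hp, if_neg (mt And.left hp), zero_mul]
  have := congrArg (MvPolynomial.coeff (Multiset.toFinsupp (A.map Prod.fst))) hrf
  rw [Finsupp.sum, map_sum, MvPolynomial.coeff_sum, Finset.sum_eq_single A, map_smul, hword,
    if_pos hdiag, MvPolynomial.coeff_smul, MvPolynomial.coeff_monomial, if_pos rfl] at this
  · exact Finsupp.mem_support_iff.1 hA (by simpa using this)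
  · intro B _ hBA
    rw [map_smul, hword, MvPolynomial.coeff_smul]
    split_ifs with hB
    · rw [MvPolynomial.coeff_monomial, if_neg, smul_zero]
      intro h
      have := Multiset.toFinsupp.injective h
      refine hBA ?_
      have key (C : Multiset (Fin N × Fin N)) (hC : ∀ p ∈ C, p.1 = p.2) :
          (C.map Prod.fst).map (fun i => (i, i)) = C := by
        rw [Multiset.map_map]
        conv_rhs => rw [← Multiset.map_id C]
        exact Multiset.map_congr rfl fun p hp => Prod.ext rfl (hC p hp)
      rw [← key B hB, ← key A hdiag, this]
    · simp
  · exact fun h => absurd hA h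

end Leading

lemma IsUniversalQuantumMatrix.exists_twist {N : ℕ} {q : ℂ} {M : Type} [Ring M] [Algebra ℂ M]
    {x : Fin N → Fin N → M} (hx : IsUniversalQuantumMatrix q x) :
    ∃ D : M →ₐ[ℂ] M, ∀ i j, D (x i j) = twistCoeff q i j • x i j :=
  hx.lift M _ (hx.rtt.scale (fun i => q ^ (2 * i.1)) fun j => (q ^ (2 * j.1))⁻¹)

namespace IsQuantumGL

variable {N : ℕ} {q : ℂ} {M G : Type} [Ring M] [Algebra ℂ M] [Ring G] [Algebra ℂ G]
    {x : Fin N → Fin N → M} {ι : M →ₐ[ℂ] G} {ΔM : M →ₐ[ℂ] M ⊗[ℂ] M}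
    {ΔG : G →ₐ[ℂ] G ⊗[ℂ] G} {εG : G →ₐ[ℂ] ℂ} {St : G →ₗ[ℂ] G}

lemma injective (h : IsQuantumGL q x ι ΔM ΔG εG St) : Function.Injective ι := by
  obtain ⟨g, hg, hu⟩ := exists_injective_isUnit h.ne_zero h.univ
  obtain ⟨ψ, rfl⟩ := h.lift _ g hu
  exact Function.Injective.of_comp hg

lemma antipode_ite (h : IsQuantumGL q x ι ΔM ΔG εG St) (p : Prop) [Decidable p] :
    St (if p then 1 else 0) = if p then 1 else 0 := by
  split_ifs
  · exact h.antipode_one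
  · exact map_zero _

lemma sum_sq_antipode_mul_antipode (h : IsQuantumGL q x ι ΔM ΔG εG St) (i j : Fin N) :
    ∑ k, St (St (ι (x k j))) * St (ι (x i k)) = if i = j then 1 else 0 := by
  have := congrArg St (h.antipode_right_gen i j)
  simpa only [map_sum, h.antipode_mul, h.antipode_ite] using this

lemma sq_antipode_gen (h : IsQuantumGL q x ι ΔM ΔG εG St) (i j : Fin N) :
    St (St (ι (x i j))) = twistCoeff q i j • ι (x i j) := by
  have hw (i k : Fin N) : twistCoeff q i k = (qWeight q i)⁻¹ * qWeight q k := by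
    have := h.ne_zero
    simp only [twistCoeff, qWeight]
    simp only [mul_add, pow_add, inv_pow]
    field_simp
  have h1 (i j : Fin N) : ∑ k, St (ι (x k j)) * (twistCoeff q i k • ι (x i k))
      = if i = j then 1 else 0 := by
    have := sum_qWeight_mul_inverse h.ne_zero (h.univ.rtt.map ι) h.antipode_left_gen
      h.antipode_right_gen j i
    simp only [hw, mul_smul, mul_smul_comm, ← Finset.smul_sum]
    rw [this]
    simp only [eq_comm (a := j)]
    split_ifs with hij
    · rw [Algebra.algebraMap_eq_smul_one, inv_smul_smul₀ (qWeight_ne_zero h.ne_zero _)]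
    · exact smul_zero _
  have key (y : Fin N → Fin N → G)
      (hy : ∀ i j, ∑ k, St (ι (x k j)) * y i k = if i = j then 1 else 0) :
      y i j = St (St (ι (x i j))) := by
    have h2 := h.sum_sq_antipode_mul_antipode
    calc y i j = ∑ k, (if k = j then 1 else 0) * y i k := by simp
      _ = ∑ k, ∑ l, St (St (ι (x l j))) * (St (ι (x k l)) * y i k) := by
        simp only [← h2, Finset.sum_mul, mul_assoc]
      _ = ∑ l, St (St (ι (x l j))) * ∑ k, St (ι (x k l)) * y i k := by
        rw [Finset.sum_comm]; simp only [Finset.mul_sum]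
      _ = _ := by simp [hy]
  exact (key _ h1).symm

lemma sq_antipode (h : IsQuantumGL q x ι ΔM ΔG εG St) {D : M →ₐ[ℂ] M}
    (hD : ∀ i j, D (x i j) = twistCoeff q i j • x i j) (m : M) : St (St (ι m)) = ι (D m) := by
  let S2 : G →ₐ[ℂ] G := AlgHom.ofLinearMap (St ∘ₗ St) (by simp [h.antipode_one])
    fun a b => by simp [h.antipode_mul]
  have : S2.comp ι = ι.comp D := h.univ.ext fun i j => by
    simp only [AlgHom.comp_apply, hD, map_smul]
    exact h.sq_antipode_gen i j
  exact DFunLike.congr_fun this m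

lemma mem_twistCocomm_of_coinvariant (h : IsQuantumGL q x ι ΔM ΔG εG St) {D : M →ₐ[ℂ] M}
    (hD : ∀ i j, D (x i j) = twistCoeff q i j • x i j) {f : M}
    (hf : adjBeta ΔM ι St f = f ⊗ₜ 1) : f ∈ twistCocomm ΔM D := by
  let H : M →ₐ[ℂ] M ⊗[ℂ] G := (Algebra.TensorProduct.map (.id ℂ M) (ι.comp D)).comp
    ((Algebra.TensorProduct.comm ℂ M M).toAlgHom.comp ΔM)
  let R : G →ₐ[ℂ] M ⊗[ℂ] G := Algebra.TensorProduct.includeRight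
  let K : M ⊗[ℂ] M →ₗ[ℂ] M ⊗[ℂ] G := LinearMap.mul' ℂ (M ⊗[ℂ] G) ∘ₗ
    TensorProduct.map H.toLinearMap (R.toLinearMap ∘ₗ St ∘ₗ ι.toLinearMap) ∘ₗ
      (TensorProduct.comm ℂ M M).toLinearMap
  have hK (a b : M) : K (a ⊗ₜ b) = H b * (1 ⊗ₜ St (ι a)) := by simp [K, R]
  let Ψ : M ⊗[ℂ] G →ₗ[ℂ] M ⊗[ℂ] G :=
    LinearMap.mul' ℂ (M ⊗[ℂ] G) ∘ₗ TensorProduct.map H.toLinearMap R.toLinearMap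
  have hΨ (a : M) (c : G) : Ψ (a ⊗ₜ c) = H a * (1 ⊗ₜ c) := by simp [Ψ, R]
  have hK1 (t : M ⊗[ℂ] M) (a b : M) : K ((a ⊗ₜ b) * t) = H b * K t * (1 ⊗ₜ St (ι a)) := by
    induction t using TensorProduct.induction_on with
    | zero => simp
    | add s t hs ht => simp only [mul_add, add_mul, map_add, hs, ht]
    | tmul c d => simp [hK, h.antipode_mul, mul_assoc]
  have hK2 (t : M ⊗[ℂ] M) (b : M) (hb : K (ΔM b) = b ⊗ₜ 1) : K (t * ΔM b) = K t * (b ⊗ₜ 1) := by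
    induction t using TensorProduct.induction_on with
    | zero => simp
    | add s t hs ht => simp only [add_mul, map_add, hs, ht]
    | tmul c d => rw [hK1, hb, hK, mul_assoc, mul_assoc]; simp
  have hK3 (a : M) : K (ΔM a) = a ⊗ₜ 1 := by
    have ha : a ∈ Algebra.adjoin ℂ (Set.range fun p : Fin N × Fin N => x p.1 p.2) := by
      rw [h.univ.gen]; trivial
    induction ha using Algebra.adjoin_induction with
    | mem _ h0 =>
      obtain ⟨⟨i, j⟩, rfl⟩ := h0
      have h1 (k l : Fin N) : ι (D (x k l)) = St (St (ι (x k l))) := (h.sq_antipode hD _).symm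
      simp only [h.comul, map_sum, hK, H, AlgHom.comp_apply]
      simp only [AlgEquiv.coe_toAlgHom, Algebra.TensorProduct.comm_tmul,
        Algebra.TensorProduct.map_tmul, AlgHom.id_apply, AlgHom.comp_apply, h1, Finset.sum_mul,
        Algebra.TensorProduct.tmul_mul_tmul, mul_one]
      rw [Finset.sum_comm]
      simp only [← tmul_sum, h.sum_sq_antipode_mul_antipode]
      simp [TensorProduct.tmul_ite]
    | algebraMap r =>
      rw [AlgHom.commutes, Algebra.algebraMap_eq_smul_one, map_smul,
        Algebra.TensorProduct.one_def, hK]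
      simp [h.antipode_one, smul_tmul', Algebra.algebraMap_eq_smul_one]
    | add a b _ _ h1 h2 => simp only [map_add, h1, h2, add_tmul]
    | mul a b _ _ h1 h2 => rw [map_mul, hK2 _ _ h2, h1]; simp
  have hΨβ (t : M ⊗[ℂ] M) : Ψ (adjMap ι St (Algebra.TensorProduct.map ΔM (.id ℂ M) t))
      = Algebra.TensorProduct.map (.id ℂ M) ι t := by
    induction t using TensorProduct.induction_on with
    | zero => simp
    | add s t hs ht => simp only [map_add, hs, ht]
    | tmul a c =>
      have (s : M ⊗[ℂ] M) : Ψ (adjMap ι St (s ⊗ₜ c)) = K s * (1 ⊗ₜ ι c) := by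
        induction s using TensorProduct.induction_on with
        | zero => simp
        | add s t hs ht => simp only [map_add, add_mul, add_tmul, hs, ht]
        | tmul a b => rw [adjMap_tmul, hΨ, hK, mul_assoc]; simp
      rw [Algebra.TensorProduct.map_tmul, AlgHom.id_apply, this, hK3]
      simp
  rw [mem_twistCocomm]
  have hinj : Function.Injective (Algebra.TensorProduct.map (.id ℂ M) ι) :=
    Module.Flat.lTensor_preserves_injective_linearMap (M := M) ι.toLinearMap h.injective
  apply hinj
  rw [← hΨβ, ← adjBeta_apply, hf, hΨ, ← Algebra.TensorProduct.one_def, mul_one]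
  simp only [H, AlgHom.comp_apply]
  generalize ΔM f = t
  induction t using TensorProduct.induction_on with
  | zero => simp
  | add s t hs ht => simp only [map_add, hs, ht]
  | tmul a c => simp

end IsQuantumGL

section Existence

variable {N : ℕ} {q : ℂ}

/-- The relations between the entries of a quantum matrix. -/
inductive QuantumMatrixRel (N : ℕ) (q : ℂ) :
    FreeAlgebra ℂ (Fin N × Fin N) → FreeAlgebra ℂ (Fin N × Fin N) → Prop
  | rtt (a b c d : Fin N) : QuantumMatrixRel N q
      (diagCoeff q a b • (FreeAlgebra.ι ℂ (a, c) * FreeAlgebra.ι ℂ (b, d))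
        + ltCoeff q b a • (FreeAlgebra.ι ℂ (b, c) * FreeAlgebra.ι ℂ (a, d)))
      (diagCoeff q c d • (FreeAlgebra.ι ℂ (b, d) * FreeAlgebra.ι ℂ (a, c))
        + ltCoeff q c d • (FreeAlgebra.ι ℂ (b, c) * FreeAlgebra.ι ℂ (a, d)))

lemma exists_isUniversalQuantumMatrix (N : ℕ) (q : ℂ) :
    ∃ (M : Type) (_ : Ring M) (_ : Algebra ℂ M) (x : Fin N → Fin N → M),
      IsUniversalQuantumMatrix q x := by
  let π := RingQuot.mkAlgHom ℂ (QuantumMatrixRel N q)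
  refine ⟨RingQuot (QuantumMatrixRel N q), inferInstance, inferInstance,
    fun i j => π (FreeAlgebra.ι ℂ (i, j)), ?_, ?_, fun B _ _ y hy => ?_⟩
  · intro a b c d
    simpa [π] using RingQuot.mkAlgHom_rel ℂ (QuantumMatrixRel.rtt (q := q) a b c d)
  · rw [show (Set.range fun p : Fin N × Fin N => π (FreeAlgebra.ι ℂ (p.1, p.2)))
      = π '' Set.range (FreeAlgebra.ι ℂ) by rw [← Set.range_comp]; rfl, ← AlgHom.map_adjoin,
      FreeAlgebra.adjoin_range_ι, Algebra.map_top, AlgHom.range_eq_top]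
    exact RingQuot.mkAlgHom_surjective _ _
  · refine ⟨RingQuot.liftAlgHom ℂ ⟨FreeAlgebra.lift ℂ fun p => y p.1 p.2, ?_⟩, fun i j => ?_⟩
    · rintro _ _ ⟨a, b, c, d⟩
      simpa using hy a b c d
    · simp [π]

lemma IsUniversalQuantumMatrix.exists_comul {M : Type} [Ring M] [Algebra ℂ M]
    {x : Fin N → Fin N → M} (hx : IsUniversalQuantumMatrix q x) :
    ∃ Δ : M →ₐ[ℂ] M ⊗[ℂ] M, ∀ i j, Δ (x i j) = ∑ k, x i k ⊗ₜ[ℂ] x k j := by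
  let l : M →ₐ[ℂ] M ⊗[ℂ] M := Algebra.TensorProduct.includeLeft
  let r : M →ₐ[ℂ] M ⊗[ℂ] M := Algebra.TensorProduct.includeRight
  obtain ⟨Δ, h⟩ := hx.lift _ _ ((hx.rtt.map l).mul (hx.rtt.map r) fun i j k m => by
    simp [l, r, Commute, SemiconjBy])
  exact ⟨Δ, fun i j => by simp [h, l, r]⟩

end Existence

section TwoByTwo

variable {q : ℂ} {M : Type} [Ring M] [Algebra ℂ M] {x : Fin 2 → Fin 2 → M}

lemma qdet_two (x : Fin 2 → Fin 2 → M) : qdet q x = x 0 0 * x 1 1 - q • (x 0 1 * x 1 0) := by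
  have h : (Finset.univ : Finset (Fin 2)).sort = [0, 1] := by
    rw [show (Finset.univ : Finset (Fin 2)) = insert 0 {1} by decide,
      Finset.sort_insert _ (by decide) (by decide), Finset.sort_singleton]
  have h1 : (Finset.univ : Finset (Fin 2)).filter (· < 0) = ∅ := by decide
  have h2 : (Finset.univ : Finset (Fin 2)).filter (· < 1) = {0} := by decide
  have h3 : (Finset.univ : Finset (Fin 2)).erase 0 = {1} := by decide
  have h4 : (Finset.univ : Finset (Fin 2)).erase 1 = {0} := by decide
  rw [qdet, qMinor_eq_qDet, h]
  simp only [qDet_cons, qDet_nil, h1, h2, h3, h4, Fin.sum_univ_two, Finset.sum_singleton]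
  simp [Finset.filter_singleton, sub_eq_add_neg]

lemma IsQuantumMatrix.commute_qdet_two (hq : q ≠ 0) (hx : IsQuantumMatrix q x) (i j : Fin 2) :
    x i j * qdet q x = qdet q x * x i j := by
  have e1 := hx.row 0 0 1 (by decide)
  have e2 := hx.row 1 0 1 (by decide)
  have e3 := hx.col 0 1 0 (by decide)
  have e4 := hx.col 0 1 1 (by decide)
  have e5 := hx.anti 0 1 0 1 (by decide) (by decide)
  have e6 := hx.diag 0 1 0 1 (by decide) (by decide)
  rw [qdet_two]
  revert i j
  simp only [Fin.forall_fin_two]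
  generalize x 0 0 = a at *
  generalize x 0 1 = b at *
  generalize x 1 0 = c at *
  generalize x 1 1 = d at *
  have ba : b * a = q⁻¹ • (a * b) := by rw [e1, inv_smul_smul₀ hq]
  have ca : c * a = q⁻¹ • (a * c) := by rw [e3, inv_smul_smul₀ hq]
  have dc : d * c = q⁻¹ • (c * d) := by rw [e2, inv_smul_smul₀ hq]
  have db : d * b = q⁻¹ • (b * d) := by rw [e4, inv_smul_smul₀ hq]
  have da : d * a = a * d - (q - q⁻¹) • (b * c) := by rw [← e6]; abel
  have ba' (t : M) : b * (a * t) = q⁻¹ • (a * (b * t)) := by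
    rw [← mul_assoc, ba, smul_mul_assoc, mul_assoc]
  have ca' (t : M) : c * (a * t) = q⁻¹ • (a * (c * t)) := by
    rw [← mul_assoc, ca, smul_mul_assoc, mul_assoc]
  have dc' (t : M) : d * (c * t) = q⁻¹ • (c * (d * t)) := by
    rw [← mul_assoc, dc, smul_mul_assoc, mul_assoc]
  have db' (t : M) : d * (b * t) = q⁻¹ • (b * (d * t)) := by
    rw [← mul_assoc, db, smul_mul_assoc, mul_assoc]
  have da' (t : M) : d * (a * t) = a * (d * t) - (q - q⁻¹) • (b * (c * t)) := by
    rw [← mul_assoc, da, sub_mul, smul_mul_assoc, mul_assoc, mul_assoc]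
  have cb' (t : M) : c * (b * t) = b * (c * t) := by rw [← mul_assoc, ← e5, mul_assoc]
  refine ⟨⟨?_, ?_⟩, ?_, ?_⟩ <;>
  · simp only [mul_sub, sub_mul, mul_smul_comm, smul_mul_assoc, mul_assoc, ca, dc, db, da,
      ba', ca', db', da', ← e5, cb', smul_smul]
    try match_scalars <;> field_simp <;> ring

end TwoByTwo

section ShiftMonomial

/-- `T` is a nonzero multiple of a `q`-difference operator with shift vector `e`. -/
def IsShiftMonomial (q : ℂ) (T : ShiftEnd) (e : ShiftLattice) : Prop :=
  ∃ (m : ShiftLattice →+ ℤ) (u : ℂ), u ≠ 0 ∧ T = u • qShift q m e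

variable {q : ℂ}

lemma isShiftMonomial_qShift (m : ShiftLattice →+ ℤ) (e : ShiftLattice) :
    IsShiftMonomial q (qShift q m e) e :=
  ⟨m, 1, one_ne_zero, (one_smul _ _).symm⟩

lemma IsShiftMonomial.mul (hq : q ≠ 0) {S T : ShiftEnd} {d e : ShiftLattice}
    (hS : IsShiftMonomial q S d) (hT : IsShiftMonomial q T e) :
    IsShiftMonomial q (S * T) (d + e) := by
  obtain ⟨m, u, hu, rfl⟩ := hS
  obtain ⟨m', u', hu', rfl⟩ := hT
  exact ⟨m + m', u * u' * q ^ m' d, mul_ne_zero (mul_ne_zero hu hu') (zpow_ne_zero _ hq), by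
    rw [smul_mul_smul_comm, qShift_mul hq, smul_smul]⟩

lemma IsShiftMonomial.pow (hq : q ≠ 0) {S : ShiftEnd} {d : ShiftLattice}
    (hS : IsShiftMonomial q S d) (n : ℕ) : IsShiftMonomial q (S ^ n) (n • d) := by
  induction n with
  | zero => rw [pow_zero, zero_smul, ← qShift_zero (q := q)]; exact isShiftMonomial_qShift _ _
  | succ n ih => rw [pow_succ, succ_nsmul]; exact ih.mul hq hS

lemma linearIndependent_of_isShiftMonomial {I : Type} {T : I → ShiftEnd} {e : I → ShiftLattice}
    (he : Function.Injective e) (h : ∀ i, IsShiftMonomial q (T i) (e i)) :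
    LinearIndependent ℂ T := by
  rw [linearIndependent_iff]
  intro c hc
  ext i
  have := congrFun (LinearMap.congr_fun hc (Pi.single (e i) 1)) 0
  rw [Finsupp.linearCombination_apply, Finsupp.sum, LinearMap.sum_apply, Finset.sum_apply,
    Finset.sum_eq_single i] at this
  · obtain ⟨m, u, hu, hT⟩ := h i
    simpa [hT, qShift_apply, hu] using this
  · intro j _ hj
    obtain ⟨m, u, hu, hT⟩ := h j
    simp [hT, qShift_apply, he.ne hj]
  · intro hi
    simp [Finsupp.notMem_support_iff.1 hi]

end ShiftMonomial

section TwoByTwo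

variable {q : ℂ} {M : Type} [Ring M] [Algebra ℂ M] {x : Fin 2 → Fin 2 → M}

/-- The monomials spanning a complement of the ideal generated by the quantum determinant. -/
def detMonomial (x : Fin 2 → Fin 2 → M) (p : ℕ × ℕ × ℤ) : M :=
  x 0 1 ^ p.1 * x 1 0 ^ p.2.1 * x 0 0 ^ p.2.2.toNat * x 1 1 ^ (-p.2.2).toNat

lemma mul_pow_of_skew {a b : M} {r : ℂ} (h : a * b = r • (b * a)) (n : ℕ) :
    a * b ^ n = r ^ n • (b ^ n * a) := by
  induction n with
  | zero => simp
  | succ n ih =>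
    rw [pow_succ, ← mul_assoc, ih, smul_mul_assoc, mul_assoc, h, mul_smul_comm, smul_smul,
      ← pow_succ, mul_assoc]

lemma IsUniversalQuantumMatrix.exists_eq_det_mul_add (hq : q ≠ 0)
    (hx : IsUniversalQuantumMatrix q x) (f : M) :
    ∃ g, f - qdet q x * g ∈ Submodule.span ℂ (Set.range (detMonomial x)) := by
  have e1 := hx.rtt.row 0 0 1 (by decide)
  have e2 := hx.rtt.row 1 0 1 (by decide)
  have e3 := hx.rtt.col 0 1 0 (by decide)
  have e4 := hx.rtt.col 0 1 1 (by decide)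
  have e5 := hx.rtt.anti 0 1 0 1 (by decide) (by decide)
  have e6 := hx.rtt.diag 0 1 0 1 (by decide) (by decide)
  have db : x 1 1 * x 0 1 = q⁻¹ • (x 0 1 * x 1 1) := by rw [e4, inv_smul_smul₀ hq]
  have dc : x 1 1 * x 1 0 = q⁻¹ • (x 1 0 * x 1 1) := by rw [e2, inv_smul_smul₀ hq]
  have ad : x 0 0 * x 1 1 = qdet q x + q • (x 0 1 * x 1 0) := by rw [qdet_two]; abel
  have da : x 1 1 * x 0 0 = qdet q x + q⁻¹ • (x 0 1 * x 1 0) := by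
    rw [← sub_sub_cancel (x 0 0 * x 1 1) (x 1 1 * x 0 0), e6, ad, sub_smul]; abel
  have hcomm := hx.rtt.commute_qdet_two hq
  set δ := qdet q x
  set V := LinearMap.range (LinearMap.mulLeft ℂ δ) ⊔
    Submodule.span ℂ (Set.range (detMonomial x)) with hV
  have hdet (m : M) : δ * m ∈ V :=
    Submodule.mem_sup_left ⟨m, rfl⟩
  have hmon (p : ℕ × ℕ × ℤ) : detMonomial x p ∈ V :=
    Submodule.mem_sup_right (Submodule.subset_span ⟨p, rfl⟩)
  have hmon' (j k i : ℕ) : x 0 1 ^ j * x 1 0 ^ k * x 0 0 ^ i ∈ V := by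
    simpa [detMonomial] using hmon (j, k, i)
  have hmon'' (j k i : ℕ) : x 0 1 ^ j * x 1 0 ^ k * x 1 1 ^ i ∈ V := by
    simpa [detMonomial] using hmon (j, k, -i)
  have hpow (t : M) (ht : t * x 0 1 = x 0 1 * t) (j : ℕ) : t * x 0 1 ^ j = x 0 1 ^ j * t :=
    ((show Commute t (x 0 1) from ht).pow_right j).eq
  have hδ (j k : ℕ) : x 0 1 ^ j * x 1 0 ^ k * δ = δ * (x 0 1 ^ j * x 1 0 ^ k) :=
    (((show Commute (x 0 1) δ from hcomm 0 1).pow_left j).mul_left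
      ((show Commute (x 1 0) δ from hcomm 1 0).pow_left k)).eq
  have hbc (j k : ℕ) : x 0 1 ^ j * x 1 0 ^ k * (x 0 1 * x 1 0) = x 0 1 ^ (j + 1) * x 1 0 ^ (k + 1) := by
    rw [pow_succ, pow_succ, ← mul_assoc, mul_assoc _ _ (x 0 1),
      ((show Commute (x 1 0) (x 0 1) from e5.symm).pow_left k).eq]
    simp only [mul_assoc]
  have hmul (i j : Fin 2) (v : M) (hv : v ∈ V) : x i j * v ∈ V := by
    suffices V ≤ V.comap (LinearMap.mulLeft ℂ (x i j)) from this hv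
    rw [hV, sup_le_iff, ← hV]
    constructor
    · rintro _ ⟨m, rfl⟩
      rw [Submodule.mem_comap, LinearMap.mulLeft_apply, LinearMap.mulLeft_apply, ← mul_assoc, hcomm,
        mul_assoc]
      exact hdet _
    rw [Submodule.span_le]
    have key : ∀ j' k' n' : ℕ, x i j * (x 0 1 ^ j' * x 1 0 ^ k' * x 0 0 ^ n') ∈ V ∧
        x i j * (x 0 1 ^ j' * x 1 0 ^ k' * x 1 1 ^ n') ∈ V := by
      intro j' k' n'
      have hb (t : M) : x 0 1 * (x 0 1 ^ j' * x 1 0 ^ k' * t) = x 0 1 ^ (j' + 1) * x 1 0 ^ k' * t := by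
        rw [pow_succ']; simp only [mul_assoc]
      have hc (t : M) : x 1 0 * (x 0 1 ^ j' * x 1 0 ^ k' * t) = x 0 1 ^ j' * x 1 0 ^ (k' + 1) * t := by
        rw [← mul_assoc, ← mul_assoc, hpow _ e5.symm, pow_succ']; simp only [mul_assoc]
      have ha (t : M) : x 0 0 * (x 0 1 ^ j' * x 1 0 ^ k' * t)
          = (q ^ j' * q ^ k') • (x 0 1 ^ j' * x 1 0 ^ k' * (x 0 0 * t)) := by
        rw [← mul_assoc, ← mul_assoc, mul_pow_of_skew e1, smul_mul_assoc, mul_assoc _ (x 0 0),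
          mul_pow_of_skew e3, mul_smul_comm, smul_smul, smul_mul_assoc]
        simp only [mul_assoc]
      have hd (t : M) : x 1 1 * (x 0 1 ^ j' * x 1 0 ^ k' * t)
          = (q⁻¹ ^ j' * q⁻¹ ^ k') • (x 0 1 ^ j' * x 1 0 ^ k' * (x 1 1 * t)) := by
        rw [← mul_assoc, ← mul_assoc, mul_pow_of_skew db, smul_mul_assoc, mul_assoc _ (x 1 1),
          mul_pow_of_skew dc, mul_smul_comm, smul_smul, smul_mul_assoc]
        simp only [mul_assoc]
      revert i j
      simp only [Fin.forall_fin_two]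
      refine ⟨⟨?_, ?_⟩, ?_, ?_⟩
      · simp only [ha]
        refine ⟨V.smul_mem _ ?_, V.smul_mem _ ?_⟩
        · rw [← pow_succ']; exact hmon' _ _ _
        · cases n' with
          | zero => simpa using hmon' j' k' 1
          | succ n =>
            rw [pow_succ', ← mul_assoc (x 0 0), ad, add_mul, mul_add, ← mul_assoc, hδ, mul_assoc,
              smul_mul_assoc, mul_smul_comm, ← mul_assoc _ (x 0 1 * x 1 0), hbc]
            exact V.add_mem (hdet _) (V.smul_mem _ (hmon'' _ _ _))
      · simp only [hb]
        exact ⟨hmon' _ _ _, hmon'' _ _ _⟩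
      · simp only [hc]
        exact ⟨hmon' _ _ _, hmon'' _ _ _⟩
      · simp only [hd]
        refine ⟨V.smul_mem _ ?_, V.smul_mem _ ?_⟩
        · cases n' with
          | zero => simpa using hmon'' j' k' 1
          | succ n =>
            rw [pow_succ', ← mul_assoc (x 1 1), da, add_mul, mul_add, ← mul_assoc, hδ, mul_assoc,
              smul_mul_assoc, mul_smul_comm, ← mul_assoc _ (x 0 1 * x 1 0), hbc]
            exact V.add_mem (hdet _) (V.smul_mem _ (hmon' _ _ _))
        · rw [← pow_succ']; exact hmon'' _ _ _
    rintro _ ⟨⟨j', k', n'⟩, rfl⟩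
    simp only [SetLike.mem_coe, Submodule.mem_comap, LinearMap.mulLeft_apply]
    obtain ⟨n, rfl | rfl⟩ := n'.eq_nat_or_neg
    · simpa [detMonomial] using (key j' k' n).1
    · simpa [detMonomial] using (key j' k' n).2
  have htop : ∀ f v : M, v ∈ V → f * v ∈ V := by
    intro f
    have hf : f ∈ Algebra.adjoin ℂ (Set.range fun p : Fin 2 × Fin 2 => x p.1 p.2) := by
      rw [hx.gen]; trivial
    induction hf using Algebra.adjoin_induction with
    | mem _ h0 => obtain ⟨p, rfl⟩ := h0; exact hmul _ _
    | algebraMap r =>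
      intro v hv
      rw [← Algebra.smul_def]; exact V.smul_mem _ hv
    | add a b _ _ h1 h2 => intro v hv; rw [add_mul]; exact V.add_mem (h1 v hv) (h2 v hv)
    | mul a b _ _ h1 h2 => intro v hv; rw [mul_assoc]; exact h1 _ (h2 v hv)
  have h1 := htop f 1 (by simpa using hmon' 0 0 0)
  rw [mul_one] at h1
  obtain ⟨_, ⟨g, rfl⟩, s, hs, rfl⟩ := Submodule.mem_sup.1 h1
  exact ⟨g, by simpa using hs⟩

/-- The rank one specialization has kernel generated by the quantum determinant. -/
lemma IsUniversalQuantumMatrix.exists_rank_one (hq : q ≠ 0) (hx : IsUniversalQuantumMatrix q x) :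
    ∃ u v : Fin 2 → ShiftEnd, u 0 * u 1 = q • (u 1 * u 0) ∧ v 0 * v 1 = q • (v 1 * v 0) ∧
      (∀ i j, Commute (u i) (v j)) ∧ ∀ ρ : M →ₐ[ℂ] ShiftEnd, (∀ i j, ρ (x i j) = u i * v j) →
        ∀ f, ρ f = 0 → ∃ g, f = qdet q x * g := by
  let m (b : Bool) (i : Fin 2) : ShiftLattice →+ ℤ := if i = 0 then 0 else coord b 0 0
  have hm (b c : Bool) (i j : Fin 2) : m b i (basisVec c 0 j) = if b = c ∧ i = 1 ∧ j = 0 then 1 else 0 := by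
    revert i j
    simp [Fin.forall_fin_two, m, coord_basisVec]
  let w (b : Bool) (i : Fin 2) : ShiftEnd := qShift q (m b i) (basisVec b 0 i)
  have hw (b : Bool) : w b 0 * w b 1 = q • (w b 1 * w b 0) := by
    simp only [w]
    rw [qShift_mul_comm hq, hm, hm]
    simp
  refine ⟨w false, w true, hw _, hw _, fun i j => qShift_commute hq (by simp [hm]),
    fun ρ hρ f hf => ?_⟩
  obtain ⟨g, hg⟩ := hx.exists_eq_det_mul_add hq f
  obtain ⟨c, hc⟩ := Finsupp.mem_span_range_iff_exists_finsupp.1 hg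
  have hmono (i j : Fin 2) :
      IsShiftMonomial q (ρ (x i j)) (basisVec false 0 i + basisVec true 0 j) := by
    rw [hρ]; exact (isShiftMonomial_qShift _ _).mul hq (isShiftMonomial_qShift _ _)
  have hdet : ρ (qdet q x) = 0 := by
    have hvw : w true 1 * w true 0 = q⁻¹ • (w true 0 * w true 1) := by rw [hw, inv_smul_smul₀ hq]
    have hc (i j) : Commute (w true i) (w false j) := qShift_commute hq (by simp [hm])
    rw [qdet_two, map_sub, map_smul, map_mul, map_mul, hρ, hρ, hρ, hρ, mul_assoc, mul_assoc,
      ← mul_assoc (w true 0), ← mul_assoc (w true 1), (hc 0 1).eq, (hc 1 1).eq, mul_assoc, mul_assoc,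
      hvw, mul_smul_comm, mul_smul_comm, smul_inv_smul₀ hq, sub_self]
  have hli : LinearIndependent ℂ fun p => ρ (detMonomial x p) := by
    refine linearIndependent_of_isShiftMonomial (q := q) (e := fun p =>
      p.1 • (basisVec false 0 (0 : Fin 2) + basisVec true 0 (1 : Fin 2))
      + p.2.1 • (basisVec false 0 (1 : Fin 2) + basisVec true 0 (0 : Fin 2))
      + p.2.2.toNat • (basisVec false 0 (0 : Fin 2) + basisVec true 0 (0 : Fin 2))
      + (-p.2.2).toNat • (basisVec false 0 (1 : Fin 2) + basisVec true 0 (1 : Fin 2))) ?_ fun p => ?_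
    · rintro ⟨j, k, n⟩ ⟨j', k', n'⟩ h
      have h1 := congrArg (coord false 0 0) h
      have h2 := congrArg (coord true 0 1) h
      have h3 := congrArg (coord false 0 1) h
      simp [coord_basisVec] at h1 h2 h3
      simp only [Prod.mk.injEq]
      omega
    · simp only [detMonomial, map_mul, map_pow]
      exact ((((hmono 0 1).pow hq _).mul hq ((hmono 1 0).pow hq _)).mul hq
        ((hmono 0 0).pow hq _)).mul hq ((hmono 1 1).pow hq _)
  have : c = 0 := by
    refine linearIndependent_iff.1 hli c ?_
    have := congrArg ρ hc
    rw [map_sub, map_mul, hdet, hf, zero_mul, sub_zero, Finsupp.sum, map_sum] at this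
    rw [Finsupp.linearCombination_apply, Finsupp.sum, ← this]
    simp only [map_smul]
  rw [this, Finsupp.sum_zero_index] at hc
  exact ⟨g, (sub_eq_zero.1 hc.symm)⟩

end TwoByTwo

lemma isQuantumMatrix_diagonal {N : ℕ} {q : ℂ} {B : Type} [Ring B] [Algebra ℂ B] (hq : q ≠ 0)
    (d : Fin N → B) (hd : ∀ i j, Commute (d i) (d j)) :
    IsQuantumMatrix q fun i j => if i = j then d i else 0 := by
  refine .of_rels hq ?_ ?_ ?_ ?_
  · intro i j l h
    by_cases h1 : i = j <;> by_cases h2 : i = l <;> simp_all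
  · intro i j l h
    by_cases h1 : i = l <;> by_cases h2 : j = l <;> simp_all
  · intro i k j l h h'
    by_cases h1 : i = l <;> by_cases h2 : k = j <;> simp_all
    omega
  · intro i k j l h h'
    have h3 : ((if i = l then d i else 0) * if k = j then d k else 0) = 0 := by
      by_cases h1 : i = l <;> by_cases h2 : k = j <;> simp_all
      omega
    rw [h3, smul_zero, sub_eq_zero]
    by_cases h1 : i = j <;> by_cases h2 : k = l <;> simp_all [(hd _ _).eq]

section TwistedTrace

variable {N : ℕ} {q : ℂ} {M : Type} [Ring M] [Algebra ℂ M] {x : Fin N → Fin N → M}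

lemma sum_qWeight_smul_mem_twistCocomm (hq : q ≠ 0) {ΔM : M →ₐ[ℂ] M ⊗[ℂ] M}
    (hΔ : ∀ i j, ΔM (x i j) = ∑ k, x i k ⊗ₜ[ℂ] x k j)
    {D : M →ₐ[ℂ] M} (hD : ∀ i j, D (x i j) = twistCoeff q i j • x i j) :
    ∑ i : Fin N, qWeight q i • x i i ∈ twistCocomm ΔM D := by
  have hw (i k : Fin N) : qWeight q i * twistCoeff q i k = qWeight q k := by
    simp only [twistCoeff, qWeight, mul_add, pow_add, inv_pow]
    field_simp
  rw [mem_twistCocomm]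
  simp only [map_sum, map_smul, hΔ, Algebra.TensorProduct.comm_tmul, Algebra.TensorProduct.map_tmul,
    AlgHom.id_apply, hD, tmul_smul, Finset.smul_sum, smul_smul, hw]
  exact Finset.sum_comm

end TwistedTrace

section TwoByTwo

variable {q : ℂ} {M : Type} [Ring M] [Algebra ℂ M] {x : Fin 2 → Fin 2 → M}

lemma comul_qdet {N : ℕ} {M : Type} [Ring M] [Algebra ℂ M] {x : Fin N → Fin N → M}
    (hq : q ≠ 0) (hx : IsQuantumMatrix q x) {ΔM : M →ₐ[ℂ] M ⊗[ℂ] M}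
    (hΔ : ∀ i j, ΔM (x i j) = ∑ k, x i k ⊗ₜ[ℂ] x k j) :
    ΔM (qdet q x) = qdet q x ⊗ₜ qdet q x := by
  rw [qdet, qMinor_eq_qDet, comul_qDet hq hx hΔ, Finset.sum_eq_single Finset.univ]
  · intro K _ hK
    rw [qDet_eq_zero_of_card_ne, zero_tmul]
    rw [Finset.length_sort]
    exact fun h => hK (Finset.card_eq_iff_eq_univ _ |>.1 (by simpa using h))
  · simp

lemma IsUniversalQuantumMatrix.mem_twistCocomm_of_det_mul (hq : q ≠ 0)
    (hx : IsUniversalQuantumMatrix q x) {ΔM : M →ₐ[ℂ] M ⊗[ℂ] M}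
    (hΔ : ∀ i j, ΔM (x i j) = ∑ k, x i k ⊗ₜ[ℂ] x k j)
    {D : M →ₐ[ℂ] M} (hD : ∀ i j, D (x i j) = twistCoeff q i j • x i j) {g : M}
    (h : qdet q x * g ∈ twistCocomm ΔM D) : g ∈ twistCocomm ΔM D := by
  have hinj : Function.Injective (LinearMap.mulLeft ℂ (qdet q x)) := by
    obtain ⟨G, hG, hu⟩ := exists_injective_isUnit hq hx
    intro a b hab
    refine hG (hu.mul_left_cancel ?_)
    rw [← map_mul, ← map_mul]
    exact congrArg G hab
  have hinj' : Function.Injective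
      (TensorProduct.map (LinearMap.mulLeft ℂ (qdet q x)) (LinearMap.mulLeft ℂ (qdet q x))) :=
    TensorProduct.map_injective_of_flat_flat _ _ hinj hinj
  have hmul (t : M ⊗[ℂ] M) : TensorProduct.map (LinearMap.mulLeft ℂ (qdet q x))
      (LinearMap.mulLeft ℂ (qdet q x)) t = (qdet q x ⊗ₜ qdet q x) * t := by
    induction t using TensorProduct.induction_on with
    | zero => simp
    | add s t hs ht => rw [map_add, hs, ht, mul_add]
    | tmul a b => simp
  have hDdet : D (qdet q x) = qdet q x := by
    simp only [qdet_two, map_sub, map_mul, map_smul, hD, smul_mul_smul_comm, twistCoeff]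
    simp [hq]
  rw [mem_twistCocomm] at h ⊢
  apply hinj'
  rw [hmul, hmul]
  simpa [comul_qdet hq hx.rtt hΔ, hDdet] using h

lemma IsUniversalQuantumMatrix.restrict_two_symm (hq : q ≠ 0)
    (hx : IsUniversalQuantumMatrix q x) {ΔM : M →ₐ[ℂ] M ⊗[ℂ] M}
    (hΔ : ∀ i j, ΔM (x i j) = ∑ k, x i k ⊗ₜ[ℂ] x k j)
    {D : M →ₐ[ℂ] M} (hD : ∀ i j, D (x i j) = twistCoeff q i j • x i j)
    {r : M →ₐ[ℂ] MvPolynomial (Fin 2) ℂ}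
    (hr : ∀ i j, r (x i j) = if i = j then MvPolynomial.X i else 0)
    {f : M} (hf : f ∈ twistCocomm ΔM D) :
    MvPolynomial.aeval ![(q ^ 2)⁻¹ • MvPolynomial.X 1, q ^ 2 • MvPolynomial.X 0] (r f)
      = (r f : MvPolynomial (Fin 2) ℂ) := by
  obtain ⟨u, v, hu, hv, huv, hker⟩ := hx.exists_rank_one hq
  obtain ⟨π, hπ⟩ := hx.lift (Polynomial ℂ) _ (isQuantumMatrix_diagonal hq
    ![q ^ 2 • Polynomial.X, 0] fun _ _ => Commute.all _ _)
  obtain ⟨φ, hφ⟩ := hx.lift _ (fun i j => if j = 0 then u i else 0) <| by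
    refine .of_rels hq ?_ ?_ ?_ ?_ <;> simp [Fin.forall_fin_two, hu]
  obtain ⟨ψ, hψ⟩ := hx.lift _ (fun i j => if i = 0 then v j else 0) <| by
    refine .of_rels hq ?_ ?_ ?_ ?_ <;> simp [Fin.forall_fin_two, hv]
  obtain ⟨g₁, g₂, h₁, h₂, H⟩ := hx.exists_convolution hΔ hD (φ := φ) (ψ := ψ) fun i j k l => by
    rw [hφ, hψ]
    split_ifs <;> simp [huv]
  set s := MvPolynomial.aeval (R := ℂ) ![(q ^ 2)⁻¹ • (MvPolynomial.X 1 : MvPolynomial (Fin 2) ℂ),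
    q ^ 2 • MvPolynomial.X 0] with hs
  have hfac : g₂ = (Polynomial.aeval ((q ^ 2)⁻¹ • g₂ (x 0 0))).comp π := by
    refine hx.ext fun i j => ?_
    rw [AlgHom.comp_apply, hπ]
    revert i j
    simp [Fin.forall_fin_two, h₂, hφ, hψ, hq]
  have hdvd (f : M) (hf : f ∈ twistCocomm ΔM D) (hπf : π f = 0) : ∃ g, f = qdet q x * g := by
    refine hker g₁ (fun i j => by simp [h₁, hφ, hψ]) f ?_
    rw [H f hf, hfac, AlgHom.comp_apply, hπf, map_zero]
  set τ := ∑ i : Fin 2, qWeight q i • x i i with hτ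
  have hτC : τ ∈ twistCocomm ΔM D := sum_qWeight_smul_mem_twistCocomm hq hΔ hD
  have hπτ : π τ = Polynomial.X := by
    simp [hτ, hπ, qWeight, hq]
  have hsτ : s (r τ) = r τ := by
    simp [hτ, hr, hs, qWeight, smul_smul]
    rw [add_comm]
    congr 2 <;> field_simp
  have key (n : ℕ) : ∀ f ∈ twistCocomm ΔM D,
      (MvPolynomial.X 0 * MvPolynomial.X 1 : MvPolynomial (Fin 2) ℂ) ^ n ∣ s (r f) - r f := by
    induction n with
    | zero => simp
    | succ n ih =>
      intro f hf
      set P := Polynomial.aeval τ (π f) with hP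
      have hPC : P ∈ twistCocomm ΔM D :=
        Algebra.adjoin_le (Set.singleton_subset_iff.2 hτC) (Polynomial.aeval_mem_adjoin_singleton _ _)
      have hsP : s (r P) = r P := by
        rw [hP, ← Polynomial.aeval_algHom_apply, ← Polynomial.aeval_algHom_apply, hsτ]
      obtain ⟨g, hg⟩ := hdvd (f - P) (sub_mem hf hPC) (by
        rw [map_sub, hP, ← Polynomial.aeval_algHom_apply, hπτ, Polynomial.aeval_X_left_apply,
          sub_self])
      obtain ⟨t, ht⟩ := ih g (hx.mem_twistCocomm_of_det_mul hq hΔ hD (hg ▸ sub_mem hf hPC))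
      have hrdet : r (qdet q x) = MvPolynomial.X 0 * MvPolynomial.X 1 := by
        simp [qdet_two, hr]
      have hsdet : s (MvPolynomial.X 0 * MvPolynomial.X 1) = MvPolynomial.X 0 * MvPolynomial.X 1 := by
        simp [hs, hq, mul_comm]
      refine ⟨t, ?_⟩
      rw [sub_eq_iff_eq_add.1 hg, map_add, map_add, map_mul, map_mul, hsP, hrdet, hsdet,
        add_sub_add_right_eq_sub, ← mul_sub, ht]
      ring
  by_contra hne
  have hfin := FiniteMultiplicity.of_not_isUnit
    (a := (MvPolynomial.X 0 * MvPolynomial.X 1 : MvPolynomial (Fin 2) ℂ))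
    (fun h => by
      have := (isUnit_of_mul_isUnit_left h).map (MvPolynomial.aeval (R := ℂ) fun _ : Fin 2 => (0 : ℂ))
      simp at this) (sub_ne_zero.2 hne)
  obtain ⟨n, hn⟩ := hfin
  exact hn (key _ f hf)

end TwoByTwo

/-- The matrix which is `u` on the rows and columns `i₀, i₁`, and diagonal with entries `z`
elsewhere. -/
def blockMatrix {N : ℕ} {B : Type} [Ring B] [Algebra ℂ B] (i₀ i₁ : Fin N) (z : Fin N → ℂ)
    (u : Fin 2 → Fin 2 → B) (i j : Fin N) : B :=
  if i = i₀ then if j = i₀ then u 0 0 else if j = i₁ then u 0 1 else 0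
  else if i = i₁ then if j = i₀ then u 1 0 else if j = i₁ then u 1 1 else 0
  else if i = j then algebraMap ℂ B (z i) else 0

section BlockMatrix

variable {N : ℕ} {q : ℂ} {B : Type} [Ring B] [Algebra ℂ B] {i₀ i₁ : Fin N} {z : Fin N → ℂ}
  {u : Fin 2 → Fin 2 → B}

lemma blockMatrix_zero_zero : blockMatrix i₀ i₁ z u i₀ i₀ = u 0 0 := by simp [blockMatrix]

lemma blockMatrix_zero_one (h : i₀ < i₁) : blockMatrix i₀ i₁ z u i₀ i₁ = u 0 1 := by
  simp [blockMatrix, h.ne']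

lemma blockMatrix_one_zero (h : i₀ < i₁) : blockMatrix i₀ i₁ z u i₁ i₀ = u 1 0 := by
  simp [blockMatrix, h.ne']

lemma blockMatrix_one_one (h : i₀ < i₁) : blockMatrix i₀ i₁ z u i₁ i₁ = u 1 1 := by
  simp [blockMatrix, h.ne']

lemma blockMatrix_left {i : Fin N} (h₀ : i ≠ i₀) (h₁ : i ≠ i₁) (j : Fin N) :
    blockMatrix i₀ i₁ z u i j = if i = j then algebraMap ℂ B (z i) else 0 := by
  simp [blockMatrix, h₀, h₁]

lemma blockMatrix_right {i : Fin N} (h₀ : i ≠ i₀) (h₁ : i ≠ i₁) (j : Fin N) :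
    blockMatrix i₀ i₁ z u j i = if i = j then algebraMap ℂ B (z i) else 0 := by
  simp only [blockMatrix, h₀, h₁, if_false]
  by_cases h : i = j
  · simp [← h, h₀, h₁]
  · simp [h, Ne.symm h]

lemma IsQuantumMatrix.blockMatrix (hq : q ≠ 0) (hi : i₀.1 + 1 = i₁.1)
    (hu : IsQuantumMatrix q u) : IsQuantumMatrix q (blockMatrix i₀ i₁ z u) := by
  have h01 : i₀ < i₁ := by omega
  have tri (i : Fin N) : i = i₀ ∨ i = i₁ ∨ (i ≠ i₀ ∧ i ≠ i₁) := by tauto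
  have c (a : ℂ) (b : B) : b * algebraMap ℂ B a = algebraMap ℂ B a * b :=
    (Algebra.commutes a b).symm
  refine .of_rels hq ?_ ?_ ?_ ?_
  · intro i j l h
    rcases tri i with rfl | rfl | ⟨hi0, hi1⟩
    · rcases tri j with rfl | rfl | ⟨hj0, hj1⟩ <;> rcases tri l with rfl | rfl | ⟨hl0, hl1⟩ <;>
        first
        | (exfalso; omega)
        | (simp [blockMatrix_zero_zero, blockMatrix_zero_one, blockMatrix_right, *]; done)
        | (simpa only [blockMatrix_zero_zero, blockMatrix_zero_one h01] using hu.row 0 0 1 (by simp))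
    · rcases tri j with rfl | rfl | ⟨hj0, hj1⟩ <;> rcases tri l with rfl | rfl | ⟨hl0, hl1⟩ <;>
        first
        | (exfalso; omega)
        | (simp [blockMatrix_one_zero, blockMatrix_one_one, blockMatrix_right, *]; done)
        | (simpa only [blockMatrix_one_zero h01, blockMatrix_one_one h01] using hu.row 1 0 1 (by simp))
    · rw [blockMatrix_left hi0 hi1, blockMatrix_left hi0 hi1]
      by_cases h1 : i = j <;> by_cases h2 : i = l <;> simp_all
  · intro i k j h
    rcases tri j with rfl | rfl | ⟨hj0, hj1⟩
    · rcases tri i with rfl | rfl | ⟨hi0, hi1⟩ <;> rcases tri k with rfl | rfl | ⟨hl0, hl1⟩ <;>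
        first
        | (exfalso; omega)
        | (simp [blockMatrix_zero_zero, blockMatrix_one_zero, blockMatrix_left, *]; done)
        | (simpa only [blockMatrix_zero_zero, blockMatrix_one_zero h01] using hu.col 0 1 0 (by simp))
    · rcases tri i with rfl | rfl | ⟨hi0, hi1⟩ <;> rcases tri k with rfl | rfl | ⟨hl0, hl1⟩ <;>
        first
        | (exfalso; omega)
        | (simp [blockMatrix_zero_one, blockMatrix_one_one, blockMatrix_left, *]; done)
        | (simpa only [blockMatrix_zero_one h01, blockMatrix_one_one h01] using hu.col 0 1 1 (by simp))
    · rw [blockMatrix_right hj0 hj1, blockMatrix_right hj0 hj1]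
      by_cases h1 : j = i <;> by_cases h2 : j = k <;> simp_all
  · intro i k j l h h'
    rcases tri i with rfl | rfl | ⟨hi0, hi1⟩
    · rcases tri k with rfl | rfl | ⟨hk0, hk1⟩
      · omega
      · rcases tri j with rfl | rfl | ⟨hj0, hj1⟩ <;> rcases tri l with rfl | rfl | ⟨hl0, hl1⟩ <;>
          first
          | (exfalso; omega)
          | (simp [blockMatrix_right, *])
          | (simpa only [blockMatrix_zero_one h01, blockMatrix_one_zero h01] using
              hu.anti 0 1 0 1 (by simp) (by simp))
      · rw [blockMatrix_left hk0 hk1]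
        split_ifs <;> simp [c]
    · rcases tri k with rfl | rfl | ⟨hk0, hk1⟩
      · omega
      · omega
      · rw [blockMatrix_left hk0 hk1]
        split_ifs <;> simp [c]
    · rw [blockMatrix_left hi0 hi1]
      split_ifs <;> simp [c]
  · intro i k j l h h'
    by_cases H : (i = i₀ ∧ k = i₁) ∧ (j = i₀ ∧ l = i₁)
    · obtain ⟨⟨rfl, rfl⟩, rfl, rfl⟩ := H
      simpa only [blockMatrix_zero_one h01, blockMatrix_one_zero h01, blockMatrix_zero_zero,
        blockMatrix_one_one h01] using hu.diag 0 1 0 1 (by simp) (by simp)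
    have hz : _root_.blockMatrix i₀ i₁ z u i l * _root_.blockMatrix i₀ i₁ z u k j = 0 := by
      clear c
      rcases tri i with rfl | rfl | ⟨hi0, hi1⟩ <;> rcases tri k with rfl | rfl | ⟨hk0, hk1⟩ <;>
      rcases tri j with rfl | rfl | ⟨hj0, hj1⟩ <;> rcases tri l with rfl | rfl | ⟨hl0, hl1⟩ <;>
      first
        | (exfalso; omega)
        | (simp [blockMatrix_left, blockMatrix_right, *]; done)
        | (simp only [blockMatrix_left, ne_eq, not_false_eq_true, *]
           split_ifs <;> first | (exfalso; omega) | simp)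
    rw [hz, smul_zero, sub_eq_zero]
    rcases tri i with rfl | rfl | ⟨hi0, hi1⟩
    · rcases tri k with rfl | rfl | ⟨hk0, hk1⟩
      · omega
      · rcases tri j with rfl | rfl | ⟨hj0, hj1⟩ <;> rcases tri l with rfl | rfl | ⟨hl0, hl1⟩ <;>
          first
          | (exfalso; omega)
          | (exfalso; tauto)
          | (simp [blockMatrix_right, *])
      · rw [blockMatrix_left hk0 hk1]
        split_ifs <;> simp [c]
    · rcases tri k with rfl | rfl | ⟨hk0, hk1⟩
      · omega
      · omega
      · rw [blockMatrix_left hk0 hk1]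
        split_ifs <;> simp [c]
    · rw [blockMatrix_left hi0 hi1]
      split_ifs <;> simp [c]

end BlockMatrix

section Restrict

variable {N : ℕ} {q : ℂ} {M : Type} [Ring M] [Algebra ℂ M] {x : Fin N → Fin N → M}

lemma IsUniversalQuantumMatrix.eval_restrict_symm (hq : q ≠ 0)
    (hx : IsUniversalQuantumMatrix q x) {ΔM : M →ₐ[ℂ] M ⊗[ℂ] M}
    (hΔ : ∀ i j, ΔM (x i j) = ∑ k, x i k ⊗ₜ[ℂ] x k j)
    {D : M →ₐ[ℂ] M} (hD : ∀ i j, D (x i j) = twistCoeff q i j • x i j)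
    {r : M →ₐ[ℂ] MvPolynomial (Fin N) ℂ}
    (hr : ∀ i j, r (x i j) = if i = j then MvPolynomial.X i else 0)
    {f : M} (hf : f ∈ twistCocomm ΔM D) {i₀ i₁ : Fin N} (hi : i₀.1 + 1 = i₁.1) (z : Fin N → ℂ)
    (a b : ℂ) :
    MvPolynomial.aeval (fun i => if i = i₀ then a else if i = i₁ then b else z i) (r f)
      = MvPolynomial.aeval (fun i => if i = i₀ then (q ^ 2)⁻¹ * b
          else if i = i₁ then q ^ 2 * a else z i) (r f) := by
  obtain ⟨M₂, _, _, x₂, hx₂⟩ := exists_isUniversalQuantumMatrix 2 q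
  obtain ⟨Δ₂, hΔ₂⟩ := hx₂.exists_comul
  obtain ⟨D₂, hD₂⟩ := hx₂.exists_twist
  obtain ⟨r₂, hr₂⟩ := hx₂.lift _ _ (isQuantumMatrix_diagonal (B := MvPolynomial (Fin 2) ℂ) hq
    MvPolynomial.X fun _ _ => Commute.all _ _)
  have h01 : i₀ < i₁ := by omega
  have tri (i : Fin N) : i = i₀ ∨ i = i₁ ∨ (i ≠ i₀ ∧ i ≠ i₁) := by tauto
  choose L hL using fun w : Fin N → ℂ =>
    hx.lift M₂ _ (IsQuantumMatrix.blockMatrix (z := w) hq hi hx₂.rtt)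
  have hsum (F : Fin N → M₂ ⊗[ℂ] M₂) (h : ∀ i, i ≠ i₀ → i ≠ i₁ → F i = 0) :
      ∑ i, F i = F i₀ + F i₁ := by
    rw [← Finset.sum_pair h01.ne]
    refine (Finset.sum_subset (Finset.subset_univ _) fun i _ h2 => ?_).symm
    simp only [Finset.mem_insert, Finset.mem_singleton, not_or] at h2
    exact h i h2.1 h2.2
  have hblock (w w' : Fin N → ℂ) (i j : Fin N) :
      ∑ k, blockMatrix i₀ i₁ w x₂ i k ⊗ₜ[ℂ] blockMatrix i₀ i₁ w' x₂ k j
        = blockMatrix i₀ i₁ (fun k => w k * w' k) (fun i j => Δ₂ (x₂ i j)) i j := by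
    rcases tri i with rfl | rfl | ⟨hi0, hi1⟩
    · rw [hsum _ fun k h0 h1 => by simp [blockMatrix_right, h0, h1]]
      rcases tri j with rfl | rfl | ⟨hj0, hj1⟩
      · simp [blockMatrix_zero_zero, blockMatrix_zero_one, blockMatrix_one_zero,
          h01, hΔ₂]
      · simp [blockMatrix_zero_zero, blockMatrix_zero_one,
          blockMatrix_one_one, h01, hΔ₂]
      · simp [blockMatrix_right, *]
    · rw [hsum _ fun k h0 h1 => by simp [blockMatrix_right, h0, h1]]
      rcases tri j with rfl | rfl | ⟨hj0, hj1⟩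
      · simp [blockMatrix_zero_zero, blockMatrix_one_zero,
          blockMatrix_one_one, h01, hΔ₂]
      · simp [blockMatrix_zero_one, blockMatrix_one_zero,
          blockMatrix_one_one, h01, hΔ₂]
      · simp [blockMatrix_right, *]
    · simp only [blockMatrix_left hi0 hi1, TensorProduct.ite_tmul, Finset.sum_ite_eq,
        Finset.mem_univ, if_true, TensorProduct.tmul_ite]
      simp only [Algebra.algebraMap_eq_smul_one, Algebra.TensorProduct.one_def, smul_tmul',
        tmul_smul, smul_smul, mul_comm]
  have hL1 (w w' : Fin N → ℂ) : (Algebra.TensorProduct.map (L w) (L w')).comp ΔM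
      = Δ₂.comp (L fun k => w k * w' k) := by
    refine hx.ext fun i j => ?_
    simp only [AlgHom.comp_apply, hΔ, map_sum, Algebra.TensorProduct.map_tmul, hL, hblock]
    simp only [blockMatrix]
    split_ifs <;> simp
  have hLD (w : Fin N → ℂ) : (L w).comp D = D₂.comp (L w) := by
    refine hx.ext fun i j => ?_
    simp only [AlgHom.comp_apply, hD, map_smul, hL]
    rcases tri i with rfl | rfl | ⟨hi0, hi1⟩
    · rcases tri j with rfl | rfl | ⟨hj0, hj1⟩
      · simp [blockMatrix_zero_zero, hD₂, twistCoeff, hq]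
      · simp [blockMatrix_zero_one, hD₂, twistCoeff, h01, ← hi, mul_add, pow_add]
        congr 1
        field_simp
      · simp only [blockMatrix_right hj0 hj1]
        split_ifs with h <;> simp [h, twistCoeff, hq]
    · rcases tri j with rfl | rfl | ⟨hj0, hj1⟩
      · simp [blockMatrix_one_zero, hD₂, twistCoeff, h01, ← hi, mul_add, pow_add]
        congr 1
        field_simp
      · simp [blockMatrix_one_one, hD₂, twistCoeff, hq, h01]
      · simp only [blockMatrix_right hj0 hj1]
        split_ifs with h <;> simp [h, twistCoeff, hq]
    · rw [blockMatrix_left hi0 hi1]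
      split_ifs with h <;> simp [h, twistCoeff, hq]
  have hmem : L z f ∈ twistCocomm Δ₂ D₂ := by
    have h1 := DFunLike.congr_fun (hL1 z 1) f
    have h2 := DFunLike.congr_fun (hL1 1 z) f
    simp only [AlgHom.comp_apply, Pi.one_apply, mul_one, one_mul] at h1 h2
    have key (t : M ⊗[ℂ] M) :
        Algebra.TensorProduct.map (.id ℂ M₂) D₂ (Algebra.TensorProduct.comm ℂ M₂ M₂
          (Algebra.TensorProduct.map (L z) (L 1) t))
        = Algebra.TensorProduct.map (L 1) (L z) (Algebra.TensorProduct.map (.id ℂ M) D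
          (Algebra.TensorProduct.comm ℂ M M t)) := by
      induction t using TensorProduct.induction_on with
      | zero => simp
      | add s t hs ht => simp only [map_add, hs, ht]
      | tmul c d =>
        simpa using congrArg (L 1 d ⊗ₜ[ℂ] ·) (DFunLike.congr_fun (hLD z) c).symm
    rw [mem_twistCocomm] at hf ⊢
    rw [← h1, key, ← hf, h1, h2]
  have heval (a b : ℂ) :
      ((MvPolynomial.aeval fun i => if i = i₀ then a else if i = i₁ then b else z i).comp r)
        = ((MvPolynomial.aeval ![a, b]).comp r₂).comp (L z) := by
    refine hx.ext fun i j => ?_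
    simp only [AlgHom.comp_apply, hr, hL]
    rcases tri i with rfl | rfl | ⟨hi0, hi1⟩
    · rcases tri j with rfl | rfl | ⟨hj0, hj1⟩
      · simp [blockMatrix_zero_zero, hr₂]
      · simp [blockMatrix_zero_one, hr₂, h01, h01.ne]
      · simp [blockMatrix_right, *, hj0.symm]
    · rcases tri j with rfl | rfl | ⟨hj0, hj1⟩
      · simp [blockMatrix_one_zero, hr₂, h01, h01.ne']
      · simp [blockMatrix_one_one, hr₂, h01, h01.ne']
      · simp [blockMatrix_right, *, hj1.symm]
    · rw [blockMatrix_left hi0 hi1]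
      split_ifs with h <;> simp [hi0, hi1]
  have h1 := DFunLike.congr_fun (heval a b) f
  have h2 := DFunLike.congr_fun (heval ((q ^ 2)⁻¹ * b) (q ^ 2 * a)) f
  rw [AlgHom.comp_apply, AlgHom.comp_apply, AlgHom.comp_apply] at h1 h2
  rw [h1, h2]
  conv_lhs => rw [← hx₂.restrict_two_symm hq hΔ₂ hD₂ hr₂ hmem]
  generalize r₂ (L z f) = p
  rw [← AlgHom.comp_apply]
  congr 1
  refine MvPolynomial.algHom_ext fun i => ?_
  fin_cases i <;> simp

end Restrict

lemma MvPolynomial.isSymmetric_of_adjacent {N : ℕ} {p : MvPolynomial (Fin N) ℂ}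
    (h : ∀ i j : Fin N, i.1 + 1 = j.1 → rename (Equiv.swap i j) p = p) : p.IsSymmetric := by
  intro e
  cases N with
  | zero => rw [Subsingleton.elim e 1]; exact rename_id_apply p
  | succ n =>
    have he : e ∈ Submonoid.closure
        (Set.range fun i : Fin n => Equiv.swap i.castSucc i.succ) := by
      rw [Equiv.Perm.mclosure_swap_castSucc_succ]; trivial
    induction he using Submonoid.closure_induction with
    | mem _ h0 => obtain ⟨i, rfl⟩ := h0; exact h _ _ (by simp)
    | one => exact rename_id_apply p
    | mul a b _ _ ha hb =>
      rw [Equiv.Perm.coe_mul, ← rename_rename, hb, ha]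

lemma MvPolynomial.IsSymmetric.mem_adjoin_esymm {N : ℕ} {p : MvPolynomial (Fin N) ℂ}
    (hp : p.IsSymmetric) :
    p ∈ Algebra.adjoin ℂ (Set.range fun i : Fin N => esymm (Fin N) ℂ (i.1 + 1)) := by
  obtain ⟨Q, hQ⟩ := esymmAlgHom_surjective ℂ (σ := Fin N) (n := N) (by simp) ⟨p, hp⟩
  have := congrArg Subtype.val hQ
  rw [esymmAlgHom_apply] at this
  rw [Algebra.adjoin_range_eq_range_aeval]
  exact ⟨Q, this⟩

section Generation

variable {N : ℕ} {q : ℂ} {M : Type} [Ring M] [Algebra ℂ M] {x : Fin N → Fin N → M}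

lemma restrict_tauCoinv {r : M →ₐ[ℂ] MvPolynomial (Fin N) ℂ}
    (hr : ∀ i j, r (x i j) = if i = j then MvPolynomial.X i else 0) (m : ℕ) :
    r (tauCoinv q q⁻¹ x m) = MvPolynomial.aeval (fun i => qWeight q i • MvPolynomial.X i)
      (MvPolynomial.esymm (Fin N) ℂ m) := by
  have hsort (I : Finset (Fin N)) :
      (I.sort.map fun i => (MvPolynomial.X i : MvPolynomial (Fin N) ℂ)).prod
        = ∏ i ∈ I, MvPolynomial.X i := by
    rw [← List.prod_toFinset _ (Finset.sort_nodup _ _), Finset.sort_toFinset]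
  rw [IsQuantumGL.tauCoinv_eq, MvPolynomial.esymm, map_sum, map_sum, Finset.powersetCard_eq_filter,
    Finset.powerset_univ]
  refine Finset.sum_congr rfl fun I _ => ?_
  rw [map_smul, map_qDet, qDet_sort_of_lower]
  · simp [hr, hsort, Finset.prod_smul]
  · intro i j h
    rw [hr, if_neg h.ne]

lemma IsUniversalQuantumMatrix.mem_adjoin_tauCoinv (hq : q ≠ 0)
    (hx : IsUniversalQuantumMatrix q x) {ΔM : M →ₐ[ℂ] M ⊗[ℂ] M}
    (hΔ : ∀ i j, ΔM (x i j) = ∑ k, x i k ⊗ₜ[ℂ] x k j)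
    {D : M →ₐ[ℂ] M} (hD : ∀ i j, D (x i j) = twistCoeff q i j • x i j)
    (hτ : ∀ m, tauCoinv q q⁻¹ x m ∈ twistCocomm ΔM D) {f : M} (hf : f ∈ twistCocomm ΔM D) :
    f ∈ Algebra.adjoin ℂ (Set.range fun i : Fin N => tauCoinv q q⁻¹ x (i.1 + 1)) := by
  obtain ⟨r, hr⟩ := hx.lift _ _ (isQuantumMatrix_diagonal (B := MvPolynomial (Fin N) ℂ) hq
    MvPolynomial.X fun _ _ => Commute.all _ _)
  set s := MvPolynomial.aeval (R := ℂ)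
    fun i : Fin N => qWeight q i • (MvPolynomial.X i : MvPolynomial (Fin N) ℂ) with hs
  set t := MvPolynomial.aeval (R := ℂ)
    fun i : Fin N => (qWeight q i)⁻¹ • (MvPolynomial.X i : MvPolynomial (Fin N) ℂ) with ht
  have hst (p : MvPolynomial (Fin N) ℂ) : s (t p) = p := by
    have : s.comp t = .id ℂ _ := MvPolynomial.algHom_ext fun i => by
      simp [hs, ht, smul_smul, qWeight_ne_zero hq]
    exact DFunLike.congr_fun this p
  have hsymm : (t (r f)).IsSymmetric := by
    refine MvPolynomial.isSymmetric_of_adjacent fun i j hij => MvPolynomial.funext fun z => ?_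
    have hw : qWeight q j = (q ^ 2)⁻¹ * qWeight q i := by
      simp only [qWeight, ← hij, mul_add, pow_add, inv_pow]
      ring
    have hne : j ≠ i := by omega
    have h := hx.eval_restrict_symm hq hΔ hD hr hf hij
      (fun k => (qWeight q k)⁻¹ * z k) ((qWeight q i)⁻¹ * z i) ((qWeight q j)⁻¹ * z j)
    have ht' (z : Fin N → ℂ) : MvPolynomial.eval z (t (r f))
        = MvPolynomial.aeval (fun k => (qWeight q k)⁻¹ * z k) (r f) := by
      rw [← MvPolynomial.aeval_eq_eval, ht, ← AlgHom.comp_apply]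
      congr 1
      exact MvPolynomial.algHom_ext fun k => by simp
    rw [MvPolynomial.eval_rename, ht', ht']
    have e1 : (fun k => if k = i then (qWeight q i)⁻¹ * z i
        else if k = j then (qWeight q j)⁻¹ * z j else (qWeight q k)⁻¹ * z k)
        = fun k => (qWeight q k)⁻¹ * z k := by
      funext k
      split_ifs with h1 h2 <;> simp [*]
    have e2 : (fun k => if k = i then (q ^ 2)⁻¹ * ((qWeight q j)⁻¹ * z j)
        else if k = j then q ^ 2 * ((qWeight q i)⁻¹ * z i) else (qWeight q k)⁻¹ * z k)
        = fun k => (qWeight q k)⁻¹ * (z ∘ Equiv.swap i j) k := by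
      have := qWeight_ne_zero hq i
      funext k
      split_ifs with h1 h2
      · subst h1
        rw [hw, Function.comp_apply, Equiv.swap_apply_left]
        field_simp
      · subst h2
        rw [hw, Function.comp_apply, Equiv.swap_apply_right]
        field_simp
      · rw [Function.comp_apply, Equiv.swap_apply_of_ne_of_ne h1 h2]
    rw [← e1, ← e2, h]
  have hmem : r f ∈ (Algebra.adjoin ℂ
      (Set.range fun i : Fin N => tauCoinv q q⁻¹ x (i.1 + 1))).map r := by
    rw [AlgHom.map_adjoin, ← Set.range_comp]
    have h1 := Subalgebra.mem_map.2 ⟨_, hsymm.mem_adjoin_esymm, hst (r f)⟩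
    rw [AlgHom.map_adjoin, ← Set.range_comp] at h1
    have h2 : (r ∘ fun i : Fin N => tauCoinv q q⁻¹ x (i.1 + 1))
        = s ∘ fun i : Fin N => MvPolynomial.esymm (Fin N) ℂ (i.1 + 1) :=
      funext fun i => restrict_tauCoinv hr _
    rw [h2]
    exact h1
  obtain ⟨g, hg, hgf⟩ := Subalgebra.mem_map.1 hmem
  have hgC : g ∈ twistCocomm ΔM D :=
    Algebra.adjoin_le (by rintro _ ⟨i, rfl⟩; exact hτ _) hg
  have h0 := hx.eq_zero_of_restrict hq hΔ hD hr (sub_mem hf hgC)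
    (by rw [map_sub, hgf, sub_self])
  rw [sub_eq_zero.1 h0]
  exact hg

end Generation

lemma mul_mem_of_mem_adjoin_of_sub_algebraMap {M : Type} [Ring M] [Algebra ℂ M] (e : M →ₐ[ℂ] ℂ)
    (T : Set M) (W : Submodule ℂ M)
    (hW : ∀ t ∈ T, ∀ h : M, (t - algebraMap ℂ M (e t)) * h ∈ W) {f : M}
    (hf : f ∈ Algebra.adjoin ℂ T) : ∀ h : M, (f - algebraMap ℂ M (e f)) * h ∈ W := by
  induction hf using Algebra.adjoin_induction with
  | mem t ht => exact hW t ht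
  | algebraMap r => intro h; simp
  | add a b _ _ ha hb =>
    intro h
    have : (a + b - algebraMap ℂ M (e (a + b))) * h
        = (a - algebraMap ℂ M (e a)) * h + (b - algebraMap ℂ M (e b)) * h := by
      rw [map_add, map_add]; noncomm_ring
    rw [this]
    exact add_mem (ha h) (hb h)
  | mul a b _ _ ha hb =>
    intro h
    have : (a * b - algebraMap ℂ M (e (a * b))) * h
        = (a - algebraMap ℂ M (e a)) * (b * h) + e a • ((b - algebraMap ℂ M (e b)) * h) := by
      rw [map_mul, map_mul, Algebra.smul_def]; noncomm_ring
    rw [this]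
    exact add_mem (ha _) (W.smul_mem _ (hb h))

/-- The kernel of `β^ξ` contains the right ideal generated by the `β`-coinvariants
`f - f(ξ)`, which contains the right ideal generated by the `τ_i - τ_i(ξ)`;
for `q` not a root of unity (or `q = 1`) the two right ideals agree. -/
theorem ker_coorbit_beta_contains_coinvariants
    {N : ℕ} (q : ℂ) (hq : q ≠ 0)
    (M G : Type) [Ring M] [Algebra ℂ M] [Ring G] [Algebra ℂ G]
    (x : Fin N → Fin N → M)
    (hrow : ∀ i j l : Fin N, j < l → x i j * x i l = (q) • (x i l * x i j))
    (hcol : ∀ i k j : Fin N, i < k → x i j * x k j = (q) • (x k j * x i j))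
    (hanti : ∀ i k j l : Fin N, i < k → j < l → x i l * x k j = x k j * x i l)
    (hdiag : ∀ i k j l : Fin N, i < k → j < l →
      x i j * x k l - x k l * x i j = ((q) - (q⁻¹)) • (x i l * x k j))
    (hgen : Algebra.adjoin ℂ (Set.range fun p : Fin N × Fin N => x p.1 p.2) = ⊤)
    (hfree : ∀ (B : Type) [Ring B] [Algebra ℂ B] (y : Fin N → Fin N → B),
      (∀ i j l : Fin N, j < l → y i j * y i l = (q) • (y i l * y i j)) →
      (∀ i k j : Fin N, i < k → y i j * y k j = (q) • (y k j * y i j)) →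
      (∀ i k j l : Fin N, i < k → j < l → y i l * y k j = y k j * y i l) →
      (∀ i k j l : Fin N, i < k → j < l →
        y i j * y k l - y k l * y i j = ((q) - (q⁻¹)) • (y i l * y k j)) →
      ∃! φ : M →ₐ[ℂ] B, ∀ i j, φ (x i j) = y i j)
    (ι : M →ₐ[ℂ] G) (dInv : G)
    (hd1 : ι (qdet (q) x) * dInv = 1)
    (hd2 : dInv * ι (qdet (q) x) = 1)
    (hgenG : Algebra.adjoin ℂ
      (Set.range (fun p : Fin N × Fin N => ι (x p.1 p.2)) ∪ {dInv}) = ⊤)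
    (hfreeG : ∀ (B : Type) [Ring B] [Algebra ℂ B] (φ : M →ₐ[ℂ] B) (u : B),
      φ (qdet (q) x) * u = 1 → u * φ (qdet (q) x) = 1 →
      ∃! ψ : G →ₐ[ℂ] B, ψ.comp ι = φ)
    (ΔM : M →ₐ[ℂ] M ⊗[ℂ] M)
    (hΔM : ∀ i j, ΔM (x i j) = ∑ k, x i k ⊗ₜ[ℂ] x k j)
    (ΔG : G →ₐ[ℂ] G ⊗[ℂ] G)
    (hΔG : ∀ m, ΔG (ι m) = Algebra.TensorProduct.map ι ι (ΔM m))
    (εG : G →ₐ[ℂ] ℂ)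
    (hεG : ∀ i j, εG (ι (x i j)) = if i = j then 1 else 0)
    (St : G →ₗ[ℂ] G)
    (hS1 : LinearMap.mul' ℂ G ∘ₗ TensorProduct.map St LinearMap.id ∘ₗ ΔG.toLinearMap
      = Algebra.linearMap ℂ G ∘ₗ εG.toLinearMap)
    (hS2 : LinearMap.mul' ℂ G ∘ₗ TensorProduct.map LinearMap.id St ∘ₗ ΔG.toLinearMap
      = Algebra.linearMap ℂ G ∘ₗ εG.toLinearMap)
    (ξ : Matrix (Fin N) (Fin N) ℂ)
    (e : M →ₐ[ℂ] ℂ) (he : ∀ i j, e (x i j) = ξ i j) :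
    Submodule.span ℂ {y : M | ∃ (i : Fin N) (h : M),
        y = (tauCoinv q q⁻¹ x (i.1 + 1) - algebraMap ℂ M (e (tauCoinv q q⁻¹ x (i.1 + 1)))) * h}
      ≤ Submodule.span ℂ {y : M | ∃ f h : M,
        adjBeta ΔM ι St f = f ⊗ₜ[ℂ] (1 : G) ∧ y = (f - algebraMap ℂ M (e f)) * h}
    ∧ Submodule.span ℂ {y : M | ∃ f h : M,
        adjBeta ΔM ι St f = f ⊗ₜ[ℂ] (1 : G) ∧ y = (f - algebraMap ℂ M (e f)) * h}
      ≤ LinearMap.ker (coorbit e (adjBeta ΔM ι St))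
    ∧ (((∀ n : ℕ, 0 < n → q ^ n ≠ 1) ∨ q = 1) →
      Submodule.span ℂ {y : M | ∃ (i : Fin N) (h : M),
          y = (tauCoinv q q⁻¹ x (i.1 + 1) - algebraMap ℂ M (e (tauCoinv q q⁻¹ x (i.1 + 1)))) * h}
        = Submodule.span ℂ {y : M | ∃ f h : M,
          adjBeta ΔM ι St f = f ⊗ₜ[ℂ] (1 : G) ∧ y = (f - algebraMap ℂ M (e f)) * h}) := by
  have hx : IsUniversalQuantumMatrix q x :=
    { rtt := .of_rels hq hrow hcol hanti hdiag
      gen := hgen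
      lift := fun B _ _ y hy => (hfree B y hy.row hy.col hy.anti hy.diag).exists }
  have hG : IsQuantumGL q x ι ΔM ΔG εG St :=
    { ne_zero := hq
      univ := hx
      ext := fun {B} _ _ f g h => by
        have hι : f.comp ι = g.comp ι := hx.ext h
        have hdet : f (ι (qdet q x)) = g (ι (qdet q x)) := DFunLike.congr_fun hι _
        refine AlgHom.ext_of_adjoin_eq_top hgenG ?_
        rintro _ (⟨p, rfl⟩ | rfl)
        · exact h p.1 p.2
        · have h1 := congrArg f hd2
          have h2 := congrArg g hd1
          rw [map_mul, map_one] at h1 h2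
          exact left_inv_eq_right_inv h1 (hdet ▸ h2)
      lift := fun B _ _ φ hu => (hfreeG B φ _ hu.mul_val_inv hu.val_inv_mul).exists
      isUnit := ⟨⟨_, _, hd1, hd2⟩, rfl⟩
      comul := hΔM
      comulG := hΔG
      counit := hεG
      antipode_left := hS1
      antipode_right := hS2 }
  have hle : Submodule.span ℂ {y : M | ∃ (i : Fin N) (h : M),
        y = (tauCoinv q q⁻¹ x (i.1 + 1) - algebraMap ℂ M (e (tauCoinv q q⁻¹ x (i.1 + 1)))) * h}
      ≤ Submodule.span ℂ {y : M | ∃ f h : M,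
        adjBeta ΔM ι St f = f ⊗ₜ[ℂ] (1 : G) ∧ y = (f - algebraMap ℂ M (e f)) * h} := by
    refine Submodule.span_mono ?_
    rintro _ ⟨i, h, rfl⟩
    exact ⟨_, h, hG.adjBeta_tauCoinv _, rfl⟩
  refine ⟨hle, Submodule.span_le.2 ?_, fun _ => le_antisymm hle (Submodule.span_le.2 ?_)⟩
  · rintro _ ⟨f, h, hf, rfl⟩
    exact coorbit_eq_zero hG.antipode_mul hf e h
  · rintro _ ⟨f, h, hf, rfl⟩
    obtain ⟨D, hD⟩ := hx.exists_twist
    refine mul_mem_of_mem_adjoin_of_sub_algebraMap e _ _ ?_ (hx.mem_adjoin_tauCoinv hq hΔM hD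
      (fun m => hG.mem_twistCocomm_of_coinvariant hD (hG.adjBeta_tauCoinv m))
      (hG.mem_twistCocomm_of_coinvariant hD hf)) h
    rintro _ ⟨i, rfl⟩ h
    exact Submodule.subset_span ⟨i, h, rfl⟩
end
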